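/- For each graph G in {Z_eighth, Z_strong} there exists C0 > 0 such that for every C ≥ C0, the set q(G, t ↦ ⌈C·t^{6/7}⌉) equals q(G, ∞). That is, against the spreading function g(t) = ⌈C·t^{6/7}⌉ Container can win for exactly the same set of strengths q as in the Firefighter Problem solitaire (unrestricted spreading). -/

import Mathlib

open Set

/-- The number of vertices Container of strength `q` may delete at turn `t`:
`⌊t·q⌋ − ⌊(t−1)·q⌋`. -/
noncomputable def budget (q : ℝ) (t : ℕ) : ℕ :=
  (⌊(t : ℝ) * q⌋ - ⌊((t : ℝ) - 1) * q⌋).toNat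

/-- The cumulative deleted sets determined by a Container strategy `σ`
(mapping the history `[B 0, …, B t]` of occupied sets to the set of vertices deleted
at turn `t + 1`) against the occupied sets `B`. -/
def delSets {V : Type*} (σ : List (Set V) → Set V) (B : ℕ → Set V) : ℕ → Set V
  | 0 => ∅
  | t + 1 => delSets σ B t ∪ σ ((List.range (t + 1)).map B)

/-- Spreader's moves are legal with spread function `g` against cumulative deleted
sets `F`: occupied sets increase, at most `g (t + 1)` vertices are newly occupied at
turn `t + 1`, and each newly occupied vertex is undeleted and adjacent (with respect
to `adj`) to a previously occupied vertex. -/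
def SpreaderLegal {V : Type*} (adj : V → V → Prop) (g : ℕ → ℕ∞)
    (F B : ℕ → Set V) : Prop :=
  ∀ t : ℕ,
    B t ⊆ B (t + 1) ∧
    (B (t + 1) \ B t).encard ≤ g (t + 1) ∧
    ∀ v ∈ B (t + 1) \ B t, v ∉ F (t + 1) ∧ ∃ u ∈ B t, adj u v

/-- The Container strategy `σ` plays legally along occupied sets `B`: at every turn it
deletes only unoccupied vertices, and at most the budget of them. -/
def ContainerLegal {V : Type*} (q : ℝ) (σ : List (Set V) → Set V)
    (B : ℕ → Set V) : Prop :=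
  ∀ t : ℕ,
    σ ((List.range (t + 1)).map B) ∩ B t = ∅ ∧
    (σ ((List.range (t + 1)).map B)).encard ≤ (budget q (t + 1) : ℕ∞)

/-- Container of strength `q` wins the containment game on the graph `adj` with spread
function `g` and initial occupied set `B₀`, deleting only vertices of `A`: it has a
strategy which, against every legal Spreader play, is itself legal, deletes only
vertices of `A`, and forces the occupied set to eventually stabilize. -/
def ContainerWinsIn {V : Type*} (adj : V → V → Prop) (q : ℝ) (g : ℕ → ℕ∞)
    (B₀ : Set V) (A : Set V) : Prop :=
  ∃ σ : List (Set V) → Set V,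
    ∀ B : ℕ → Set V, B 0 = B₀ → SpreaderLegal adj g (delSets σ B) B →
      ContainerLegal q σ B ∧
      (∀ t : ℕ, σ ((List.range (t + 1)).map B) ⊆ A) ∧
      ∃ T : ℕ, ∀ t : ℕ, T ≤ t → B t = B T

/-- Container of strength `q` wins the containment game `(adj, q, g)` with initial
occupied set `B₀`. -/
def ContainerWins {V : Type*} (adj : V → V → Prop) (q : ℝ) (g : ℕ → ℕ∞)
    (B₀ : Set V) : Prop :=
  ContainerWinsIn adj q g B₀ Set.univ

/-- `q(G, g)`: the set of strengths `q > 0` for which Container wins the containment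
game `(adj, q, g)` from every finite initial occupied set. -/
def qSet {V : Type*} (adj : V → V → Prop) (g : ℕ → ℕ∞) : Set ℝ :=
  {q | 0 < q ∧ ∀ B₀ : Set V, B₀.Finite → ContainerWins adj q g B₀}

/-- The occupied sets determined by a Spreader strategy `τ` (mapping the history
`[F 1, …, F (t + 1)]` of cumulative deleted sets to the set of vertices newly occupied
at turn `t + 1`) against deleted sets `F`, starting from `B₀`. -/
def occSets {V : Type*} (τ : List (Set V) → Set V) (B₀ : Set V)
    (F : ℕ → Set V) : ℕ → Set V
  | 0 => B₀
  | t + 1 => occSets τ B₀ F t ∪ τ ((List.range (t + 1)).map fun i => F (i + 1))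

/-- The sequence `F` of cumulative deleted sets is a legal play of Container of
strength `q` against occupied sets `B`. -/
def ContainerSeqLegal {V : Type*} (q : ℝ) (F B : ℕ → Set V) : Prop :=
  F 0 = ∅ ∧ ∀ t : ℕ,
    F t ⊆ F (t + 1) ∧
    (F (t + 1) \ F t).encard ≤ (budget q (t + 1) : ℕ∞) ∧
    (F (t + 1) \ F t) ∩ B t = ∅

/-- Spreader wins the containment game `(adj, q, g)` with initial occupied set `B₀`:
it has a strategy which, against every legal Container play, is itself legal and
occupies new vertices at arbitrarily late times. -/
def SpreaderWins {V : Type*} (adj : V → V → Prop) (q : ℝ) (g : ℕ → ℕ∞)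
    (B₀ : Set V) : Prop :=
  ∃ τ : List (Set V) → Set V,
    ∀ F : ℕ → Set V, ContainerSeqLegal q F (occSets τ B₀ F) →
      SpreaderLegal adj g F (occSets τ B₀ F) ∧
      ∀ T : ℕ, ∃ t : ℕ, T ≤ t ∧ occSets τ B₀ F t ≠ occSets τ B₀ F T

/-- The strongly connected grid `ℤ ⊠ ℤ`. -/
def adjStrong (p q : ℤ × ℤ) : Prop :=
  max |p.1 - q.1| |p.2 - q.2| = 1

/-- The vertices of the eighth plane: `{(x, y) ∈ ℤ² : 0 ≤ x ≤ y}`. -/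
abbrev ZEighth : Type := {p : ℤ × ℤ // 0 ≤ p.1 ∧ p.1 ≤ p.2}

/-- The edges of the eighth plane: `(x, y) ~ (x + i, y + 1)` for `i ∈ {0, 1}`. -/
def adjEighth (p q : ZEighth) : Prop :=
  (q.val.2 = p.val.2 + 1 ∧ (q.val.1 = p.val.1 ∨ q.val.1 = p.val.1 + 1)) ∨
  (p.val.2 = q.val.2 + 1 ∧ (p.val.1 = q.val.1 ∨ p.val.1 = q.val.1 + 1))

section PartP1

abbrev Cell := ℕ × ℤ

noncomputable def nx (γ : ℕ) (X : Finset ℤ) : Finset ℤ := X.biUnion (fun x => Finset.Icc x (x + γ))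

noncomputable def run (γ : ℕ) (Y : Finset Cell) (j : ℕ) (X : Finset ℤ) : ℕ → Finset ℤ
  | 0 => X
  | n + 1 => (nx γ (run γ Y j X n)).filter (fun p => (j + n + 1, p) ∉ Y)

noncomputable def lo (γ : ℕ) (Y : Finset Cell) (j : ℕ) (X : Finset ℤ) (a : ℤ) : ℕ → ℤ
  | 0 => a
  | n + 1 => if lo γ Y j X a n ∈ run γ Y j X n then lo γ Y j X a n else lo γ Y j X a n + 1

noncomputable def hi (γ : ℕ) (Y : Finset Cell) (j : ℕ) (X : Finset ℤ) (b : ℤ) : ℕ → ℤ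
  | 0 => b
  | n + 1 => if hi γ Y j X b n ∈ run γ Y j X n then hi γ Y j X b n + γ
      else hi γ Y j X b n + γ - 1

/-- cells of `Y` in row `r`, positions `[a,b]` -/
def rowc (Y : Finset Cell) (r : ℕ) (a b : ℤ) : Finset Cell :=
  Y.filter (fun c => c.1 = r ∧ a ≤ c.2 ∧ c.2 ≤ b)

def cs (Y : Finset Cell) (j n : ℕ) (l h : ℕ → ℤ) : Finset Cell :=
  Y.filter (fun c => j < c.1 ∧ c.1 ≤ j + n ∧ l (c.1 - j) ≤ c.2 ∧ c.2 ≤ h (c.1 - j))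

noncomputable def val (γ : ℕ) (Y : Finset Cell) (j n : ℕ) (X : Finset ℤ) (a b : ℤ) : ℕ :=
  (run γ Y j X n).card + (cs Y j n (lo γ Y j X a) (hi γ Y j X b)).card

def rows (Z : Finset Cell) (j k : ℕ) : Finset Cell :=
  Z.filter (fun c => j < c.1 ∧ c.1 ≤ j + k)

def Lgl (ρ : ℕ) (j : ℕ) (Z : Finset Cell) : Prop := ∀ k, (rows Z j k).card ≤ ρ * k

def PP (γ ρ j n : ℕ) (X : Finset ℤ) (a b : ℤ) (F : Finset Cell) (v : ℤ) : Prop :=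
  ∀ Z, Lgl ρ j Z → v ≤ val γ (F ∪ Z) j n X a b

def kap (X : Finset ℤ) : ℕ := (X.filter (fun x => x + 1 ∉ X)).card

lemma mem_nx {γ : ℕ} {X : Finset ℤ} {p : ℤ} : p ∈ nx γ X ↔ ∃ x ∈ X, x ≤ p ∧ p ≤ x + γ := by
  simp [nx]

lemma nx_mono {γ : ℕ} {X X' : Finset ℤ} (h : X ⊆ X') : nx γ X ⊆ nx γ X' := by
  intro p; simp only [mem_nx]; rintro ⟨x, hx, h'⟩; exact ⟨x, h hx, h'⟩

lemma nx_union {γ : ℕ} {X X' : Finset ℤ} : nx γ (X ∪ X') = nx γ X ∪ nx γ X' := by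
  ext p; simp only [mem_nx, Finset.mem_union]; grind

lemma mem_run_succ {γ : ℕ} {Y : Finset Cell} {j : ℕ} {X : Finset ℤ} {n : ℕ} {p : ℤ} :
    p ∈ run γ Y j X (n+1) ↔ (∃ x ∈ run γ Y j X n, x ≤ p ∧ p ≤ x + γ) ∧ (j + n + 1, p) ∉ Y := by
  simp [run, mem_nx]

lemma run_congr {γ : ℕ} {Y Y' : Finset Cell} {j : ℕ} {X : Finset ℤ} (n : ℕ)
    (h : ∀ c : Cell, j < c.1 → c.1 ≤ j + n → (c ∈ Y ↔ c ∈ Y')) :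
    run γ Y j X n = run γ Y' j X n := by
  induction n with
  | zero => rfl
  | succ n ih =>
    have := ih (fun c h1 h2 => h c h1 (by omega))
    ext p
    simp only [mem_run_succ, this]
    rw [h (j+n+1, p) (by simp) (by simp)]

lemma run_mono {γ : ℕ} {Y Y' : Finset Cell} {j : ℕ} {X X' : Finset ℤ} (hX : X ⊆ X')
    (hY : Y' ⊆ Y) (n : ℕ) : run γ Y j X n ⊆ run γ Y' j X' n := by
  induction n with
  | zero => exact hX
  | succ n ih =>
    intro p; simp only [mem_run_succ]
    rintro ⟨⟨x, hx, h'⟩, h2⟩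
    exact ⟨⟨x, ih hx, h'⟩, fun h => h2 (hY h)⟩

lemma run_union {γ : ℕ} {Y : Finset Cell} {j : ℕ} {X X' : Finset ℤ} (n : ℕ) :
    run γ Y j (X ∪ X') n = run γ Y j X n ∪ run γ Y j X' n := by
  induction n with
  | zero => rfl
  | succ n ih => ext p; simp only [run, ih, nx_union, Finset.mem_union, Finset.mem_filter]; tauto

lemma run_add {γ : ℕ} {Y : Finset Cell} {j : ℕ} {X : Finset ℤ} (n k : ℕ) :
    run γ Y j X (n + k) = run γ Y (j + n) (run γ Y j X n) k := by
  induction k with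
  | zero => rfl
  | succ k ih => rw [← add_assoc, run, ih, run]; simp only [add_assoc]

lemma run_empty {γ : ℕ} {Y : Finset Cell} {j : ℕ} (n : ℕ) : run γ Y j ∅ n = ∅ := by
  induction n with
  | zero => rfl
  | succ n ih => simp [run, ih, nx]

lemma mem_run_iff {γ : ℕ} {Y : Finset Cell} {j : ℕ} {X : Finset ℤ} {n : ℕ} {p : ℤ} :
    p ∈ run γ Y j X n ↔ ∃ x ∈ X, p ∈ run γ Y j {x} n := by
  induction n generalizing p with
  | zero => simp [run]
  | succ n ih =>
    simp only [mem_run_succ]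
    constructor
    · rintro ⟨⟨x, hx, h⟩, h2⟩
      obtain ⟨x', hx', h'⟩ := ih.1 hx
      exact ⟨x', hx', ⟨x, h', h⟩, h2⟩
    · rintro ⟨x', hx', ⟨x, h', h⟩, h2⟩
      exact ⟨⟨x, ih.2 ⟨x', hx', h'⟩, h⟩, h2⟩

lemma run_cone {γ : ℕ} {Y : Finset Cell} {j : ℕ} {x : ℤ} {n : ℕ} {p : ℤ}
    (h : p ∈ run γ Y j {x} n) : x ≤ p ∧ p ≤ x + γ * n := by
  induction n generalizing p with
  | zero => simp [run] at h; simp [h]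
  | succ n ih =>
    obtain ⟨⟨y, hy, h⟩, -⟩ := mem_run_succ.1 h
    have := ih hy; push_cast; constructor <;> nlinarith

lemma lo_add {γ : ℕ} {Y : Finset Cell} {j : ℕ} {X : Finset ℤ} {a : ℤ} (n k : ℕ) :
    lo γ Y j X a (n + k) = lo γ Y (j + n) (run γ Y j X n) (lo γ Y j X a n) k := by
  induction k with
  | zero => rfl
  | succ k ih => rw [← add_assoc, lo, ih, lo, run_add]

lemma hi_add {γ : ℕ} {Y : Finset Cell} {j : ℕ} {X : Finset ℤ} {b : ℤ} (n k : ℕ) :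
    hi γ Y j X b (n + k) = hi γ Y (j + n) (run γ Y j X n) (hi γ Y j X b n) k := by
  induction k with
  | zero => rfl
  | succ k ih => rw [← add_assoc, hi, ih, hi, run_add]

lemma lo_congr {γ : ℕ} {Y Y' : Finset Cell} {j : ℕ} {X X' : Finset ℤ} {a : ℤ} (n : ℕ)
    (h : ∀ i < n, lo γ Y j X a i ∈ run γ Y j X i ↔ lo γ Y j X a i ∈ run γ Y' j X' i) :
    lo γ Y j X a n = lo γ Y' j X' a n := by
  induction n with
  | zero => rfl
  | succ n ih =>
    have e := ih (fun i hi => h i (by omega))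
    have := h n (by omega)
    rw [lo, lo, ← e]; simp only [this]

lemma hi_congr {γ : ℕ} {Y Y' : Finset Cell} {j : ℕ} {X X' : Finset ℤ} {b : ℤ} (n : ℕ)
    (h : ∀ i < n, hi γ Y j X b i ∈ run γ Y j X i ↔ hi γ Y j X b i ∈ run γ Y' j X' i) :
    hi γ Y j X b n = hi γ Y' j X' b n := by
  induction n with
  | zero => rfl
  | succ n ih =>
    have e := ih (fun i hi => h i (by omega))
    have := h n (by omega)
    rw [hi, hi, ← e]; simp only [this]

lemma lo_bd {γ : ℕ} {Y : Finset Cell} {j : ℕ} {X : Finset ℤ} {a : ℤ} (n : ℕ) :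
    a ≤ lo γ Y j X a n ∧ lo γ Y j X a n ≤ a + n := by
  induction n with
  | zero => simp [lo]
  | succ n ih => rw [lo]; push_cast; split_ifs <;> omega

lemma hi_bd {γ : ℕ} {Y : Finset Cell} {j : ℕ} {X : Finset ℤ} {b : ℤ} (n : ℕ) :
    b + γ * n - n ≤ hi γ Y j X b n ∧ hi γ Y j X b n ≤ b + γ * n := by
  induction n with
  | zero => simp [hi]
  | succ n ih => rw [hi]; push_cast; split_ifs <;> constructor <;> linarith

lemma run_sub {γ : ℕ} {Y : Finset Cell} {j : ℕ} {X : Finset ℤ} {a b : ℤ}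
    (h : X ⊆ Finset.Icc a b) (n : ℕ) :
    run γ Y j X n ⊆ Finset.Icc (lo γ Y j X a n) (hi γ Y j X b n) := by
  induction n with
  | zero => exact h
  | succ n ih =>
    intro p hp
    obtain ⟨⟨x, hx, h'⟩, -⟩ := mem_run_succ.1 hp
    have := Finset.mem_Icc.1 (ih hx)
    rw [Finset.mem_Icc, lo, hi]
    constructor
    · split_ifs with h1
      · omega
      · have : x ≠ lo γ Y j X a n := fun e => h1 (e ▸ hx)
        omega
    · split_ifs with h1
      · omega
      · have : x ≠ hi γ Y j X b n := fun e => h1 (e ▸ hx)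
        omega

lemma nx_sub {γ : ℕ} {Y : Finset Cell} {j : ℕ} {X : Finset ℤ} {a b : ℤ}
    (h : X ⊆ Finset.Icc a b) (n : ℕ) :
    nx γ (run γ Y j X n) ⊆ Finset.Icc (lo γ Y j X a (n+1)) (hi γ Y j X b (n+1)) := by
  intro p hp
  obtain ⟨x, hx, h'⟩ := mem_nx.1 hp
  have := Finset.mem_Icc.1 (run_sub h n hx)
  rw [Finset.mem_Icc, lo, hi]
  constructor
  · split_ifs with h1
    · omega
    · have : x ≠ lo γ Y j X a n := fun e => h1 (e ▸ hx)
      omega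
  · split_ifs with h1
    · omega
    · have : x ≠ hi γ Y j X b n := fun e => h1 (e ▸ hx)
      omega

lemma cs_succ (Y : Finset Cell) (j n : ℕ) (l h : ℕ → ℤ) :
    (cs Y j (n+1) l h).card = (cs Y j n l h).card + (rowc Y (j+n+1) (l (n+1)) (h (n+1))).card := by
  rw [← Finset.card_union_of_disjoint]
  · congr 1; ext ⟨r, p⟩
    simp only [cs, rowc, Finset.mem_union, Finset.mem_filter]
    by_cases hr : r = j + n + 1
    · subst hr
      have : j + n + 1 - j = n + 1 := by omega
      simp only [this]; grind
    · grind
  · rw [Finset.disjoint_left]; simp only [cs, rowc, Finset.mem_filter]; grind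

lemma cs_shift (Y : Finset Cell) (j n : ℕ) (l h : ℕ → ℤ) :
    (cs Y j (n+1) l h).card = (rowc Y (j+1) (l 1) (h 1)).card
      + (cs Y (j+1) n (fun i => l (1+i)) (fun i => h (1+i))).card := by
  rw [← Finset.card_union_of_disjoint]
  · congr 1; ext ⟨r, p⟩
    simp only [cs, rowc, Finset.mem_union, Finset.mem_filter]
    by_cases hr : r = j + 1
    · subst hr
      have : j + 1 - j = 1 := by omega
      simp only [this]; grind
    · by_cases h2 : j + 1 < r
      · have : 1 + (r - (j+1)) = r - j := by omega
        simp only [this]; grind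
      · grind
  · rw [Finset.disjoint_left]; simp only [cs, rowc, Finset.mem_filter]; grind

lemma card_nx {γ : ℕ} (hγ : 1 ≤ γ) {X : Finset ℤ} (hX : X.Nonempty) :
    X.card + γ + kap X ≤ (nx γ X).card + 1 := by
  classical
  set M := X.max' hX
  have hM : M ∈ X := X.max'_mem hX
  have hle : ∀ x ∈ X, x ≤ M := fun x hx => X.le_max' x hx
  set A := (X.filter (fun x => x + 1 ∉ X)).image (· + 1)
  have hA : A.card = kap X := Finset.card_image_of_injective _ (fun x y h => by simpa using h)
  have d1 : Disjoint X A := by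
    rw [Finset.disjoint_left]; intro x hx h
    simp only [A, Finset.mem_image, Finset.mem_filter] at h
    grind
  have d2 : Disjoint (X ∪ A) (Finset.Icc (M+2) (M+γ)) := by
    rw [Finset.disjoint_left]; intro x hx h
    simp only [A, Finset.mem_image, Finset.mem_filter, Finset.mem_union, Finset.mem_Icc] at hx h
    rcases hx with hx | ⟨y, hy, rfl⟩
    · have := hle x hx; omega
    · have := hle y hy.1; omega
  have hsub : (X ∪ A) ∪ Finset.Icc (M+2) (M+γ) ⊆ nx γ X := by
    intro p hp
    simp only [A, Finset.mem_image, Finset.mem_filter, Finset.mem_union, Finset.mem_Icc] at hp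
    rw [mem_nx]
    rcases hp with (hp | ⟨y, hy, rfl⟩) | hp
    · exact ⟨p, hp, le_rfl, by omega⟩
    · exact ⟨y, hy.1, by omega, by omega⟩
    · exact ⟨M, hM, by omega, by omega⟩
  have := Finset.card_le_card hsub
  rw [Finset.card_union_of_disjoint d2, Finset.card_union_of_disjoint d1, hA, Int.card_Icc] at this
  omega

lemma kap_sub {X X' : Finset ℤ} (h : X' ⊆ X) : kap X ≤ kap X' + (X \ X').card := by
  unfold kap
  rw [← Finset.card_union_of_disjoint]
  · apply Finset.card_le_card; intro x; simp only [Finset.mem_filter, Finset.mem_union, Finset.mem_sdiff]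
    grind
  · rw [Finset.disjoint_left]; simp only [Finset.mem_filter, Finset.mem_sdiff]; grind

/-- lost cells -/
lemma run_lost {γ : ℕ} (F Z : Finset Cell) (j n : ℕ) (X : Finset ℤ) :
    run γ F j X n ⊆ run γ (F ∪ Z) j X n ∪
      (rows Z j n).biUnion (fun c => Finset.Icc c.2 (c.2 + γ * ((j + n : ℕ) - c.1))) := by
  induction n with
  | zero => simp [run]
  | succ n ih =>
    intro p hp
    obtain ⟨⟨x, hx, h'⟩, hF⟩ := mem_run_succ.1 hp
    rw [Finset.mem_union, mem_run_succ]
    by_cases hZ : (j+n+1, p) ∈ Z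
    · right
      rw [Finset.mem_biUnion]
      refine ⟨(j+n+1, p), ?_, ?_⟩
      · simp [rows, hZ, ← Nat.add_assoc]
      · simp [Nat.add_assoc]
    · rcases Finset.mem_union.1 (ih hx) with h | h
      · left; exact ⟨⟨x, h, h'⟩, by simp [hZ, hF]⟩
      · right
        rw [Finset.mem_biUnion] at h ⊢
        obtain ⟨c, hc, h⟩ := h
        refine ⟨c, ?_, ?_⟩
        · simp only [rows, Finset.mem_filter] at hc ⊢; exact ⟨hc.1, hc.2.1, by omega⟩
        · simp only [Finset.mem_Icc] at h ⊢; push_cast at h ⊢; constructor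
          · omega
          · linarith

lemma run_lost_card {γ ρ : ℕ} {F Z : Finset Cell} {j n : ℕ} {X : Finset ℤ} (hZ : Lgl ρ j Z) :
    (run γ F j X n \ run γ (F ∪ Z) j X n).card ≤ (γ * n + 1) * (ρ * n) := by
  have h1 : run γ F j X n \ run γ (F ∪ Z) j X n ⊆
      (rows Z j n).biUnion (fun c => Finset.Icc c.2 (c.2 + γ * ((j + n : ℕ) - c.1))) := by
    intro p hp
    rw [Finset.mem_sdiff] at hp
    have := run_lost F Z j n X hp.1
    simp only [Finset.mem_union] at this
    tauto
  refine (Finset.card_le_card h1).trans ?_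
  refine (Finset.card_biUnion_le_card_mul _ _ (γ * n + 1) ?_).trans ?_
  · intro c hc
    simp only [rows, Finset.mem_filter] at hc
    rw [Int.card_Icc]
    have : (γ:ℤ) * ((j + n : ℕ) - c.1) ≤ γ * n := by
      apply mul_le_mul_of_nonneg_left _ (by positivity); push_cast; omega
    have : ((γ * n + 1 : ℕ):ℤ) = γ * n + 1 := by push_cast; ring
    omega
  · rw [mul_comm]; exact Nat.mul_le_mul_left _ (hZ n)

lemma rowc_union_le (Y : Finset Cell) (r : ℕ) (a b : ℤ) (S : Finset ℤ) (hS : S ⊆ Finset.Icc a b) :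
    S.card ≤ (S.filter (fun p => (r, p) ∉ Y)).card + (rowc Y r a b).card := by
  rw [← Finset.card_filter_add_card_filter_not (s := S) (fun p => (r,p) ∉ Y)]
  gcongr
  apply Finset.card_le_card_of_injOn (fun p => (r, p))
  · intro p hp
    simp at hp
    have := Finset.mem_Icc.1 (hS hp.1)
    simp [rowc, hp.2, this]
  · intro x _ y _ h; simpa using h

/-- shift lemma -/
lemma PP_shift {γ ρ j n : ℕ} {X : Finset ℤ} {a b : ℤ} {F Δ : Finset Cell} {v : ℤ}
    (h : PP γ ρ j (n+1) X a b F v) (hΔ : Δ.card ≤ ρ) :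
    PP γ ρ (j+1) n (run γ (F ∪ Δ) j X 1) (lo γ F j X a 1) (hi γ F j X b 1) (F ∪ Δ)
      (v - (rowc (F ∪ Δ) (j+1) (lo γ F j X a 1) (hi γ F j X b 1)).card) := by
  intro Z hZ
  set W := Δ ∪ Z.filter (fun c => j + 1 < c.1) with hW
  have hWl : Lgl ρ j W := by
    intro k
    rcases k with _ | k
    · have : rows W j 0 = ∅ := by
        ext c; simp only [rows, Finset.mem_filter, Finset.notMem_empty, iff_false]; omega
      simp [this]
    · have : rows W j (k+1) ⊆ Δ ∪ rows Z (j+1) k := by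
        intro c; simp only [rows, hW, Finset.mem_filter, Finset.mem_union]; grind
      have h2 := (Finset.card_le_card this).trans (Finset.card_union_le _ _)
      have := hZ k
      nlinarith
  have h0 := h W hWl
  have e1 : run γ (F ∪ Δ) j X 1 = run γ (F ∪ W) j X 1 := by
    apply run_congr; intro c h1 h2
    simp only [hW, Finset.mem_union, Finset.mem_filter]; grind
  have e2 : ∀ X a b, val γ (F ∪ W) (j+1) n X a b = val γ (F ∪ Δ ∪ Z) (j+1) n X a b := by
    intro X a b
    have er : ∀ i ≤ n, run γ (F ∪ W) (j+1) X i = run γ (F ∪ Δ ∪ Z) (j+1) X i := by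
      intro i hi; apply run_congr; intro c h1 h2
      simp only [hW, Finset.mem_union, Finset.mem_filter]; grind
    have el : ∀ i ≤ n, lo γ (F ∪ W) (j+1) X a i = lo γ (F ∪ Δ ∪ Z) (j+1) X a i := by
      intro i hi; apply lo_congr; intro k hk; rw [er k (by omega)]
    have eh : ∀ i ≤ n, hi γ (F ∪ W) (j+1) X b i = hi γ (F ∪ Δ ∪ Z) (j+1) X b i := by
      intro i hi; apply hi_congr; intro k hk; rw [er k (by omega)]
    unfold val
    rw [er n le_rfl]
    congr 2
    ext c
    simp only [cs, hW, Finset.mem_union, Finset.mem_filter]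
    by_cases hc : j + 1 < c.1 ∧ c.1 ≤ j + 1 + n
    · rw [el _ (by omega), eh _ (by omega)]; grind
    · grind
  have el1 : ∀ Y, lo γ Y j X a 1 = lo γ F j X a 1 := fun Y => rfl
  have eh1 : ∀ Y, hi γ Y j X b 1 = hi γ F j X b 1 := fun Y => rfl
  have key : val γ (F ∪ W) j (n+1) X a b =
     (rowc (F ∪ Δ) (j+1) (lo γ F j X a 1) (hi γ F j X b 1)).card +
      val γ (F ∪ W) (j+1) n (run γ (F ∪ Δ) j X 1) (lo γ F j X a 1) (hi γ F j X b 1) := by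
    unfold val
    rw [cs_shift, e1, add_comm n 1, run_add]
    have : rowc (F ∪ W) (j+1) (lo γ (F ∪ W) j X a 1) (hi γ (F ∪ W) j X b 1) =
       rowc (F ∪ Δ) (j+1) (lo γ F j X a 1) (hi γ F j X b 1) := by
      ext c; rw [el1, eh1]; simp only [rowc, hW, Finset.mem_union, Finset.mem_filter]; grind
    rw [this]
    simp only [lo_add 1, hi_add 1]
    rw [el1 (F ∪ W), eh1 (F ∪ W)]
    have e3 : ∀ A B : ℕ → ℤ, cs (F ∪ W) (j+1) n (fun i => A i) (fun i => B i) = cs (F ∪ W) (j+1) n A B :=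
      fun _ _ => rfl
    rw [e3]
    ring
  rw [key, e2] at h0
  push_cast at h0
  linarith

/-- extension lemma -/
lemma PP_extend {γ ρ j n : ℕ} (hγ : 1 ≤ γ) {X : Finset ℤ} {a b : ℤ} {F : Finset Cell} {v : ℤ}
    (hX : X ⊆ Finset.Icc a b)
    (h : PP γ ρ j n X a b F v) (hbig : (γ * n + 1) * (ρ * n) < (run γ F j X n).card) :
    PP γ ρ j (n+1) X a b F
      (v + γ + (kap (run γ F j X n) - 1 - (γ * n + 1) * (ρ * n) : ℕ)) := by
  intro Z hZ
  have h0 := h Z hZ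
  have hl := run_lost_card (γ := γ) (F := F) (n := n) (X := X) hZ
  have hs : run γ (F ∪ Z) j X n ⊆ run γ F j X n :=
    run_mono (Finset.Subset.refl _) Finset.subset_union_left n
  have hne : (run γ (F ∪ Z) j X n).Nonempty := by
    rw [Finset.nonempty_iff_ne_empty]; intro he
    rw [he, Finset.sdiff_empty] at hl; omega
  have h1 := card_nx hγ hne
  have hk1 : 1 ≤ kap (run γ (F ∪ Z) j X n) := by
    rw [kap, Finset.one_le_card]
    refine ⟨(run γ (F ∪ Z) j X n).max' hne, ?_⟩
    rw [Finset.mem_filter]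
    refine ⟨Finset.max'_mem _ _, fun h => ?_⟩
    have := Finset.le_max' _ _ h; omega
  have h2 := kap_sub hs
  have h3 := rowc_union_le (F ∪ Z) (j+n+1) _ _ _ (nx_sub (γ := γ) (Y := F ∪ Z) (j := j) hX n)
  unfold val at h0 ⊢
  rw [cs_succ, run]
  push_cast at h0 ⊢
  omega

end PartP1

section PartP2

lemma one_le_kap {X : Finset ℤ} (hX : X.Nonempty) : 1 ≤ kap X := by
  rw [kap, Finset.one_le_card]
  refine ⟨X.max' hX, ?_⟩
  rw [Finset.mem_filter]
  refine ⟨Finset.max'_mem _ _, fun h => ?_⟩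
  have := Finset.le_max' _ _ h; omega

lemma card_nx' {γ : ℕ} (hγ : 1 ≤ γ) {X : Finset ℤ} (hX : X.Nonempty) :
    X.card + γ ≤ (nx γ X).card := by
  have := card_nx hγ hX; have := one_le_kap hX; omega

lemma run_mono' {γ : ℕ} {Y Y' : Finset Cell} {j : ℕ} {X X' : Finset ℤ} (hX : X ⊆ X') (n : ℕ)
    (hY : ∀ c ∈ Y', j < c.1 → c.1 ≤ j + n → c ∈ Y) : run γ Y j X n ⊆ run γ Y' j X' n := by
  induction n with
  | zero => exact hX
  | succ n ih =>
    intro p; simp only [mem_run_succ]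
    rintro ⟨⟨x, hx, h'⟩, h2⟩
    exact ⟨⟨x, ih (fun c h1 h2 h3 => hY c h1 h2 (by omega)) hx, h'⟩,
      fun h => h2 (hY _ h (by simp) (by simp))⟩

lemma val_eq {γ : ℕ} {Y : Finset Cell} {j n : ℕ} {S S' : Finset ℤ} {a b : ℤ} (hS : S' ⊆ S)
    (hr : run γ Y j S' n = run γ Y j S n)
    (hp : ∀ i < n, ∀ p ∈ run γ Y j S i, p ∉ run γ Y j S' i → a + i < p ∧ p < b + γ * i - i) :
    val γ Y j n S' a b = val γ Y j n S a b := by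
  have el : ∀ i ≤ n, lo γ Y j S a i = lo γ Y j S' a i := by
    intro i hi; apply lo_congr; intro k hk
    refine ⟨fun h => ?_, fun h => run_mono hS (Finset.Subset.refl _) k h⟩
    by_contra hc
    have := hp k (by omega) _ h hc
    have := (lo_bd (γ := γ) (Y := Y) (j := j) (X := S) (a := a) k).2; omega
  have eh : ∀ i ≤ n, hi γ Y j S b i = hi γ Y j S' b i := by
    intro i hi; apply hi_congr; intro k hk
    refine ⟨fun h => ?_, fun h => run_mono hS (Finset.Subset.refl _) k h⟩
    by_contra hc
    have := hp k (by omega) _ h hc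
    have := (hi_bd (γ := γ) (Y := Y) (j := j) (X := S) (b := b) k).1; omega
  unfold val
  rw [hr]
  congr 2
  ext c
  simp only [cs, Finset.mem_filter]
  by_cases hc : j < c.1 ∧ c.1 ≤ j + n
  · rw [el _ (by omega), eh _ (by omega)]
  · grind

/-- dropping doomed points -/
lemma PP_doomed {γ ρ j n k : ℕ} {S S' : Finset ℤ} {a b : ℤ} {F : Finset Cell} {v : ℤ}
    (h : PP γ ρ j n S a b F v) (hS : S' ⊆ S) (hk : k ≤ n)
    (hd : ∀ x ∈ S, x ∉ S' → run γ F j {x} k = ∅ ∧ a + k < x ∧ x + k < b) :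
    PP γ ρ j n S' a b F v := by
  intro Z hZ
  have key : ∀ i, ∀ p ∈ run γ (F ∪ Z) j S i, p ∉ run γ (F ∪ Z) j S' i →
      i < k ∧ ∃ x, a + k < x ∧ x + k < b ∧ p ∈ run γ (F ∪ Z) j {x} i := by
    intro i p hp hp'
    obtain ⟨x, hx, hpx⟩ := mem_run_iff.1 hp
    have hx' : x ∉ S' := fun h => hp' (mem_run_iff.2 ⟨x, h, hpx⟩)
    obtain ⟨h1, h2, h3⟩ := hd x hx hx'
    refine ⟨?_, x, h2, h3, hpx⟩
    by_contra hik
    obtain ⟨r, rfl⟩ := Nat.exists_eq_add_of_le (not_lt.1 hik)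
    have h4 : run γ (F ∪ Z) j {x} k = ∅ := by
      rw [← Finset.subset_empty, ← h1]
      exact run_mono (Finset.Subset.refl _) Finset.subset_union_left k
    rw [run_add, h4, run_empty] at hpx
    simp at hpx
  rw [val_eq hS]
  · exact h Z hZ
  · apply Finset.Subset.antisymm (run_mono hS (Finset.Subset.refl _) n)
    intro p hp; by_contra hp'
    have := (key n p hp hp').1; omega
  · intro i hi p hp hp'
    obtain ⟨h1, x, h2, h3, h4⟩ := key i p hp hp'
    have := run_cone h4
    constructor <;> omega

/-- sloppy trimming -/
lemma PP_sloppy {γ ρ j n s : ℕ} {S S' : Finset ℤ} {a b : ℤ} {F : Finset Cell} {v : ℤ}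
    (h : PP γ ρ j n S a b F v) (hS : S' ⊆ S) (hns : n ≤ s)
    (hr : run γ F j S' n = run γ F j S n) :
    PP γ ρ j n S' a b F (v - ((γ * s + 1) * (ρ * s) + s * (2 * s) : ℕ)) := by
  intro Z hZ
  have h0 := h Z hZ
  set Y := F ∪ Z
  have hl := run_lost_card (γ := γ) (F := F) (n := n) (X := S') hZ
  have h1 : (run γ Y j S n).card ≤ (run γ F j S' n).card := by
    rw [hr]; exact Finset.card_le_card (run_mono (Finset.Subset.refl _) Finset.subset_union_left n)
  have h2 : (run γ F j S' n).card ≤ (run γ F j S' n \ run γ Y j S' n).card + (run γ Y j S' n).card := by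
    rw [← Finset.card_sdiff_add_card_inter (run γ F j S' n) (run γ Y j S' n)]
    gcongr; exact Finset.inter_subset_right
  set E := (Finset.Icc 1 n).biUnion (fun i : ℕ => ({j+i} : Finset ℕ) ×ˢ
    (Finset.Ico a (a+i) ∪ Finset.Ioc (b + γ * i - i) (b + γ * i)))
  have hE : E.card ≤ n * (2 * n) := by
    refine (Finset.card_biUnion_le_card_mul _ _ (2 * n) ?_).trans ?_
    · intro i hi
      rw [Finset.card_product, Finset.card_singleton, one_mul]
      refine (Finset.card_union_le _ _).trans ?_
      rw [Int.card_Ico, Int.card_Ioc]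
      have := Finset.mem_Icc.1 hi; omega
    · simp
  have h3 : cs Y j n (lo γ Y j S a) (hi γ Y j S b) ⊆ cs Y j n (lo γ Y j S' a) (hi γ Y j S' b) ∪ E := by
    intro c hc
    by_cases hc' : c ∈ cs Y j n (lo γ Y j S' a) (hi γ Y j S' b)
    · exact Finset.mem_union_left _ hc'
    apply Finset.mem_union_right
    simp only [cs, Finset.mem_filter] at hc hc'
    simp only [E, Finset.mem_biUnion, Finset.mem_product, Finset.mem_singleton, Finset.mem_union,
      Finset.mem_Ico, Finset.mem_Ioc, Finset.mem_Icc]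
    refine ⟨c.1 - j, by omega, by omega, ?_⟩
    have b1 := lo_bd (γ := γ) (Y := Y) (j := j) (X := S) (a := a) (c.1 - j)
    have b2 := lo_bd (γ := γ) (Y := Y) (j := j) (X := S') (a := a) (c.1 - j)
    have b3 := hi_bd (γ := γ) (Y := Y) (j := j) (X := S) (b := b) (c.1 - j)
    have b4 := hi_bd (γ := γ) (Y := Y) (j := j) (X := S') (b := b) (c.1 - j)
    by_cases h5 : lo γ Y j S' a (c.1 - j) ≤ c.2
    · right
      have : hi γ Y j S' b (c.1 - j) < c.2 := by
        by_contra h6; exact hc' ⟨hc.1, hc.2.1, hc.2.2.1, h5, not_lt.1 h6⟩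
      constructor <;> omega
    · left; constructor <;> omega
  have h4 := (Finset.card_le_card h3).trans (Finset.card_union_le _ _)
  have h5 : (γ * n + 1) * (ρ * n) ≤ (γ * s + 1) * (ρ * s) := by gcongr
  have h6 : n * (2 * n) ≤ s * (2 * s) := by gcongr
  unfold val at h0 ⊢
  push_cast at h0 h5 h6 ⊢
  zify at h1 h2 h4 hl hE
  linarith

lemma closure_aux {γ : ℕ} (hγ : 1 ≤ γ) {A B : Finset ℤ} {l v : ℤ} {e : ℕ} (hA : A.Nonempty)
    (hB : B.Nonempty) (h1 : ∀ x ∈ A, x ≤ l) (h2 : ∀ x ∈ B, v ≤ x) (he : e ≤ γ) (hlv : l + e < v) :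
    (A ∪ B).card + γ + e ≤ (nx γ (A ∪ B)).card := by
  set M := A.max' hA
  have hM : M ∈ A := A.max'_mem hA
  have hle : ∀ x ∈ A, x ≤ M := fun x hx => A.le_max' x hx
  have hMl := h1 M hM
  have d1 : Disjoint A (Finset.Icc (M+1) (M+e)) := by
    rw [Finset.disjoint_left]; intro x hx h
    have := hle x hx; rw [Finset.mem_Icc] at h; omega
  have d2 : Disjoint (A ∪ Finset.Icc (M+1) (M+e)) (nx γ B) := by
    rw [Finset.disjoint_left]; intro x hx h
    obtain ⟨y, hy, hyx⟩ := mem_nx.1 h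
    have := h2 y hy
    rcases Finset.mem_union.1 hx with h | h
    · have := hle x h; omega
    · rw [Finset.mem_Icc] at h; omega
  have hs : (A ∪ Finset.Icc (M+1) (M+e)) ∪ nx γ B ⊆ nx γ (A ∪ B) := by
    rw [nx_union]
    apply Finset.union_subset_union_left
    intro p hp; rw [mem_nx]
    rcases Finset.mem_union.1 hp with h | h
    · exact ⟨p, h, le_rfl, by omega⟩
    · rw [Finset.mem_Icc] at h; exact ⟨M, hM, by omega, by omega⟩
  have := Finset.card_le_card hs
  rw [Finset.card_union_of_disjoint d2, Finset.card_union_of_disjoint d1, Int.card_Icc] at this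
  have := card_nx' hγ hB
  have := Finset.card_union_le A B
  omega

/-- closure lemma -/
lemma closure_lem {γ : ℕ} (hγ : 1 ≤ γ) {Y : Finset Cell} {j m : ℕ} {u v : ℤ} (huv : u < v)
    (hu : (run γ Y j {u} m).Nonempty) (hv : (run γ Y j {v} m).Nonempty) (hm : v - u ≤ γ * m) :
    v - u + γ * m + 1 ≤ (run γ Y j {u, v} m).card +
      ((cs Y j m (fun _ => u) (fun i => v + γ * i)).card : ℤ) := by
  have alive : ∀ x : ℤ, (run γ Y j {x} m).Nonempty → ∀ n ≤ m, (run γ Y j {x} n).Nonempty := by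
    intro x hx n hn
    obtain ⟨r, rfl⟩ := Nat.exists_eq_add_of_le hn
    rw [run_add] at hx
    by_contra hc
    rw [Finset.not_nonempty_iff_eq_empty] at hc
    rw [hc, run_empty] at hx; simp at hx
  have main : ∀ n ≤ m, 2 + γ * n + min (γ * n : ℤ) (v - u - 1) ≤ (run γ Y j {u, v} n).card +
      ((cs Y j n (fun _ => u) (fun i => v + γ * i)).card : ℤ) := by
    intro n
    induction n with
    | zero =>
      intro _
      have : (run γ Y j {u, v} 0).card = 2 := by
        rw [run, Finset.card_pair huv.ne]
      rw [this]; simp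
    | succ n ih =>
      intro hn
      have ih := ih (by omega)
      have hsub : nx γ (run γ Y j {u,v} n) ⊆ Finset.Icc u (v + γ * ((n+1 : ℕ):ℤ)) := by
        intro p hp
        obtain ⟨q, hq, h1, h2⟩ := mem_nx.1 hp
        obtain ⟨x, hx, hqx⟩ := mem_run_iff.1 hq
        have := run_cone hqx
        simp only [Finset.mem_insert, Finset.mem_singleton] at hx
        rw [Finset.mem_Icc]; push_cast
        rcases hx with rfl | rfl <;> constructor <;> linarith
      have h3 := rowc_union_le Y (j+n+1) _ _ _ hsub
      rw [cs_succ, run]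
      have hun : ({u, v} : Finset ℤ) = {u} ∪ {v} := rfl
      have h4 : (run γ Y j {u,v} n).card + γ + min (γ:ℤ) (max 0 (v - u - 1 - γ * n)) ≤
          (nx γ (run γ Y j {u,v} n)).card := by
        rw [hun, run_union]
        by_cases hd : v - u - 1 - γ * n ≤ 0
        · rw [max_eq_left hd, min_eq_right (by omega), add_zero]
          have := card_nx' hγ (X := run γ Y j {u} n ∪ run γ Y j {v} n)
            ((alive u hu n (by omega)).mono Finset.subset_union_left)
          omega
        · obtain ⟨e, he⟩ := Int.eq_ofNat_of_zero_le
            (show 0 ≤ min (γ:ℤ) (max 0 (v - u - 1 - γ * n)) by omega)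
          have := closure_aux hγ (l := u + γ * n) (v := v) (e := e) (alive u hu n (by omega))
            (alive v hv n (by omega)) (fun x hx => (run_cone hx).2) (fun x hx => (run_cone hx).1)
            (by omega) (by omega)
          rw [he]; omega
      beta_reduce
      generalize (rowc Y (j + n + 1) u (v + γ * ((n+1:ℕ):ℤ))).card = R at *
      push_cast at *
      have e1 : (γ:ℤ) * (n + 1) = γ * n + γ := by ring
      rw [e1]
      omega
  have := main m le_rfl
  omega

/-- removing a point by exchange -/
lemma PP_remove {γ ρ j n m : ℕ} (hγ : 1 ≤ γ) {S : Finset ℤ} {x a b : ℤ} {F : Finset Cell} {w : ℤ}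
    (h : PP γ ρ j n S a b F w) (hmn : m ≤ n)
    (hx : ∀ Z, Lgl ρ j Z → ∃ u ∈ S, ∃ v ∈ S, u < x ∧ x < v ∧
      (run γ (F ∪ Z) j {u} m).Nonempty ∧ (run γ (F ∪ Z) j {v} m).Nonempty ∧ v - u ≤ γ * m ∧
      a + m < u ∧ v + m < b ∧
      ∀ c ∈ F, j < c.1 → c.1 ≤ j + m → u ≤ c.2 → c.2 ≤ v + γ * m → False) :
    PP γ ρ j n (S.erase x) a b F w := by
  intro Z hZ
  obtain ⟨u, huS, v, hvS, hux, hxv, hu, hv, hm, hau, hvb, hF⟩ := hx Z hZ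
  set S' := S.erase x with hS'
  set Y := F ∪ Z with hY
  have hm0 : m ≠ 0 := by rintro rfl; simp at hm; omega
  obtain ⟨m0, hmd⟩ : ∃ m0, m = m0 + 1 := ⟨m - 1, by omega⟩
  -- trap
  set tr : Finset Cell := cs Z j m (fun _ => u) (fun i => v + γ * i) with htr
  set D : Finset Cell := ((Finset.Icc u (v + γ * m)) \ run γ Y j S' m).image (fun p => (j+m, p))
    with hD
  set Z' := (Z \ tr) ∪ D with hZ'
  have memtr : ∀ c : Cell, c ∈ tr ↔ c ∈ Z ∧ j < c.1 ∧ c.1 ≤ j + m ∧ u ≤ c.2 ∧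
      c.2 ≤ v + γ * ((c.1 - j : ℕ):ℤ) := by intro c; simp [htr, cs]
  have memD : ∀ c : Cell, c ∈ D ↔ c.1 = j + m ∧ u ≤ c.2 ∧ c.2 ≤ v + γ * m ∧
      c.2 ∉ run γ Y j S' m := by
    rintro ⟨r, p⟩; simp [hD]; grind
  have hwide : ∀ i : ℕ, i ≤ m → (γ:ℤ) * i ≤ γ * m := by
    intro i hi; exact mul_le_mul_of_nonneg_left (by exact_mod_cast hi) (by positivity)
  have huS' : u ∈ S' := Finset.mem_erase.2 ⟨by omega, huS⟩
  have hvS' : v ∈ S' := Finset.mem_erase.2 ⟨by omega, hvS⟩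
  have cardD : D.card ≤ tr.card := by
    have h1 := closure_lem hγ (by omega : u < v) hu hv hm
    have h2 : cs Y j m (fun _ => u) (fun i => v + γ * i) ⊆ tr := by
      intro c hc
      simp only [cs, Finset.mem_filter, hY, Finset.mem_union] at hc
      rw [memtr]
      refine ⟨?_, hc.2⟩
      rcases hc.1 with h | h
      · exact (hF c h hc.2.1 hc.2.2.1 hc.2.2.2.1 (by have := hwide (c.1-j) (by omega); linarith [hc.2.2.2.2])).elim
      · exact h
    have h3 := Finset.card_le_card h2
    have h4 : run γ Y j {u,v} m ⊆ Finset.Icc u (v + γ * m) ∩ run γ Y j S' m := by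
      intro p hp
      rw [Finset.mem_inter]
      refine ⟨?_, run_mono (by grind) (Finset.Subset.refl _) m hp⟩
      obtain ⟨y, hy, hpy⟩ := mem_run_iff.1 hp
      have := run_cone hpy
      simp only [Finset.mem_insert, Finset.mem_singleton] at hy
      rw [Finset.mem_Icc]
      rcases hy with rfl | rfl <;> constructor <;> linarith
    have h5 := Finset.card_le_card h4
    have h6 := Finset.card_sdiff_add_card_inter (Finset.Icc u (v + γ * m)) (run γ Y j S' m)
    rw [Int.card_Icc] at h6
    have h7 : D.card ≤ (Finset.Icc u (v + γ * m) \ run γ Y j S' m).card := Finset.card_image_le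
    omega
  have hl' : Lgl ρ j Z' := by
    intro k
    refine le_trans ?_ (hZ k)
    by_cases hk : k < m
    · apply Finset.card_le_card
      intro c
      simp only [rows, Finset.mem_filter, hZ', Finset.mem_union, Finset.mem_sdiff, memD]
      grind
    · have h1 : rows Z' j k ⊆ (rows Z j k \ tr) ∪ D := by
        intro c
        simp only [rows, Finset.mem_filter, hZ', Finset.mem_union, Finset.mem_sdiff]
        grind
      have h2 : tr ⊆ rows Z j k := by
        intro c; rw [memtr]; simp only [rows, Finset.mem_filter]; grind
      have := (Finset.card_le_card h1).trans (Finset.card_union_le _ _)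
      have := Finset.card_sdiff_add_card_eq_card h2
      omega
  have hval := h Z' hl'
  refine hval.trans ?_
  -- membership agreement
  have agree : ∀ c : Cell, j < c.1 → (c.1 ≤ j + m → c.2 < u ∨ v + γ * ((c.1 - j : ℕ):ℤ) < c.2) →
      (c ∈ F ∪ Z' ↔ c ∈ Y) := by
    intro c hc1 hc2
    have t1 : c ∉ tr := by rw [memtr]; rintro ⟨_, _, h3, h4, h5⟩; rcases hc2 h3 <;> omega
    have t2 : c ∉ D := by
      rw [memD]; rintro ⟨h3, h4, h5, _⟩
      have e : c.1 - j = m := by omega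
      rw [e] at hc2; rcases hc2 (by omega) <;> omega
    simp only [hY, hZ', Finset.mem_union, Finset.mem_sdiff]; tauto
  have out : ∀ i ≤ m, ∀ p : ℤ, (p < u ∨ v + γ * i < p) →
      (p ∈ run γ (F ∪ Z') j S i ↔ p ∈ run γ Y j S' i) := by
    intro i
    induction i with
    | zero => intro _ p hp; simp only [run, hS', Finset.mem_erase]; simp at hp; constructor
              · intro h; exact ⟨by omega, h⟩
              · exact fun h => h.2
    | succ i ih =>
      intro hi p hp
      have ih := ih (by omega)
      rw [mem_run_succ, mem_run_succ]
      have e : j + i + 1 - j = i + 1 := by omega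
      rw [agree (j+i+1, p) (by simp) (fun _ => by simp only [e]; exact hp)]
      push_cast at hp
      constructor
      · rintro ⟨⟨q, hq, h1, h2⟩, h3⟩
        exact ⟨⟨q, (ih q (by rcases hp with hp | hp; · left; omega
                             · right; linarith)).1 hq, h1, h2⟩, h3⟩
      · rintro ⟨⟨q, hq, h1, h2⟩, h3⟩
        exact ⟨⟨q, (ih q (by rcases hp with hp | hp; · left; omega
                             · right; linarith)).2 hq, h1, h2⟩, h3⟩
  have atm : run γ (F ∪ Z') j S m = run γ Y j S' m := by
    ext p
    by_cases hp : p < u ∨ v + γ * (m:ℤ) < p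
    · exact out m le_rfl p hp
    · push Not at hp
      constructor
      · intro h1
        by_contra h2
        have : (j + m0 + 1, p) ∈ D := by rw [memD]; exact ⟨by simp [hmd, add_assoc], hp.1, hp.2, h2⟩
        rw [hmd, mem_run_succ] at h1
        exact h1.2 (by rw [Finset.mem_union, hZ', Finset.mem_union]; right; right; exact this)
      · intro h1
        have h1' := h1
        rw [hmd, mem_run_succ] at h1
        obtain ⟨⟨q, hq, h3⟩, h4⟩ := h1
        rw [hmd, mem_run_succ]
        refine ⟨⟨q, ?_, h3⟩, ?_⟩
        · refine run_mono' (Finset.erase_subset _ _) m0 ?_ hq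
          intro c hc h5 h6
          simp only [hZ', Finset.mem_union, Finset.mem_sdiff, memD] at hc
          simp only [hY, Finset.mem_union]
          grind
        · intro hc
          simp only [hZ', Finset.mem_union, Finset.mem_sdiff, memD] at hc
          simp only [hY, Finset.mem_union] at h4
          grind
  have ater : ∀ i, m ≤ i → run γ (F ∪ Z') j S i = run γ Y j S' i := by
    intro i hi
    obtain ⟨r, rfl⟩ := Nat.exists_eq_add_of_le hi
    rw [run_add, run_add, atm]
    apply run_congr
    intro c h1 h2; apply agree
    · omega
    · intro h; omega
  have el : ∀ i, lo γ (F ∪ Z') j S a i = lo γ Y j S' a i := by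
    intro i; apply lo_congr; intro k hk
    by_cases hkm : m ≤ k
    · rw [ater k hkm]
    · apply out k (by omega); left
      have := (lo_bd (γ := γ) (Y := F ∪ Z') (j := j) (X := S) (a := a) k).2; omega
  have eh : ∀ i, hi γ (F ∪ Z') j S b i = hi γ Y j S' b i := by
    intro i; apply hi_congr; intro k hk
    by_cases hkm : m ≤ k
    · rw [ater k hkm]
    · apply out k (by omega); right
      have := (hi_bd (γ := γ) (Y := F ∪ Z') (j := j) (X := S) (b := b) k).1; omega
  have el' : lo γ (F ∪ Z') j S a = lo γ Y j S' a := funext el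
  have eh' : hi γ (F ∪ Z') j S b = hi γ Y j S' b := funext eh
  unfold val
  rw [ater n hmn, el', eh']
  have c1 : tr ⊆ cs Y j n (lo γ Y j S' a) (hi γ Y j S' b) := by
    intro c hc
    rw [memtr] at hc
    simp only [cs, Finset.mem_filter]
    have := (lo_bd (γ := γ) (Y := Y) (j := j) (X := S') (a := a) (c.1 - j)).2
    have := (hi_bd (γ := γ) (Y := Y) (j := j) (X := S') (b := b) (c.1 - j)).1
    refine ⟨Finset.mem_union_right _ hc.1, hc.2.1, by omega, by omega, by omega⟩
  have c2 : cs (F ∪ Z') j n (lo γ Y j S' a) (hi γ Y j S' b) ⊆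
      (cs Y j n (lo γ Y j S' a) (hi γ Y j S' b) \ tr) ∪ D := by
    intro c hc
    simp only [cs, Finset.mem_filter] at hc
    simp only [Finset.mem_union, Finset.mem_sdiff, cs, Finset.mem_filter]
    by_cases hcD : c ∈ D
    · exact Or.inr hcD
    left
    have hct : c ∉ tr := by
      intro ht
      have ht' := (memtr c).1 ht
      rcases Finset.mem_union.1 hc.1 with h1 | h1
      · exact hF c h1 ht'.2.1 ht'.2.2.1 ht'.2.2.2.1 (by have := hwide (c.1-j) (by omega); linarith [ht'.2.2.2.2])
      · rw [hZ', Finset.mem_union, Finset.mem_sdiff] at h1; tauto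
    refine ⟨⟨?_, hc.2⟩, hct⟩
    have := hc.1
    simp only [hZ', Finset.mem_union, Finset.mem_sdiff, hY] at this ⊢
    tauto
  have c3 := (Finset.card_le_card c2).trans (Finset.card_union_le _ _)
  have c4 := Finset.card_sdiff_add_card_eq_card c1
  push_cast; omega

lemma mem_run_left {γ : ℕ} {Y : Finset Cell} {j : ℕ} {x : ℤ} {n : ℕ} {q : ℤ} :
    q ∈ run γ Y j {x} (n+1) ↔ ∃ x', x ≤ x' ∧ x' ≤ x + γ ∧ (j+1, x') ∉ Y ∧ q ∈ run γ Y (j+1) {x'} n := by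
  rw [add_comm n 1, run_add, mem_run_iff]
  have : ∀ y, y ∈ run γ Y j {x} 1 ↔ x ≤ y ∧ y ≤ x + γ ∧ (j+1, y) ∉ Y := by
    intro y; rw [show (1:ℕ) = 0 + 1 from rfl, mem_run_succ]; simp [run, and_assoc]
  simp only [this]; grind

lemma cover_lem {γ : ℕ} {Y : Finset Cell} (k : ℕ) : ∀ {j r : ℕ} {x₁ x₂ x₃ p q : ℤ},
    x₁ ≤ x₂ → x₂ ≤ x₃ → p ∈ run γ Y j {x₁} k → p ∈ run γ Y j {x₃} k →
    q ∈ run γ Y j {x₂} (k + r) → q ∈ run γ Y j {x₁} (k + r) ∨ q ∈ run γ Y j {x₃} (k + r) := by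
  induction k with
  | zero =>
    intro j r x₁ x₂ x₃ p q h1 h2 h3 h4 h5
    simp [run] at h3 h4
    have : x₂ = x₁ := by omega
    subst this; left; exact h5
  | succ k ih =>
    intro j r x₁ x₂ x₃ p q h1 h2 h3 h4 h5
    rw [Nat.add_right_comm k 1 r] at *
    obtain ⟨y₁, a1, a2, a3, a4⟩ := mem_run_left.1 h3
    obtain ⟨y₃, b1, b2, b3, b4⟩ := mem_run_left.1 h4
    obtain ⟨y₂, c1, c2, c3, c4⟩ := mem_run_left.1 h5
    rw [mem_run_left, mem_run_left]
    by_cases h6 : y₂ ≤ y₁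
    · left; exact ⟨y₂, by omega, by omega, c3, c4⟩
    · by_cases h7 : y₃ ≤ y₂
      · right; exact ⟨y₂, by omega, by omega, c3, c4⟩
      · rcases ih (by omega : y₁ ≤ y₂) (by omega) a4 b4 c4 with h | h
        · left; exact ⟨y₁, a1, a2, a3, h⟩
        · right; exact ⟨y₃, b1, b2, b3, h⟩

noncomputable def eff (γ : ℕ) (Y : Finset Cell) (j : ℕ) (X : Finset ℤ) (n : ℕ) : Finset Cell :=
  Y.filter (fun c => j < c.1 ∧ c.1 ≤ j + n ∧ c.2 ∈ nx γ (run γ Y j X (c.1 - j - 1)))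

lemma eff_card {γ : ℕ} (hγ : 1 ≤ γ) {Y : Finset Cell} {j : ℕ} {X : Finset ℤ} (n : ℕ)
    (h : ∀ i < n, (run γ Y j X i).Nonempty) :
    X.card + γ * n ≤ (run γ Y j X n).card + (eff γ Y j X n).card := by
  induction n with
  | zero => simp [run]
  | succ n ih =>
    have ih := ih (fun i hi => h i (by omega))
    have h1 := card_nx' hγ (h n (by omega))
    have h2 : (nx γ (run γ Y j X n)).card ≤ (run γ Y j X (n+1)).card +
        ((nx γ (run γ Y j X n)).filter (fun p => ¬ (j+n+1, p) ∉ Y)).card := by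
      rw [run]; exact (Finset.card_filter_add_card_filter_not _).ge
    have h3 : (eff γ Y j X n).card + ((nx γ (run γ Y j X n)).filter (fun p => ¬ (j+n+1, p) ∉ Y)).card
        ≤ (eff γ Y j X (n+1)).card := by
      rw [← Finset.card_image_of_injective (f := fun p : ℤ => ((j+n+1, p) : Cell))
        ((nx γ (run γ Y j X n)).filter (fun p => ¬ (j+n+1, p) ∉ Y)) (fun x y h => by simpa using h),
        ← Finset.card_union_of_disjoint]
      · apply Finset.card_le_card
        intro c; simp only [eff, Finset.mem_union, Finset.mem_filter, Finset.mem_image]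
        rintro (h | ⟨p, hp, rfl⟩)
        · exact ⟨h.1, h.2.1, by omega, h.2.2.2⟩
        · have e : j + n + 1 - j - 1 = n := by omega
          simp only [e]
          exact ⟨not_not.1 hp.2, by omega, by omega, hp.1⟩
      · rw [Finset.disjoint_left]; simp only [eff, Finset.mem_filter, Finset.mem_image]
        rintro c hc ⟨p, hp, rfl⟩; simp at hc
    rw [Nat.mul_succ]; omega

end PartP2

section PartP3

lemma run_dead {γ : ℕ} {Y : Finset Cell} {j : ℕ} {X : Finset ℤ} {i k : ℕ} (hik : i ≤ k)
    (h : run γ Y j X i = ∅) : run γ Y j X k = ∅ := by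
  obtain ⟨r, rfl⟩ := Nat.exists_eq_add_of_le hik
  rw [run_add, h, run_empty]

/-- lossless net -/
lemma net_lem {γ : ℕ} (hγ : 1 ≤ γ) (F : Finset Cell) (j m : ℕ) {S : Finset ℤ} {a b : ℤ}
    (hS : S ⊆ Finset.Icc a b) : ∃ S' ⊆ S, run γ F j S' m = run γ F j S m ∧
      S'.card * (1 + γ * m) ≤ 2 * (b - a + 1 + γ * m).toNat + 2 * (γ + 1) * F.card := by
  classical
  obtain ⟨S', hS', hmin⟩ := Finset.exists_min_image
    (S.powerset.filter (fun T => run γ F j T m = run γ F j S m)) Finset.card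
    ⟨S, by simp⟩
  simp only [Finset.mem_filter, Finset.mem_powerset] at hS' hmin
  refine ⟨S', hS'.1, hS'.2, ?_⟩
  have nrem : ∀ x ∈ S', run γ F j (S'.erase x) m ≠ run γ F j S' m := by
    intro x hx he
    have := hmin (S'.erase x) ⟨(Finset.erase_subset _ _).trans hS'.1, he.trans hS'.2⟩
    have := Finset.card_erase_lt_of_mem hx
    omega
  have alive : ∀ x ∈ S', (run γ F j {x} m).Nonempty := by
    intro x hx
    by_contra hc
    rw [Finset.not_nonempty_iff_eq_empty] at hc
    apply nrem x hx
    conv_rhs => rw [← Finset.insert_erase hx, Finset.insert_eq, run_union, hc, Finset.empty_union]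
  have mult : ∀ i ≤ m, ∀ p : ℤ, (S'.filter (fun x => p ∈ run γ F j {x} i)).card ≤ 2 := by
    intro i hi p
    by_contra hc
    set U := S'.filter (fun x => p ∈ run γ F j {x} i) with hU
    have hne : U.Nonempty := Finset.card_pos.1 (by omega)
    have hcard : 0 < ((U.erase (U.min' hne)).erase (U.max' hne)).card := by
      have h1 := Finset.pred_card_le_card_erase (s := U) (a := U.min' hne)
      have h2 := Finset.pred_card_le_card_erase (s := U.erase (U.min' hne)) (a := U.max' hne)
      omega
    obtain ⟨x, hx⟩ := Finset.card_pos.1 hcard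
    simp only [Finset.mem_erase] at hx
    have hxU := hx.2.2
    have l1 := U.min'_le x hxU
    have l2 := U.le_max' x hxU
    have m1 := U.min'_mem hne
    have m2 := U.max'_mem hne
    generalize U.min' hne = x1 at *
    generalize U.max' hne = x3 at *
    rw [hU, Finset.mem_filter] at hxU m1 m2
    apply nrem x hxU.1
    apply Finset.Subset.antisymm (run_mono (Finset.erase_subset _ _) (Finset.Subset.refl _) m)
    intro q hq
    obtain ⟨y, hy, hqy⟩ := mem_run_iff.1 hq
    rw [mem_run_iff]
    by_cases hyx : y = x
    · subst hyx
      obtain ⟨r, rfl⟩ := Nat.exists_eq_add_of_le hi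
      rcases cover_lem i l1 l2 m1.2 m2.2 hqy with h | h
      · exact ⟨x1, Finset.mem_erase.2 ⟨fun e => hx.2.1 e.symm, m1.1⟩, h⟩
      · exact ⟨x3, Finset.mem_erase.2 ⟨fun e => hx.1 e.symm, m2.1⟩, h⟩
    · exact ⟨y, Finset.mem_erase.2 ⟨hyx, hy⟩, hqy⟩
  have h1 : ∀ x ∈ S', 1 + γ * m ≤ (run γ F j {x} m).card + (eff γ F j {x} m).card := by
    intro x hx
    refine eff_card hγ (X := {x}) m (fun i hi => ?_)
    by_contra hc
    rw [Finset.not_nonempty_iff_eq_empty] at hc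
    have := alive x hx
    rw [run_dead hi.le hc] at this; simp at this
  set R := Finset.Icc a (b + γ * m)
  have h2 : ∑ x ∈ S', (run γ F j {x} m).card ≤ 2 * R.card := by
    have : ∀ x ∈ S', (run γ F j {x} m).card = (R.bipartiteAbove (fun x p => p ∈ run γ F j {x} m) x).card := by
      intro x hx
      congr 1; ext p
      rw [Finset.mem_bipartiteAbove]
      refine ⟨fun h => ⟨?_, h⟩, fun h => h.2⟩
      have h1 := run_cone h
      have h2 := Finset.mem_Icc.1 (hS (hS'.1 hx))
      rw [Finset.mem_Icc]; constructor <;> linarith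
    rw [Finset.sum_congr rfl this, Finset.sum_card_bipartiteAbove_eq_sum_card_bipartiteBelow]
    refine (Finset.sum_le_card_nsmul _ _ 2 ?_).trans (by simp [mul_comm])
    intro p hp; exact mult m le_rfl p
  have h3 : ∑ x ∈ S', (eff γ F j {x} m).card ≤ 2 * (γ + 1) * F.card := by
    have : ∀ x ∈ S', (eff γ F j {x} m).card = (F.bipartiteAbove (fun x c =>
      j < c.1 ∧ c.1 ≤ j + m ∧ c.2 ∈ nx γ (run γ F j {x} (c.1 - j - 1))) x).card := fun x hx => rfl
    rw [Finset.sum_congr rfl this, Finset.sum_card_bipartiteAbove_eq_sum_card_bipartiteBelow]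
    refine (Finset.sum_le_card_nsmul _ _ (2 * (γ + 1)) ?_).trans (by simp [mul_comm])
    intro c hc
    by_cases hcm : j < c.1 ∧ c.1 ≤ j + m
    · have hsub : S'.bipartiteBelow (fun x (c : Cell) =>
          j < c.1 ∧ c.1 ≤ j + m ∧ c.2 ∈ nx γ (run γ F j {x} (c.1 - j - 1))) c ⊆
          (Finset.Icc (c.2 - γ) c.2).biUnion (fun q => S'.filter (fun x => q ∈ run γ F j {x} (c.1 - j - 1))) := by
        intro x hx
        rw [Finset.mem_bipartiteBelow] at hx
        obtain ⟨q, hq, h⟩ := mem_nx.1 hx.2.2.2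
        rw [Finset.mem_biUnion]
        exact ⟨q, Finset.mem_Icc.2 (by omega), Finset.mem_filter.2 ⟨hx.1, hq⟩⟩
      refine (Finset.card_le_card hsub).trans ((Finset.card_biUnion_le_card_mul _ _ 2 ?_).trans ?_)
      · intro q hq; exact mult _ (by omega) q
      · rw [Int.card_Icc]
        have : (c.2 + 1 - (c.2 - γ)).toNat = γ + 1 := by omega
        rw [this]; omega
    · rw [Finset.card_eq_zero.2]; · omega
      · ext x; rw [Finset.mem_bipartiteBelow]; simp; grind
  have h4 := Finset.sum_le_sum h1
  rw [Finset.sum_const, Finset.sum_add_distrib, smul_eq_mul] at h4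
  have h5 : R.card = (b - a + 1 + γ * m).toNat := by rw [Int.card_Icc]; congr 1; ring
  rw [h5] at h2
  omega

def NoDead (γ ρ K g m : ℕ) : Prop := ∀ (F Z : Finset Cell) (j : ℕ) (pts : Finset ℤ),
  Lgl ρ j Z → K ≤ pts.card → (∀ x ∈ pts, ∀ y ∈ pts, x < y → x + g ≤ y) →
  (∀ c ∈ F, j < c.1 → c.1 ≤ j + m → ∀ x ∈ pts, x ≤ c.2 → c.2 ≤ x + γ * m → False) →
  ∃ x ∈ pts, (run γ (F ∪ Z) j {x} m).Nonempty

/-- first death time -/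
lemma death {γ : ℕ} (hγ : 1 ≤ γ) {Y : Finset Cell} {j : ℕ} {X : Finset ℤ} {k : ℕ}
    (h : run γ Y j X k = ∅) : ∃ d ≤ k, (∀ i < d, (run γ Y j X i).Nonempty) ∧ run γ Y j X d = ∅ ∧
      X.card + γ * d ≤ (eff γ Y j X d).card := by
  classical
  have hex : ∃ d, run γ Y j X d = ∅ := ⟨k, h⟩
  have h1 : ∀ i < Nat.find hex, (run γ Y j X i).Nonempty := fun i hi =>
    Finset.nonempty_iff_ne_empty.2 (Nat.find_min hex hi)
  refine ⟨Nat.find hex, Nat.find_min' hex h, h1, Nat.find_spec hex, ?_⟩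
  have := eff_card hγ (Nat.find hex) h1
  rw [Nat.find_spec hex] at this; simpa using this

lemma eff_mono {γ : ℕ} {Y : Finset Cell} {j : ℕ} {X X' : Finset ℤ} {d k : ℕ} (hX : X ⊆ X')
    (h : d ≤ k) : eff γ Y j X d ⊆ eff γ Y j X' k := by
  intro c; simp only [eff, Finset.mem_filter]
  exact fun hc => ⟨hc.1, hc.2.1, by omega, nx_mono (run_mono hX (Finset.Subset.refl _) _) hc.2.2.2⟩

lemma eff_cone {γ : ℕ} {Y : Finset Cell} {j : ℕ} {X : Finset ℤ} {k : ℕ} {c : Cell}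
    (hc : c ∈ eff γ Y j X k) : c ∈ Y ∧ j < c.1 ∧ c.1 ≤ j + k ∧
      ∃ x ∈ X, x ≤ c.2 ∧ c.2 ≤ x + γ * k := by
  simp only [eff, Finset.mem_filter] at hc
  refine ⟨hc.1, hc.2.1, hc.2.2.1, ?_⟩
  obtain ⟨q, hq, h1, h2⟩ := mem_nx.1 hc.2.2.2
  obtain ⟨x, hx, hqx⟩ := mem_run_iff.1 hq
  have := run_cone hqx
  refine ⟨x, hx, by omega, ?_⟩
  have : (γ:ℤ) * ((c.1 - j - 1 : ℕ):ℤ) + γ ≤ γ * k := by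
    have : (((c.1 - j - 1 : ℕ):ℤ) + 1) ≤ k := by omega
    nlinarith
  linarith

lemma eff_sub_rows {γ m k : ℕ} {F Z : Finset Cell} {j : ℕ} {X : Finset ℤ} (hk : k ≤ m)
    (hF : ∀ c ∈ F, j < c.1 → c.1 ≤ j + m → ∀ x ∈ X, x ≤ c.2 → c.2 ≤ x + γ * m → False) :
    eff γ (F ∪ Z) j X k ⊆ rows Z j k := by
  intro c hc
  obtain ⟨h1, h2, h3, x, hx, h4, h5⟩ := eff_cone hc
  simp only [rows, Finset.mem_filter]
  refine ⟨?_, h2, h3⟩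
  rcases Finset.mem_union.1 h1 with h | h
  · have : (γ:ℤ) * k ≤ γ * m := mul_le_mul_of_nonneg_left (by exact_mod_cast hk) (by positivity)
    exact (hF c h h2 (by omega) x hx h4 (by linarith)).elim
  · exact h

lemma noDead_one (K g m : ℕ) (hK : 1 ≤ K) : NoDead 1 1 K g m := by
  intro F Z j pts hZ hc _ hF
  obtain ⟨x, hx⟩ := Finset.card_pos.1 (by omega : 0 < pts.card)
  refine ⟨x, hx, ?_⟩
  by_contra h
  rw [Finset.not_nonempty_iff_eq_empty] at h
  obtain ⟨d, hd, -, -, h2⟩ := death le_rfl h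
  have h3 := (Finset.card_le_card (eff_sub_rows (Z := Z) hd
    (fun c h1 h2 h3 y hy => hF c h1 h2 h3 y (by rw [Finset.mem_singleton.1 hy]; exact hx)))).trans (hZ d)
  simp at h2; omega

lemma noDead_two (K i m : ℕ) (hm : 2 ^ i ≤ m)
    (hK : 2 * 2 ^ i + m < (K - 2 * i) * (2 * 2 ^ i - 1)) : NoDead 2 3 K (2 * 2 ^ i) m := by
  intro F Z j pts hZ hc hsep hF
  set N := 2 ^ i with hN
  have hN1 : 1 ≤ N := Nat.one_le_two_pow
  by_contra hdead
  push Not at hdead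
  have effsub : ∀ k ≤ m, ∀ X ⊆ pts, eff 2 (F ∪ Z) j X k ⊆ rows Z j k := fun k hk X hX =>
    eff_sub_rows hk (fun c h1 h2 h3 y hy => hF c h1 h2 h3 y (hX hy))
  have disj : ∀ k < N, ∀ x ∈ pts, ∀ y ∈ pts, x ≠ y →
      Disjoint (eff 2 (F ∪ Z) j {x} k) (eff 2 (F ∪ Z) j {y} k) := by
    intro k hk x hx y hy hxy
    rw [Finset.disjoint_left]
    intro c h1 h2
    obtain ⟨-, -, -, x', hx', h3, h4⟩ := eff_cone h1
    obtain ⟨-, -, -, y', hy', h5, h6⟩ := eff_cone h2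
    simp only [Finset.mem_singleton] at hx' hy'; subst hx' hy'
    rcases lt_or_gt_of_ne hxy with h | h
    · have := hsep _ hx _ hy h; push_cast at *; omega
    · have := hsep _ hy _ hx h; push_cast at *; omega
  have sumeff : ∀ k < N, ∀ T ⊆ pts, ∑ x ∈ T, (eff 2 (F ∪ Z) j {x} k).card ≤
      (eff 2 (F ∪ Z) j T k).card := by
    intro k hk T hT
    rw [← Finset.card_biUnion (fun x hx y hy hxy => disj k hk x (hT hx) y (hT hy) hxy)]
    apply Finset.card_le_card
    rw [Finset.biUnion_subset]
    exact fun x hx => eff_mono (by simpa using hx) le_rfl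
  have dbl : ∀ l ≤ i, (pts.filter (fun x => run 2 (F ∪ Z) j {x} (2 ^ l - 1) = ∅)).card ≤ 2 * l := by
    intro l
    induction l with
    | zero => intro _; simp [run]
    | succ l ih =>
      intro hl
      have ih := ih (by omega)
      set k := 2 ^ l - 1 with hk
      have hl1 : 1 ≤ 2 ^ l := Nat.one_le_two_pow
      have hk2 : 2 ^ (l+1) - 1 = 2 * k + 1 := by rw [pow_succ]; omega
      have hkN : 2 * k + 1 < N := by
        have : 2 ^ (l+1) ≤ N := Nat.pow_le_pow_right (by norm_num) hl
        have : 1 ≤ 2 ^ (l+1) := Nat.one_le_two_pow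
        omega
      rw [hk2]
      set T := pts.filter (fun x => run 2 (F ∪ Z) j {x} (2*k+1) = ∅ ∧ run 2 (F ∪ Z) j {x} k ≠ ∅)
      have hT : T ⊆ pts := Finset.filter_subset _ _
      have h1 : ∀ x ∈ T, 2 * k + 3 ≤ (eff 2 (F ∪ Z) j {x} (2*k+1)).card := by
        intro x hx
        rw [Finset.mem_filter] at hx
        obtain ⟨d, hd, -, h2, h3⟩ := death (by norm_num) hx.2.1
        have : k < d := by
          by_contra hc; exact hx.2.2 (run_dead (not_lt.1 hc) h2)
        have := Finset.card_le_card (eff_mono (γ := 2) (Y := F ∪ Z) (j := j) (Finset.Subset.refl {x}) hd)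
        simp at h3; omega
      have h2 := Finset.card_nsmul_le_sum _ _ _ h1
      have h3 := (sumeff _ hkN T hT).trans ((Finset.card_le_card (effsub _ (by omega) T hT)).trans (hZ _))
      have h4 : T.card ≤ 2 := by
        by_contra hc
        rw [smul_eq_mul] at h2
        have : 3 * (2 * k + 3) ≤ T.card * (2 * k + 3) := Nat.mul_le_mul_right _ (by omega)
        omega
      have h5 : pts.filter (fun x => run 2 (F ∪ Z) j {x} (2*k+1) = ∅) ⊆
         pts.filter (fun x => run 2 (F ∪ Z) j {x} k = ∅) ∪ T := by
        intro x; simp only [T, Finset.mem_union, Finset.mem_filter]; tauto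
      have := (Finset.card_le_card h5).trans (Finset.card_union_le _ _)
      omega
  have hJ := dbl i le_rfl
  rw [← hN] at hJ
  set L := pts.filter (fun x => run 2 (F ∪ Z) j {x} (N - 1) ≠ ∅) with hL
  have hLc : K ≤ L.card + 2 * i := by
    have := Finset.card_filter_add_card_filter_not (s := pts) (fun x => run 2 (F ∪ Z) j {x} (N-1) = ∅)
    have e : L.card = (pts.filter (fun x => ¬ run 2 (F ∪ Z) j {x} (N-1) = ∅)).card := rfl
    omega
  have hLs : L ⊆ pts := Finset.filter_subset _ _
  have hLne : L.Nonempty := by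
    rw [← Finset.card_pos]
    by_contra h0
    have : K - 2 * i = 0 := by omega
    rw [this] at hK; omega
  have h1 : ∀ x ∈ L, 1 + 2 * (N - 1) ≤ (run 2 (F ∪ Z) j {x} (N-1)).card +
      (eff 2 (F ∪ Z) j {x} (N-1)).card := by
    intro x hx
    rw [hL, Finset.mem_filter] at hx
    refine eff_card (by norm_num) (X := {x}) (N-1) (fun i hi => ?_)
    by_contra hc
    rw [Finset.not_nonempty_iff_eq_empty] at hc
    exact hx.2 (run_dead hi.le hc)
  have h2 := Finset.card_nsmul_le_sum _ _ _ h1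
  rw [Finset.sum_add_distrib, smul_eq_mul] at h2
  have h3 := sumeff (N-1) (by omega) L hLs
  have h4 : ∑ x ∈ L, (run 2 (F ∪ Z) j {x} (N-1)).card ≤ (run 2 (F ∪ Z) j L (N-1)).card := by
    rw [← Finset.card_biUnion]
    · apply Finset.card_le_card
      rw [Finset.biUnion_subset]
      exact fun x hx => run_mono (by simpa using hx) (Finset.Subset.refl _) _
    · intro x hx y hy hxy
      refine Finset.disjoint_left.2 ?_
      intro c h1 h2
      have := run_cone h1
      have := run_cone h2
      rcases lt_or_gt_of_ne hxy with h | h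
      · have := hsep _ (hLs hx) _ (hLs hy) h; push_cast at *; omega
      · have := hsep _ (hLs hy) _ (hLs hx) h; push_cast at *; omega
  set X1 := run 2 (F ∪ Z) j L (N-1)
  have hdL : run 2 (F ∪ Z) (j + (N-1)) X1 (m - (N-1)) = ∅ := by
    rw [← run_add, Nat.add_sub_cancel' (by omega)]
    rw [Finset.eq_empty_iff_forall_notMem]
    intro p hp
    obtain ⟨x, hx, h⟩ := mem_run_iff.1 hp
    rw [hdead x (hLs hx)] at h; simp at h
  obtain ⟨d, hd, -, -, h5⟩ := death (by norm_num) hdL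
  have h6 : (eff 2 (F ∪ Z) j L (N-1)).card + (eff 2 (F ∪ Z) (j+(N-1)) X1 d).card ≤ 3 * (N-1+d) := by
    rw [← Finset.card_union_of_disjoint]
    · refine le_trans (Finset.card_le_card ?_) (hZ (N-1+d))
      apply Finset.union_subset
      · refine (effsub _ (by omega) L hLs).trans ?_
        intro c; simp only [rows, Finset.mem_filter]; grind
      · refine Finset.Subset.trans ?_ (effsub (N-1+d) (by omega) L hLs)
        intro c; simp only [eff, Finset.mem_filter]
        rintro ⟨a1, a2, a3, a4⟩
        refine ⟨a1, by omega, by omega, ?_⟩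
        rw [← run_add] at a4
        have : N - 1 + (c.1 - (j + (N-1)) - 1) = c.1 - j - 1 := by omega
        rwa [this] at a4
    · rw [Finset.disjoint_left]; simp only [eff, Finset.mem_filter]; intro c h1 h2; omega
  have h7 : (K - 2 * i) * (2 * N - 1) ≤ L.card * (1 + 2 * (N - 1)) := by
    apply Nat.mul_le_mul <;> omega
  omega

end PartP3

section PartP4

def Tn (γ ρ n : ℕ) : ℕ := (γ * n + 1) * (ρ * n)
def W0 (γ ρ s : ℕ) : ℕ := (γ * s + 1) * (ρ * s) + s * (2 * s)
def Qn (γ ρ s : ℕ) : ℕ := Tn γ ρ s * (γ * s + 1) + 2 * (s + 1)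

lemma Tn_mono {γ ρ n s : ℕ} (h : n ≤ s) : Tn γ ρ n ≤ Tn γ ρ s := by unfold Tn; gcongr
lemma Qn_mono {γ ρ n s : ℕ} (h : n ≤ s) : Qn γ ρ n ≤ Qn γ ρ s := by
  unfold Qn; have := Tn_mono (γ := γ) (ρ := ρ) h; gcongr

structure FInv (γ ρ s m m1 e t : ℕ) (F : Finset Cell) (X : Finset ℤ) (a b : ℤ) (n : ℕ) (z : ℤ)
    (w : ℕ) (gg : ℕ → ℕ) (LL : ℕ → Finset ℤ) (D : ℕ → Finset Cell) (r0 tr : ℕ)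
    (Xr : Finset ℤ) : Prop where
  hX : X ⊆ Finset.Icc a b
  hP : PP γ ρ t n X a b F (z + γ * n + w)
  hn : n ≤ s
  hw : ∑ r ∈ Finset.Ioo t (t+n), gg r * (r - t + e) ≤ s * w
  L0 : ∀ r, t < r → r < t + n → run γ F t X (r - t) ⊆ LL r
  L1 : ∀ r p, t < r → r < t + n → p ∈ LL r → (r, p) ∈ F → ∃ i ≤ t, r ≤ i + s ∧ (r, p) ∈ D i
  L2 : ∀ r p, t + m1 ≤ r → r0 ≤ r → t < r → r < t + n → p ∈ LL r → p ∉ run γ F t X (r - t) →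
    (∃ i ≤ t, r ≤ i + s ∧ ∃ c ∈ D i, c.2 ≤ p ∧ p ≤ c.2 + γ * s) ∨
    (r ≤ t + m ∧ run γ F r {p} (t + m - r) = ∅)
  L3 : ∀ r, t < r → r < t + n → kap (LL r) ≤ gg r + 1 + Tn γ ρ s
  hD : ∀ i, (D i).card ≤ ρ
  htr : tr ≤ t
  hr0 : r0 ≤ tr + s
  hXr : Xr.card ≤ Qn γ ρ s
  hyg : t < r0 → ∀ x ∈ X, ∃ y ∈ Xr, y ≤ x ∧ x ≤ y + γ * ((t - tr : ℕ):ℤ)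

section
variable {γ ρ s m m1 e t : ℕ} {F : Finset Cell} {X : Finset ℤ} {a b : ℤ} {n : ℕ} {z : ℤ}
    {w : ℕ} {gg : ℕ → ℕ} {LL : ℕ → Finset ℤ} {D : ℕ → Finset Cell} {r0 tr : ℕ}
    {Xr : Finset ℤ}

lemma FInv.mono {s' m' m1' : ℕ} (h : FInv γ ρ s m m1 e t F X a b n z w gg LL D r0 tr Xr)
    (hs : s ≤ s') (hm : m ≤ m') (hm1 : m1 ≤ m1') :
    FInv γ ρ s' m' m1' e t F X a b n z w gg LL D r0 tr Xr where
  hX := h.hX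
  hP := h.hP
  hn := h.hn.trans hs
  hw := h.hw.trans (Nat.mul_le_mul_right _ hs)
  L0 := h.L0
  L1 := fun r p h1 h2 h3 h4 => by
    obtain ⟨i, h5, h6, h7⟩ := h.L1 r p h1 h2 h3 h4
    exact ⟨i, h5, by omega, h7⟩
  L2 := fun r p h1 h2 h3 h4 h5 h6 => by
    rcases h.L2 r p (by omega) h2 h3 h4 h5 h6 with ⟨i, h7, h8, c, h9, h10, h11⟩ | ⟨h7, h8⟩
    · left; refine ⟨i, h7, by omega, c, h9, h10, h11.trans ?_⟩
      gcongr
    · right; exact ⟨by omega, run_dead (by omega) h8⟩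
  L3 := fun r h1 h2 => (h.L3 r h1 h2).trans (by have := Tn_mono (γ := γ) (ρ := ρ) hs; omega)
  hD := h.hD
  htr := h.htr
  hr0 := h.hr0.trans (by omega)
  hXr := h.hXr.trans (Qn_mono hs)
  hyg := h.hyg

lemma FInv.shift (h : FInv γ ρ s m m1 0 t F X a b (n+1) z w gg LL D r0 tr Xr) {Δ : Finset Cell}
    (hΔ : Δ.card ≤ ρ) :
    FInv γ ρ s m m1 1 (t+1) (F ∪ Δ) (run γ (F ∪ Δ) t X 1) (lo γ F t X a 1) (hi γ F t X b 1) n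
      (z + γ - (rowc (F ∪ Δ) (t+1) (lo γ F t X a 1) (hi γ F t X b 1)).card) w gg LL
      (fun i => if i ≤ t then D i else Δ) r0 tr Xr where
  hX := run_sub (Y := F ∪ Δ) h.hX 1
  hP := by
    have := PP_shift h.hP hΔ
    convert this using 1; push_cast; ring
  hn := by have := h.hn; omega
  hw := by
    refine le_trans ?_ h.hw
    refine le_trans (Finset.sum_le_sum (g := fun r => gg r * (r - t + 0)) ?_) (Finset.sum_le_sum_of_subset ?_)
    · intro r hr; rw [Finset.mem_Ioo] at hr
      apply Nat.mul_le_mul_left; omega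
    · intro r; simp only [Finset.mem_Ioo]; omega
  L0 := fun r h1 h2 => by
    rw [← run_add, show 1 + (r - (t+1)) = r - t by omega]
    exact (run_mono (Finset.Subset.refl _) Finset.subset_union_left _).trans
      (h.L0 r (by omega) (by omega))
  L1 := fun r p h1 h2 h3 h4 => by
    rcases Finset.mem_union.1 h4 with h4 | h4
    · obtain ⟨i, h5, h6, h7⟩ := h.L1 r p (by omega) (by omega) h3 h4
      exact ⟨i, by omega, h6, by rw [if_pos h5]; exact h7⟩
    · have := h.hn
      exact ⟨t+1, le_rfl, by omega, by rw [if_neg (by omega)]; exact h4⟩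
  L2 := fun r p h1 h2 h3 h4 h5 h6 => by
    rw [← run_add, show 1 + (r - (t+1)) = r - t by omega] at h6
    by_cases h7 : p ∈ run γ F t X (r - t)
    · left
      rcases Finset.mem_union.1 (run_lost F Δ t (r-t) X h7) with h8 | h8
      · exact (h6 h8).elim
      · obtain ⟨c, hc, h9⟩ := Finset.mem_biUnion.1 h8
        have hn := h.hn
        simp only [rows, Finset.mem_filter] at hc
        refine ⟨t+1, le_rfl, by omega, c, by rw [if_neg (by omega)]; exact hc.1, ?_⟩
        rw [Finset.mem_Icc] at h9
        refine ⟨h9.1, h9.2.trans ?_⟩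
        have : (((t + (r - t) : ℕ):ℤ) - c.1) ≤ s := by omega
        gcongr
    · rcases h.L2 r p (by omega) h2 (by omega) (by omega) h5 h7 with ⟨i, h8, h9, c, h10, h11⟩ | ⟨h8, h9⟩
      · left; exact ⟨i, by omega, h9, c, by rw [if_pos h8]; exact h10, h11⟩
      · right
        refine ⟨by omega, ?_⟩
        have := run_mono (γ := γ) (j := r) (Finset.Subset.refl {p}) (Finset.subset_union_left (s₁ := F) (s₂ := Δ)) (t+m-r)
        rw [h9, Finset.subset_empty] at this
        exact run_dead (by omega) this
  L3 := fun r h1 h2 => h.L3 r (by omega) (by omega)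
  hD := fun i => by
    by_cases hi : i ≤ t
    · simp only [if_pos hi]; exact h.hD i
    · simp only [if_neg hi]; exact hΔ
  htr := by have := h.htr; omega
  hr0 := h.hr0
  hXr := h.hXr
  hyg := fun h1 x hx => by
    rw [show (1:ℕ) = 0 + 1 from rfl, mem_run_succ] at hx
    obtain ⟨⟨y, hy, h2⟩, -⟩ := hx
    obtain ⟨u, hu, h3⟩ := h.hyg (by omega) y hy
    have := h.htr
    have e : (((t + 1 - tr : ℕ)):ℤ) = ((t - tr : ℕ):ℤ) + 1 := by omega
    refine ⟨u, hu, by omega, ?_⟩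
    rw [e]; linarith

lemma FInv.ext1 (hγ : 1 ≤ γ) (h : FInv γ ρ s m m1 1 t F X a b n z w gg LL D r0 tr Xr) (hns : n < s)
    (hb : Tn γ ρ n < (run γ F t X n).card) :
    ∃ w' gg' LL', FInv γ ρ s m m1 1 t F X a b (n+1) z w' gg' LL' D r0 tr Xr := by
  set q := kap (run γ F t X n) - 1 - Tn γ ρ n with hq
  refine ⟨w + q, fun r => if r = t + n then q else gg r,
    fun r => if r = t + n then run γ F t X n else LL r, ?_⟩
  refine ⟨h.hX, ?_, by omega, ?_, ?_, ?_, ?_, ?_, h.hD, h.htr, h.hr0, h.hXr, h.hyg⟩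
  · have := PP_extend hγ h.hX h.hP hb
    convert this using 1
    rw [hq, Tn]; push_cast; ring
  · have h1 : ∑ r ∈ Finset.Ioo t (t+(n+1)), (if r = t + n then q else gg r) * (r - t + 1) ≤
        ∑ r ∈ Finset.Ioo t (t+n), gg r * (r - t + 1) + q * (n + 1) := by
      have hsub : Finset.Ioo t (t+(n+1)) ⊆ insert (t+n) (Finset.Ioo t (t+n)) := by
        intro r; simp only [Finset.mem_Ioo, Finset.mem_insert]; omega
      refine (Finset.sum_le_sum_of_subset hsub).trans ?_
      rw [Finset.sum_insert (by simp)]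
      simp only [if_true]
      rw [show t + n - t + 1 = n + 1 by omega, add_comm]
      gcongr with r hr
      rw [Finset.mem_Ioo] at hr
      rw [if_neg (by omega)]
    refine h1.trans ?_
    have h2 := h.hw
    have h3 : q * (n+1) ≤ q * s := Nat.mul_le_mul_left _ hns
    nlinarith
  · intro r h1 h2
    by_cases hr : r = t + n
    · subst hr; simp
    · simp only [if_neg hr]; exact h.L0 r h1 (by omega)
  · intro r p h1 h2 h3 h4
    by_cases hr : r = t + n
    · subst hr
      simp only [if_true] at h3
      obtain ⟨n0, rfl⟩ : ∃ n0, n = n0 + 1 := ⟨n - 1, by omega⟩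
      exact ((mem_run_succ.1 h3).2 h4).elim
    · simp only [if_neg hr] at h3; exact h.L1 r p h1 (by omega) h3 h4
  · intro r p h1 h2 h3 h4 h5 h6
    by_cases hr : r = t + n
    · subst hr
      simp only [if_true] at h5
      rw [show t + n - t = n by omega] at h6
      exact (h6 h5).elim
    · simp only [if_neg hr] at h5; exact h.L2 r p h1 h2 h3 (by omega) h5 h6
  · intro r h1 h2
    by_cases hr : r = t + n
    · subst hr
      simp only [if_true]
      have := Tn_mono (γ := γ) (ρ := ρ) hns.le
      omega
    · simp only [if_neg hr]; exact h.L3 r h1 (by omega)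

lemma FInv.extAll (hγ : 1 ≤ γ) : ∀ (k n : ℕ) (w : ℕ) (gg : ℕ → ℕ) (LL : ℕ → Finset ℤ), k + n = s →
    FInv γ ρ s m m1 1 t F X a b n z w gg LL D r0 tr Xr →
    ∃ n' w' gg' LL', n ≤ n' ∧ FInv γ ρ s m m1 1 t F X a b n' z w' gg' LL' D r0 tr Xr ∧
      (n' = s ∨ (run γ F t X n').card ≤ Tn γ ρ n') ∧ (X = ∅ → n' = n) := by
  intro k
  induction k with
  | zero => intro n w gg LL hk h; exact ⟨n, w, gg, LL, le_rfl, h, Or.inl (by omega), fun _ => rfl⟩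
  | succ k ih =>
    intro n w gg LL hk h
    by_cases hb : Tn γ ρ n < (run γ F t X n).card
    · obtain ⟨w1, gg1, LL1, h1⟩ := h.ext1 hγ (by omega) hb
      obtain ⟨n', w', gg', LL', h2, h3, h4, h5⟩ := ih (n+1) w1 gg1 LL1 (by omega) h1
      refine ⟨n', w', gg', LL', by omega, h3, h4, ?_⟩
      rintro rfl; rw [run_empty] at hb; simp at hb
    · exact ⟨n, w, gg, LL, le_rfl, h, Or.inr (not_lt.1 hb), fun _ => rfl⟩

lemma FInv.sub (h : FInv γ ρ s m m1 e t F X a b n z w gg LL D r0 tr Xr) {X' : Finset ℤ} {w' e' : ℕ}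
    (hX' : X' ⊆ X) (hP' : PP γ ρ t n X' a b F (z + γ * n + w'))
    (hw' : ∑ r ∈ Finset.Ioo t (t+n), gg r * (r - t + e') ≤ s * w')
    (hL : ∀ r p, t + m1 ≤ r → p ∈ run γ F t X (r-t) → p ∉ run γ F t X' (r-t) →
      r ≤ t + m ∧ run γ F r {p} (t + m - r) = ∅) :
    FInv γ ρ s m m1 e' t F X' a b n z w' gg LL D r0 tr Xr where
  hX := hX'.trans h.hX
  hP := hP'
  hn := h.hn
  hw := hw'
  L0 := fun r h1 h2 => (run_mono hX' (Finset.Subset.refl _) _).trans (h.L0 r h1 h2)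
  L1 := h.L1
  L2 := fun r p h1 h2 h3 h4 h5 h6 => by
    by_cases h7 : p ∈ run γ F t X (r - t)
    · right; exact hL r p h1 h7 h6
    · exact h.L2 r p h1 h2 h3 h4 h5 h7
  L3 := h.L3
  hD := h.hD
  htr := h.htr
  hr0 := h.hr0
  hXr := h.hXr
  hyg := fun h1 x hx => h.hyg h1 x (hX' hx)

lemma FInv.thin (h : FInv γ ρ s m m1 1 t F X a b n z w gg LL D r0 tr Xr)
    (hb : (run γ F t X n).card ≤ Tn γ ρ n) :
    ∃ X' ⊆ X, ∃ tr' Xr', X'.card ≤ Qn γ ρ s ∧ (n = 0 → X' = ∅) ∧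
      FInv γ ρ s m m1 0 t F X' a b n z w gg LL D (t+n) tr' Xr' := by
  classical
  set X' := X.filter (fun x => ¬ (run γ F t {x} n = ∅ ∧ a + n < x ∧ x + n < b)) with hX'
  have hs : X' ⊆ X := Finset.filter_subset _ _
  have hcard : X'.card ≤ Qn γ ρ s := by
    have hsub : X' ⊆ (run γ F t X n).biUnion (fun p => Finset.Icc (p - γ * n) p) ∪
        (Finset.Icc a (a+n) ∪ Finset.Icc (b-n) b) := by
      intro x hx
      rw [hX', Finset.mem_filter] at hx
      have hab := Finset.mem_Icc.1 (h.hX hx.1)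
      simp only [Finset.mem_union, Finset.mem_biUnion, Finset.mem_Icc]
      by_cases hr : run γ F t {x} n = ∅
      · right; by_cases a + n < x
        · right; grind
        · left; omega
      · left
        obtain ⟨p, hp⟩ := Finset.nonempty_iff_ne_empty.2 hr
        have := run_cone hp
        exact ⟨p, mem_run_iff.2 ⟨x, hx.1, hp⟩, by omega⟩
    refine (Finset.card_le_card hsub).trans ((Finset.card_union_le _ _).trans ?_)
    have h1 := Finset.card_biUnion_le_card_mul (run γ F t X n) (fun p => Finset.Icc (p - γ * n) p)
      (γ * n + 1) (fun p hp => by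
        rw [Int.card_Icc]
        have : (0:ℤ) ≤ γ * n := by positivity
        zify; push_cast; omega)
    have h2 := Finset.card_union_le (Finset.Icc a (a+n)) (Finset.Icc (b-n) b)
    rw [Int.card_Icc, Int.card_Icc] at h2
    have h3 : (run γ F t X n).card * (γ * n + 1) ≤ Tn γ ρ s * (γ * s + 1) := by
      have := hb.trans (Tn_mono h.hn); have := h.hn; gcongr
    have := h.hn
    unfold Qn; omega
  refine ⟨X', hs, t, X', hcard, ?_, ?_⟩
  · rintro rfl
    simp [Tn, run] at hb
    rw [← Finset.subset_empty, ← hb]; exact hs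
  · refine ⟨hs.trans h.hX, ?_, h.hn, ?_, ?_, h.L1, ?_, h.L3, h.hD, le_rfl, ?_, hcard, ?_⟩
    · refine PP_doomed h.hP hs le_rfl ?_
      intro x hx hx'
      rw [hX', Finset.mem_filter] at hx'
      tauto
    · refine le_trans (Finset.sum_le_sum ?_) h.hw
      intro r hr; apply Nat.mul_le_mul_left; omega
    · exact fun r h1 h2 => (run_mono hs (Finset.Subset.refl _) _).trans (h.L0 r h1 h2)
    · intro r p h1 h2 h3 h4; omega
    · have := h.hn; omega
    · intro _ x hx; exact ⟨x, hx, le_rfl, by simp⟩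

lemma FInv.young (h : FInv γ ρ s m m1 1 t F X a b n z w gg LL D r0 tr Xr) (ht : t < r0) :
    X.card ≤ Qn γ ρ s * (γ * s + 1) := by
  have hsub : X ⊆ Xr.biUnion (fun y => Finset.Icc y (y + γ * ((t - tr : ℕ):ℤ))) := by
    intro x hx
    obtain ⟨y, hy, h1⟩ := h.hyg ht x hx
    exact Finset.mem_biUnion.2 ⟨y, hy, Finset.mem_Icc.2 h1⟩
  refine (Finset.card_le_card hsub).trans ((Finset.card_biUnion_le_card_mul _ _ (γ * s + 1) ?_).trans
    (Nat.mul_le_mul_right _ h.hXr))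
  intro y hy
  have := h.hr0
  have h2 : γ * (t - tr) ≤ γ * s := Nat.mul_le_mul_left _ (by omega)
  have : (0:ℤ) ≤ γ * ((t - tr : ℕ):ℤ) := by positivity
  rw [Int.card_Icc]; zify at h2 ⊢; omega

lemma FInv.e0 (h : FInv γ ρ s m m1 1 t F X a b n z w gg LL D r0 tr Xr) :
    FInv γ ρ s m m1 0 t F X a b n z w gg LL D r0 tr Xr :=
  h.sub (Finset.Subset.refl _) h.hP
    (le_trans (Finset.sum_le_sum (fun r hr => Nat.mul_le_mul_left _ (by omega))) h.hw)
    (fun r p _ h1 h2 => (h2 h1).elim)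

lemma FInv.sloppy (hγ : 1 ≤ γ) (h : FInv γ ρ s m m1 1 t F X a b n z w gg LL D r0 tr Xr)
    (hm1 : m1 ≤ n) (hs : 0 < s)
    (hG : s * W0 γ ρ s ≤ ∑ r ∈ Finset.Ioo t (t+n), gg r) :
    ∃ X' ⊆ X, ∃ w', X'.card * (1 + γ * m1) ≤ 2 * (b - a + 1 + γ * m1).toNat + 2 * (γ + 1) * F.card ∧
      FInv γ ρ s m m1 0 t F X' a b n z w' gg LL D r0 tr Xr := by
  obtain ⟨X', hX', hr, hc⟩ := net_lem hγ F t m1 h.hX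
  have h1 := h.hw
  have h2 : ∑ r ∈ Finset.Ioo t (t+n), gg r * (r - t + 1) =
      ∑ r ∈ Finset.Ioo t (t+n), gg r * (r - t + 0) + ∑ r ∈ Finset.Ioo t (t+n), gg r := by
    rw [← Finset.sum_add_distrib]; exact Finset.sum_congr rfl (fun r _ => by ring)
  have h3 : W0 γ ρ s ≤ w := by
    apply Nat.le_of_mul_le_mul_left _ hs; omega
  have hreq : ∀ k, m1 ≤ k → run γ F t X' k = run γ F t X k := by
    intro k hk
    obtain ⟨r, rfl⟩ := Nat.exists_eq_add_of_le hk
    rw [run_add, run_add, hr]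
  refine ⟨X', hX', w - W0 γ ρ s, hc, h.sub hX' ?_ ?_ ?_⟩
  · have := PP_sloppy h.hP hX' h.hn (hreq n hm1)
    convert this using 1
    rw [Nat.cast_sub h3, W0]; ring
  · rw [Nat.mul_sub]; omega
  · intro r p h4 h5 h6
    rw [hreq _ (by omega)] at h6; exact (h6 h5).elim
end

end PartP4

section PartP4b

lemma run_straight {γ : ℕ} {Y : Finset Cell} {j : ℕ} {p : ℤ} (n : ℕ)
    (h : ∀ k, j < k → k ≤ j + n → (k, p) ∉ Y) : p ∈ run γ Y j {p} n := by
  induction n with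
  | zero => simp [run]
  | succ n ih =>
    rw [mem_run_succ]
    exact ⟨⟨p, ih (fun k h1 h2 => h k h1 (by omega)), le_rfl, by simp⟩, h _ (by omega) (by omega)⟩

lemma run_full {γ : ℕ} {Y : Finset Cell} {j : ℕ} {u : ℤ} (n : ℕ)
    (h : ∀ c ∈ Y, j < c.1 → c.1 ≤ j + n → u ≤ c.2 → c.2 ≤ u + γ * n → False) (p : ℤ) (h1 : u ≤ p)
    (h2 : p ≤ u + γ * n) : p ∈ run γ Y j {u} n := by
  induction n generalizing p with
  | zero => simp at h2; simp [run]; omega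
  | succ n ih =>
    rw [mem_run_succ]
    push_cast at h h2
    have hg : (0:ℤ) ≤ γ * n := by positivity
    refine ⟨⟨max u (p - γ), ih (fun c a1 a2 a3 a4 a5 => h c a1 a2 (by omega) a4 (by linarith)) _ (by omega) ?_, ?_, by omega⟩,
      fun hc => h _ hc (by simp) (by simp) h1 (by simpa using h2)⟩
    · rw [mul_add] at h2; omega
    · omega

lemma kap_left (L : Finset ℤ) : (L.filter (fun x => x - 1 ∉ L)).card = kap L := by
  unfold kap
  have h1 := Finset.card_filter_add_card_filter_not (s := L) (fun x => x + 1 ∈ L)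
  have h2 := Finset.card_filter_add_card_filter_not (s := L) (fun x => x - 1 ∈ L)
  have h3 : (L.filter (fun x => x + 1 ∈ L)).card = (L.filter (fun x => x - 1 ∈ L)).card := by
    apply Finset.card_bij (fun x _ => x + 1)
    · intro x; simp; tauto
    · intro x _ y _; simp
    · intro y hy; refine ⟨y - 1, ?_, by simp⟩; simp at hy ⊢; tauto
  omega

lemma bdry_right {L : Finset ℤ} {p q : ℤ} (hp : p ∈ L) (hq : q ∉ L) (h : p ≤ q) :
    ∃ z ∈ L, z + 1 ∉ L ∧ p ≤ z ∧ z ≤ q := by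
  obtain ⟨k, rfl⟩ : ∃ k : ℕ, q = p + k := ⟨(q - p).toNat, by omega⟩
  clear h
  induction k with
  | zero => simp at hq; tauto
  | succ k ih =>
    by_cases h : p + k ∈ L
    · exact ⟨p + k, h, by push_cast at hq; rwa [← add_assoc] at hq, by omega, by omega⟩
    · obtain ⟨z, h1, h2, h3, h4⟩ := ih h
      exact ⟨z, h1, h2, h3, by push_cast; omega⟩

lemma bdry_left {L : Finset ℤ} {p q : ℤ} (hp : p ∈ L) (hq : q ∉ L) (h : q ≤ p) :
    ∃ z ∈ L, z - 1 ∉ L ∧ q ≤ z ∧ z ≤ p := by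
  obtain ⟨k, rfl⟩ : ∃ k : ℕ, q = p - k := ⟨(p - q).toNat, by omega⟩
  clear h
  induction k with
  | zero => simp at hq; tauto
  | succ k ih =>
    by_cases h : p - k ∈ L
    · exact ⟨p - k, h, by push_cast at hq; rwa [← sub_sub] at hq, by omega, by omega⟩
    · obtain ⟨z, h1, h2, h3, h4⟩ := ih h
      exact ⟨z, h1, h2, by push_cast; omega, h4⟩

def Nice (s m t : ℕ) (a b Λ : ℤ) (LL : ℕ → Finset ℤ) (D : ℕ → Finset Cell) (x : ℤ) : Prop :=
  a + Λ < x ∧ x + Λ < b ∧ (∀ i ≤ t, t < i + s → ∀ c ∈ D i, ¬ (x - Λ ≤ c.2 ∧ c.2 ≤ x + Λ)) ∧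
  ∀ r, t < r → r ≤ t + m → ∀ p, x - Λ ≤ p → p ≤ x + Λ → p ∈ LL r

def Cov (P G : ℤ) (N : ℤ → Prop) (T : Finset ℤ) : Prop :=
  ∀ x, N x → ∀ y, x - 2 * P ≤ y → y ≤ x + 2 * P → ∃ u ∈ T, y < u ∧ u ≤ y + G

def Rn (γ ρ s m : ℕ) : ℕ := 2 * (4 * γ * s + 1) + s * (ρ * (8 * γ * s + 1)) +
  2 * (s * W0 γ ρ s + m * (1 + Tn γ ρ s)) * (8 * γ * s + 1)

section
variable {γ ρ s m m1 t : ℕ} {F : Finset Cell} {X : Finset ℤ} {a b : ℤ} {n : ℕ} {z : ℤ}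
    {w : ℕ} {gg : ℕ → ℕ} {LL : ℕ → Finset ℤ} {D : ℕ → Finset Cell} {r0 tr : ℕ}
    {Xr : Finset ℤ}

lemma nice_clean (h : FInv γ ρ s m m1 1 t F X a b n z w gg LL D r0 tr Xr) (hmn : m < n) {Λ x : ℤ}
    (hx : Nice s m t a b Λ LL D x) :
    ∀ c ∈ F, t < c.1 → c.1 ≤ t + m → x - Λ ≤ c.2 → c.2 ≤ x + Λ → False := by
  intro c hc h1 h2 h3 h4
  obtain ⟨i, h5, h6, h7⟩ := h.L1 c.1 c.2 h1 (by omega) (hx.2.2.2 _ h1 h2 _ h3 h4) hc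
  exact hx.2.2.1 i h5 (by omega) _ h7 ⟨h3, h4⟩

lemma remove_nice {K g : ℕ} {G : ℤ} (hγ : 1 ≤ γ) (hND : NoDead γ ρ K g m) (hK : K * (g + G) ≤ γ * m) (hG : 0 ≤ G)
    {Λ x : ℤ} {T : Finset ℤ} (hm : 1 ≤ m) (hmn : m ≤ n) (hΛ : 4 * (γ * m) ≤ Λ)
    {N : ℤ → Prop} (hx : N x) (hc : ∀ c ∈ F, t < c.1 → c.1 ≤ t + m → x - Λ ≤ c.2 → c.2 ≤ x + Λ → False)
    (hab : a + Λ < x ∧ x + Λ < b)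
    (hP : PP γ ρ t n T a b F z) (hC : Cov (γ * m) G N (T.erase x)) : PP γ ρ t n (T.erase x) a b F z := by
  classical
  have hPm : (m:ℤ) ≤ γ * m := by nlinarith
  have hgG : (0:ℤ) ≤ g + G := by positivity
  set P : ℤ := γ * m with hPdef
  have hP1 : 1 ≤ P := by omega
  refine PP_remove hγ hP hmn ?_
  intro Z hZ
  have win : ∀ l, x - P - 1 ≤ l → l ≤ x → ∃ u ∈ T.erase x, l < u ∧ u ≤ l + P ∧
      (run γ (F ∪ Z) t {u} m).Nonempty := by
    intro l h1 h2
    have hy : ∀ i < K, 0 ≤ (i:ℤ) * (g + G) ∧ (i:ℤ) * (g+G) + (g + G) ≤ P := by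
      intro i hi
      have : ((i:ℤ) + 1) * (g + G) ≤ K * (g + G) := by gcongr; exact_mod_cast hi
      refine ⟨by positivity, by linarith⟩
    have hex : ∀ i, ∃ u, i < K → u ∈ T.erase x ∧ l + i * (g + G) < u ∧ u ≤ l + i * (g + G) + G := by
      intro i
      by_cases hi : i < K
      · have := hy i hi
        obtain ⟨u, h3, h4⟩ := hC x hx (l + i * (g+G)) (by omega) (by omega)
        exact ⟨u, fun _ => ⟨h3, h4⟩⟩
      · exact ⟨0, fun h => (hi h).elim⟩
    choose f hf using hex
    have hmono : ∀ i j, i < j → j < K → f i + g ≤ f j := by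
      intro i j hij hj
      have h3 := hf i (by omega)
      have h4 := hf j hj
      have : ((i:ℤ) + 1) * (g + G) ≤ j * (g + G) := by gcongr; exact_mod_cast hij
      linarith
    have hmono' : ∀ i j, i < j → j < K → f i < f j := by
      intro i j hij hj
      have h3 := hf i (by omega)
      have h4 := hf j hj
      have : ((i:ℤ) + 1) * (g + G) ≤ j * (g + G) := by gcongr; exact_mod_cast hij
      have : (0:ℤ) ≤ g := by positivity
      linarith
    obtain ⟨u, hu, hal⟩ := hND F Z t ((Finset.range K).image f) hZ (by
        rw [Finset.card_image_of_injOn, Finset.card_range]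
        intro i hi j hj hij
        simp only [Finset.coe_range, Set.mem_Iio] at hi hj
        rcases lt_trichotomy i j with h | h | h
        · have := hmono' i j h hj; omega
        · exact h
        · have := hmono' j i h hi; omega) (by
        intro u hu v hv huv
        simp only [Finset.mem_image, Finset.mem_range] at hu hv
        obtain ⟨i, hi, rfl⟩ := hu
        obtain ⟨j, hj, rfl⟩ := hv
        rcases lt_trichotomy i j with h | h | h
        · exact hmono i j h hj
        · subst h; omega
        · have := hmono' j i h hi; omega) (by
        intro c hcF h3 h4 u hu h5 h6
        simp only [Finset.mem_image, Finset.mem_range] at hu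
        obtain ⟨i, hi, rfl⟩ := hu
        have h7 := hf i hi
        have h8 := hy i hi
        have : (0:ℤ) ≤ g := by positivity
        exact hc c hcF h3 h4 (by omega) (by omega))
    simp only [Finset.mem_image, Finset.mem_range] at hu
    obtain ⟨i, hi, rfl⟩ := hu
    have h7 := hf i hi
    have h8 := hy i hi
    have : (0:ℤ) ≤ g := by positivity
    exact ⟨f i, h7.1, by omega, by omega, hal⟩
  obtain ⟨u0, h1, h2, h3, h4⟩ := win (x - P - 1) le_rfl (by omega)
  obtain ⟨u, hu, hmax⟩ := Finset.exists_max_image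
    ((T.erase x).filter (fun u => u < x ∧ (run γ (F ∪ Z) t {u} m).Nonempty)) id
    ⟨u0, by simp only [Finset.mem_filter]; exact ⟨h1, by omega, h4⟩⟩
  have hu0 := hmax u0 (by simp only [Finset.mem_filter]; exact ⟨h1, by omega, h4⟩)
  simp only [Finset.mem_filter, id] at hu hu0 hmax
  obtain ⟨v, h5, h6, h7, h8⟩ := win u (by omega) (by omega)
  have hvx : x < v := by
    by_contra hh
    have := Finset.ne_of_mem_erase h5
    have := hmax v ⟨h5, by omega, h8⟩
    omega
  refine ⟨u, Finset.mem_of_mem_erase hu.1, v, Finset.mem_of_mem_erase h5, hu.2.1, hvx, hu.2.2, h8,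
    by omega, by omega, by omega, ?_⟩
  intro c hcF h9 h10 h11 h12
  exact hc c hcF h9 h10 (by omega) (by omega)

lemma nice_count {G : ℤ} (hG : 1 ≤ G) {T : Finset ℤ} (hT : T ⊆ Finset.Icc a b)
    (h : ∀ x ∈ T, ∃ y, y < x ∧ x ≤ y + G ∧ ∀ u ∈ T, y < u → u ≤ y + G → u = x) :
    T.card ≤ 2 * (((b - a) / G).toNat + 1) := by
  classical
  have h1 : ∀ x ∈ T, (x - a) / G ∈ Finset.Icc 0 ((b - a) / G) := by
    intro x hx
    have := Finset.mem_Icc.1 (hT hx)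
    rw [Finset.mem_Icc]
    exact ⟨Int.ediv_nonneg (by omega) (by omega), Int.ediv_le_ediv (by omega) (by omega)⟩
  refine (Finset.card_le_mul_card_image_of_maps_to h1 2 ?_).trans ?_
  · intro i _
    by_contra hh
    push Not at hh
    obtain ⟨x, hx, y, hy, w, hw, h2, h3, h4⟩ := Finset.two_lt_card.1 hh
    simp only [Finset.mem_filter] at hx hy hw
    have ex := Int.emod_add_mul_ediv (x - a) G
    have ey := Int.emod_add_mul_ediv (y - a) G
    have ew := Int.emod_add_mul_ediv (w - a) G
    rw [hx.2] at ex
    rw [hy.2] at ey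
    rw [hw.2] at ew
    have := Int.emod_lt_of_pos (x - a) (by omega : 0 < G)
    have := Int.emod_lt_of_pos (y - a) (by omega : 0 < G)
    have := Int.emod_lt_of_pos (w - a) (by omega : 0 < G)
    have := Int.emod_nonneg (x - a) (by omega : G ≠ 0)
    have := Int.emod_nonneg (y - a) (by omega : G ≠ 0)
    have := Int.emod_nonneg (w - a) (by omega : G ≠ 0)
    obtain ⟨p, p1, p2, p3⟩ := h x hx.1
    obtain ⟨q, q1, q2, q3⟩ := h y hy.1
    obtain ⟨r, r1, r2, r3⟩ := h w hw.1
    have := fun e e' => h2 (p3 y hy.1 e e').symm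
    have := fun e e' => h3 (p3 w hw.1 e e').symm
    have := fun e e' => h2 (q3 x hx.1 e e')
    have := fun e e' => h4 (q3 w hw.1 e e').symm
    have := fun e e' => h3 (r3 x hx.1 e e')
    have := fun e e' => h4 (r3 y hy.1 e e')
    clear p3 q3 r3 h h1 hh
    grind
  · rw [Int.card_Icc]
    have : 0 ≤ (b-a)/G ∨ (b-a)/G < 0 := by omega
    omega
end

end PartP4b

section PartP4c

section
variable {γ ρ s m m1 t : ℕ} {F : Finset Cell} {X : Finset ℤ} {a b : ℤ} {n : ℕ} {z : ℤ}
    {w : ℕ} {gg : ℕ → ℕ} {LL : ℕ → Finset ℤ} {D : ℕ → Finset Cell} {r0 tr : ℕ}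
    {Xr : Finset ℤ}

lemma nonnice_count (h : FInv γ ρ s m m1 1 t F X a b n z w gg LL D r0 tr Xr) (hγ : 1 ≤ γ)
    (hms : m ≤ s) (hmn : m < n) (hG : ∑ r ∈ Finset.Ioo t (t+n), gg r ≤ s * W0 γ ρ s) {T : Finset ℤ} (hT : T ⊆ X)
    (hal : ∀ x ∈ T, a + m < x → x + m < b → (run γ F t {x} m).Nonempty)
    (hN : ∀ x ∈ T, ¬ Nice s m t a b (4 * γ * s) LL D x) : T.card ≤ Rn γ ρ s m := by
  classical
  set Λ : ℕ := 4 * γ * s with hΛ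
  have hmΛ : m ≤ γ * s := by nlinarith
  have hmΛ' : γ * m ≤ γ * s := by nlinarith
  have hΛ4 : Λ = 4 * (γ * s) := by rw [hΛ]; ring
  have hsub : T ⊆ (Finset.Icc a (a + Λ) ∪ Finset.Icc (b - Λ) b) ∪
      ((Finset.Icc (t + 1 - s) t).biUnion (fun i => (D i).biUnion (fun c => Finset.Icc (c.2 - Λ) (c.2 + Λ)))) ∪
      ((Finset.Ioc t (t+m)).biUnion (fun r => ((LL r).filter (fun x => x + 1 ∉ LL r) ∪
        (LL r).filter (fun x => x - 1 ∉ LL r)).biUnion (fun c => Finset.Icc (c - Λ) (c + Λ)))) := by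
    intro x hx
    have hab := Finset.mem_Icc.1 (h.hX (hT hx))
    have hn := hN x hx
    simp only [Finset.mem_union, Finset.mem_biUnion, Finset.mem_Icc, Finset.mem_Ioc, Finset.mem_filter]
    by_contra hcon
    push Not at hcon
    obtain ⟨⟨⟨c1, c2⟩, c3⟩, c4⟩ := hcon
    apply hn
    have e1 : a + (Λ:ℤ) < x := by have := c1 hab.1; omega
    have e2 : x + (Λ:ℤ) < b := by
      by_contra hh; have := c2 (by omega); omega
    rw [show (4 * γ * s : ℤ) = (Λ:ℤ) by rw [hΛ]; push_cast; ring]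
    refine ⟨e1, e2, ?_, ?_⟩
    · rintro i h1 h2 c hc ⟨h3, h4⟩
      have := c3 i (by omega) c hc (by omega); omega
    · intro r h1 h2 p h3 h4
      by_contra hp
      have hmL : m ≤ Λ := by omega
      obtain ⟨q, hq⟩ := hal x hx (by omega) (by omega)
      rw [show m = (r - t) + (t + m - r) by omega, run_add] at hq
      obtain ⟨q', hq', -⟩ := mem_run_iff.1 hq
      have hc := run_cone hq'
      have hqL := h.L0 r h1 (by omega) (mem_run_iff.2 ⟨x, hT hx, hq'⟩)
      have h5 : (γ:ℤ) * ((r - t : ℕ):ℤ) ≤ Λ := by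
        have : γ * (r - t) ≤ Λ := by
          have : γ * (r - t) ≤ γ * m := Nat.mul_le_mul_left _ (by omega)
          omega
        exact_mod_cast this
      rcases le_total p q' with h6 | h6
      · obtain ⟨y, y1, y2, y3, y4⟩ := bdry_left hqL hp h6
        have := c4 r ⟨h1, h2⟩ y (Or.inr ⟨y1, y2⟩) (by omega); omega
      · obtain ⟨y, y1, y2, y3, y4⟩ := bdry_right hqL hp h6
        have := c4 r ⟨h1, h2⟩ y (Or.inl ⟨y1, y2⟩) (by omega); omega
  refine (Finset.card_le_card hsub).trans ?_
  have cI : ∀ c : ℤ, (Finset.Icc (c - Λ) (c + Λ)).card ≤ 8 * γ * s + 1 := by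
    intro c; rw [Int.card_Icc]
    have : 8 * γ * s = 2 * Λ := by rw [hΛ]; ring
    omega
  refine (Finset.card_union_le _ _).trans (Nat.add_le_add ((Finset.card_union_le _ _).trans
    (Nat.add_le_add ?_ ?_)) ?_)
  · refine (Finset.card_union_le _ _).trans ?_
    rw [Int.card_Icc, Int.card_Icc]; omega
  · refine (Finset.card_biUnion_le_card_mul _ _ (ρ * (8 * γ * s + 1)) ?_).trans ?_
    · intro i _
      exact (Finset.card_biUnion_le_card_mul _ _ _ (fun c _ => cI _)).trans (Nat.mul_le_mul_right _ (h.hD i))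
    · apply Nat.mul_le_mul_right; rw [Nat.card_Icc]; omega
  · have : ∀ r ∈ Finset.Ioc t (t+m), (((LL r).filter (fun x => x + 1 ∉ LL r) ∪
        (LL r).filter (fun x => x - 1 ∉ LL r)).biUnion (fun c => Finset.Icc (c - Λ) (c + Λ))).card ≤
        (2 * (gg r + (1 + Tn γ ρ s))) * (8 * γ * s + 1) := by
      intro r hr
      rw [Finset.mem_Ioc] at hr
      refine (Finset.card_biUnion_le_card_mul _ _ _ (fun c _ => cI _)).trans (Nat.mul_le_mul_right _ ?_)
      refine (Finset.card_union_le _ _).trans ?_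
      rw [kap_left]
      have := h.L3 r hr.1 (by omega)
      change kap (LL r) + kap (LL r) ≤ _
      omega
    refine Finset.card_biUnion_le.trans ((Finset.sum_le_sum this).trans ?_)
    rw [← Finset.sum_mul, ← Finset.mul_sum, Finset.sum_add_distrib, Finset.sum_const, Nat.card_Ioc]
    apply Nat.mul_le_mul_right
    apply Nat.mul_le_mul_left
    apply Nat.add_le_add
    · refine le_trans (Finset.sum_le_sum_of_subset ?_) hG
      intro r; simp only [Finset.mem_Ioc, Finset.mem_Ioo]; omega
    · simp

lemma FInv.light {K g : ℕ} (h : FInv γ ρ s m m1 1 t F X a b n z w gg LL D r0 tr Xr) (hγ : 1 ≤ γ)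
    (hND : NoDead γ ρ K g m) (hK : K * (g + (γ * m1 + 1)) ≤ γ * m)
    (hm1 : 1 ≤ m1) (hm : 2 * m1 ≤ m) (hms : m < s) (hns : n = s) (hr0 : r0 ≤ t)
    (hG : ∑ r ∈ Finset.Ioo t (t+n), gg r ≤ s * W0 γ ρ s) :
    ∃ X' ⊆ X, X'.card ≤ 2 * (((b - a) / (γ * m1 + 1)).toNat + 1) + Rn γ ρ s m ∧
      FInv γ ρ s m m1 0 t F X' a b n z w gg LL D r0 tr Xr := by
  classical
  set Q : ℤ := γ * m1 with hQ
  set P : ℤ := γ * m with hP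
  set Λ : ℤ := 4 * γ * s with hΛ
  have a1 : (1:ℤ) ≤ Q := by rw [hQ]; nlinarith
  have a2 : 2 * Q ≤ P := by
    rw [hP, hQ]; have : γ * (2 * m1) ≤ γ * m := Nat.mul_le_mul_left _ hm
    zify at this; linarith
  have a3 : 4 * P ≤ Λ := by
    rw [hP, hΛ]; have : γ * m ≤ γ * s := Nat.mul_le_mul_left _ hms.le
    zify at this; linarith
  have a4 : (m:ℤ) ≤ P := by rw [hP]; nlinarith
  have hN1 := fun x (hx : Nice s m t a b Λ LL D x) => nice_clean h (by omega) hx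
  set S1 := X.filter (fun x => ¬ (run γ F t {x} m = ∅ ∧ a + m < x ∧ x + m < b)) with hS1
  have hS1X : S1 ⊆ X := Finset.filter_subset _ _
  have hPP1 : PP γ ρ t n S1 a b F (z + γ * n + w) := by
    refine PP_doomed h.hP hS1X (by omega : m ≤ n) ?_
    intro x hx hx'
    rw [hS1, Finset.mem_filter] at hx'
    tauto
  have hCov1 : Cov P (Q + 1) (Nice s m t a b Λ LL D) S1 := by
    intro x hx y hy1 hy2
    have hst : ∀ p, x - Λ ≤ p → p ≤ x + Λ → ∀ r, t ≤ r → r ≤ t + m → p ∈ run γ F r {p} (t + m - r) := by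
      intro p h1 h2 r h3 h4
      exact run_straight _ (fun k h5 h6 h7 => hN1 x hx _ h7 (by simp; omega) (by simp; omega) h1 h2)
    by_cases hp : y + Q + 1 ∈ run γ F t X (t + m1 - t)
    · rw [show t + m1 - t = m1 by omega] at hp
      obtain ⟨u, hu, hpu⟩ := mem_run_iff.1 hp
      have hc := run_cone hpu
      refine ⟨u, ?_, by omega, by omega⟩
      rw [hS1, Finset.mem_filter]
      refine ⟨hu, fun hd => ?_⟩
      have : y + Q + 1 ∈ run γ F t {u} m := by
        rw [show m = m1 + (m - m1) by omega, run_add]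
        refine mem_run_iff.2 ⟨_, hpu, ?_⟩
        have := hst (y + Q + 1) (by omega) (by omega) (t + m1) (by omega) (by omega)
        rwa [show t + m - (t + m1) = m - m1 by omega] at this
      rw [hd.1] at this; simp at this
    · exfalso
      rcases h.L2 (t + m1) (y + Q + 1) le_rfl (by omega) (by omega) (by omega)
        (hx.2.2.2 _ (by omega) (by omega) _ (by omega) (by omega)) hp with ⟨i, h1, h2, c, h3, h4, h5⟩ | ⟨h1, h2⟩
      · refine hx.2.2.1 i h1 (by omega) c h3 ?_
        have : Λ = 4 * (γ * s) := by rw [hΛ]; ring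
        omega
      · have := hst (y + Q + 1) (by omega) (by omega) (t + m1) (by omega) (by omega)
        rw [h2] at this; simp at this
  obtain ⟨T, hT, hmin⟩ := Finset.exists_min_image
    (S1.powerset.filter (fun T => (∀ x ∈ S1, ¬ Nice s m t a b Λ LL D x → x ∈ T) ∧
      PP γ ρ t n T a b F (z + γ * n + w) ∧ Cov P (Q+1) (Nice s m t a b Λ LL D) T)) Finset.card
    ⟨S1, by simp only [Finset.mem_filter, Finset.mem_powerset]; exact ⟨Finset.Subset.refl _, fun _ h _ => h, hPP1, hCov1⟩⟩
  simp only [Finset.mem_filter, Finset.mem_powerset] at hT hmin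
  obtain ⟨hTS, hTn, hTP, hTC⟩ := hT
  have huniq : ∀ x ∈ T.filter (Nice s m t a b Λ LL D), ∃ y, y < x ∧ x ≤ y + (Q + 1) ∧
      ∀ u ∈ T.filter (Nice s m t a b Λ LL D), y < u → u ≤ y + (Q + 1) → u = x := by
    intro x hx
    rw [Finset.mem_filter] at hx
    have hnc : ¬ Cov P (Q+1) (Nice s m t a b Λ LL D) (T.erase x) := by
      intro hc
      have hp := remove_nice hγ hND (G := Q + 1) (by rw [hQ]; exact_mod_cast hK) (by omega) (by omega) (by omega)
        a3 hx.2 (hN1 x hx.2) ⟨hx.2.1, hx.2.2.1⟩ hTP hc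
      have := hmin (T.erase x) ⟨(Finset.erase_subset _ _).trans hTS, fun y hy hny =>
        Finset.mem_erase.2 ⟨fun he => hny (he ▸ hx.2), hTn y hy hny⟩, hp, hc⟩
      have := Finset.card_erase_lt_of_mem hx.1
      omega
    unfold Cov at hnc
    push Not at hnc
    obtain ⟨x', hx', y, y1, y2, y3⟩ := hnc
    obtain ⟨u, hu, u1, u2⟩ := hTC x' hx' y y1 y2
    have key : ∀ v ∈ T, y < v → v ≤ y + (Q + 1) → v = x := by
      intro v hv v1 v2
      by_contra hne
      have := y3 v (Finset.mem_erase.2 ⟨hne, hv⟩) v1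
      omega
    have := key u hu u1 u2
    subst this
    exact ⟨y, u1, u2, fun v hv => key v (Finset.mem_filter.1 hv).1⟩
  refine ⟨T, hTS.trans hS1X, ?_, h.sub (hTS.trans hS1X) hTP ?_ ?_⟩
  · rw [← Finset.card_filter_add_card_filter_not (s := T) (Nice s m t a b Λ LL D)]
    apply Nat.add_le_add
    · exact nice_count (by omega) (((Finset.filter_subset _ _).trans (hTS.trans hS1X)).trans h.hX) huniq
    · refine nonnice_count h hγ hms.le (by omega) hG
        (((Finset.filter_subset _ _).trans (hTS.trans hS1X))) ?_ ?_
      · intro x hx h1 h2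
        have := hTS (Finset.mem_filter.1 hx).1
        rw [hS1, Finset.mem_filter] at this
        rw [Finset.nonempty_iff_ne_empty]; tauto
      · intro x hx; exact (Finset.mem_filter.1 hx).2
  · exact le_trans (Finset.sum_le_sum (fun r hr => Nat.mul_le_mul_left _ (by omega))) h.hw
  · intro r p hr hp hp'
    obtain ⟨x, hx, hpx⟩ := mem_run_iff.1 hp
    by_cases hxS : x ∈ S1
    · exfalso
      have hxT : x ∉ T := fun hh => hp' (mem_run_iff.2 ⟨x, hh, hpx⟩)
      have hxN : Nice s m t a b Λ LL D x := by by_contra hh; exact hxT (hTn x hxS hh)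
      obtain ⟨u0, hu0, h1, h2⟩ := hTC x hxN (x - Q - 2) (by omega) (by omega)
      have hu0x : u0 ≠ x := fun e => hxT (e ▸ hu0)
      obtain ⟨u, hu, hmax⟩ := Finset.exists_max_image (T.filter (fun u => u < x)) id
        ⟨u0, by rw [Finset.mem_filter]; exact ⟨hu0, by omega⟩⟩
      have hh := hmax u0 (by rw [Finset.mem_filter]; exact ⟨hu0, by omega⟩)
      simp only [Finset.mem_filter, id] at hu hmax hh
      obtain ⟨v, hv, v1, v2⟩ := hTC x hxN u (by omega) (by omega)
      have hvx : x < v := by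
        by_contra h5
        have h6 : v ≠ x := fun e => hxT (e ▸ hv)
        have := hmax v ⟨hv, by omega⟩
        omega
      apply hp'
      rw [show r - t = m1 + (r - t - m1) by omega, run_add] at hpx ⊢
      refine run_mono ?_ (Finset.Subset.refl _) _ hpx
      intro q hq
      have hc := run_cone hq
      refine mem_run_iff.2 ?_
      by_cases hqu : q ≤ u + Q
      · refine ⟨u, hu.1, run_full m1 ?_ q (by omega) hqu⟩
        intro c hcF c1 c2 c3 c4
        exact hN1 x hxN c hcF c1 (by omega) (by omega) (by omega)
      · refine ⟨v, hv, run_full m1 ?_ q (by omega) (by omega)⟩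
        intro c hcF c1 c2 c3 c4
        exact hN1 x hxN c hcF c1 (by omega) (by omega) (by omega)
    · rw [hS1, Finset.mem_filter] at hxS
      have hd : run γ F t {x} m = ∅ := by tauto
      have hrm : r ≤ t + m := by
        by_contra hh
        rw [run_dead (by omega : m ≤ r - t) hd] at hpx; simp at hpx
      refine ⟨hrm, ?_⟩
      rw [show m = (r - t) + (t + m - r) by omega, run_add, show t + (r - t) = r by omega] at hd
      rw [← Finset.subset_empty, ← hd]
      exact run_mono (by simpa using hpx) (Finset.Subset.refl _) _
end

end PartP4c

section PartP4d

def Ms (t : ℕ) : ℕ := 2 ^ (max 7 (Nat.log 2 t / 14))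

lemma Ms_mono {t t' : ℕ} (h : t ≤ t') : Ms t ≤ Ms t' := by
  unfold Ms
  apply Nat.pow_le_pow_right (by norm_num)
  have := Nat.div_le_div_right (c := 14) (Nat.log_mono_right (b := 2) h)
  omega

lemma one_le_Ms (t : ℕ) : 128 ≤ Ms t := by
  unfold Ms
  calc 128 = 2 ^ 7 := by norm_num
    _ ≤ _ := Nat.pow_le_pow_right (by norm_num) (le_max_left _ _)

lemma lt_Ms (t : ℕ) : t < 2 ^ 14 * Ms t ^ 14 := by
  have h1 : t < 2 ^ (Nat.log 2 t + 1) := Nat.lt_pow_succ_log_self (by norm_num) t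
  refine h1.trans_le ?_
  unfold Ms
  rw [← pow_mul, ← pow_add]
  apply Nat.pow_le_pow_right (by norm_num)
  omega

lemma Ms_le (t : ℕ) (ht : 1 ≤ t) : Ms t ^ 14 ≤ 2 ^ 98 * t := by
  unfold Ms
  rcases le_total 7 (Nat.log 2 t / 14) with h | h
  · rw [max_eq_right h, ← pow_mul]
    have h1 : 2 ^ (Nat.log 2 t / 14 * 14) ≤ t := by
      refine le_trans (Nat.pow_le_pow_right (by norm_num) (Nat.div_mul_le_self _ _)) (Nat.pow_log_le_self 2 (by omega))
    nlinarith
  · rw [max_eq_left h, ← pow_mul]; norm_num; omega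

def Good (γ ρ : ℕ) : Prop := 1 ≤ γ ∧ γ ≤ 2 ∧ ρ ≤ 3 ∧
  ∀ t, NoDead γ ρ (Ms t) (8 * γ * Ms t ^ 2) (10 * Ms t ^ 3)

lemma good_one : Good 1 1 := ⟨le_rfl, by norm_num, by norm_num, fun t => noDead_one _ _ _ (by have := one_le_Ms t; omega)⟩

lemma good_two : Good 2 3 := by
  refine ⟨by norm_num, le_rfl, le_rfl, fun t => ?_⟩
  unfold Ms
  set a := max 7 (Nat.log 2 t / 14) with ha
  have h7 : 7 ≤ a := le_max_left _ _
  have hM : 128 ≤ 2 ^ a := one_le_Ms t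
  have h4 : 10 * (2 * (2 * a + 3)) ≤ 3 * 2 ^ a := by
    clear_value a
    clear ha hM
    induction a, h7 using Nat.le_induction with
    | base => norm_num
    | succ k hk ih =>
      have : 32 ≤ 2 ^ k := Nat.pow_le_pow_right (n := 2) (i := 5) (by norm_num) (by omega)
      rw [pow_succ]; omega
  have e : 8 * 2 * (2 ^ a) ^ 2 = 2 * 2 ^ (2 * a + 3) := by rw [pow_add, pow_mul']; ring
  rw [e]
  have e2 : 2 ^ (2 * a + 3) = 8 * (2 ^ a) ^ 2 := by rw [pow_add, pow_mul']; ring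
  set M := 2 ^ a with hMd
  apply noDead_two
  · rw [e2]; nlinarith [Nat.zero_le (M^2)]
  · rw [e2]
    have h5 : 7 * M ≤ 10 * (M - 2 * (2 * a + 3)) := by omega
    have h6 : 1 ≤ M ^ 2 := Nat.one_le_pow _ _ (by omega)
    obtain ⟨k, hk⟩ : ∃ k, 2 * (8 * M^2) = k + 1 := ⟨2 * (8 * M^2) - 1, by omega⟩
    rw [hk, Nat.add_sub_cancel]
    generalize M - 2 * (2 * a + 3) = R at *
    have h7 : 7 * M * k ≤ 10 * R * k := Nat.mul_le_mul_right _ h5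
    have h8 : 7 * M * k + 7 * M = 112 * M ^ 3 := by
      have : 112 * M^3 = 7 * M * (2 * (8 * M^2)) := by ring
      rw [this, hk]; ring
    have h9 : 128 * M ^ 2 ≤ M ^ 3 := by nlinarith
    have h10 : M ≤ M ^ 2 := by nlinarith
    nlinarith

def Front (γ ρ t : ℕ) (F : Finset Cell) (X : Finset ℤ) (a b : ℤ) (n : ℕ) (z : ℤ) : Prop :=
  ∃ w gg LL D r0 tr Xr, FInv γ ρ (20 * Ms t ^ 3) (10 * Ms t ^ 3) (Ms t ^ 2) 0 t F X a b n z w gg LL D r0 tr Xr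

lemma Qn_le {γ ρ M : ℕ} (hγ : γ ≤ 2) (hρ : ρ ≤ 3) (hM : 1 ≤ M) :
    Qn γ ρ (20 * M ^ 3) * (γ * (20 * M ^ 3) + 1) ≤ 10 ^ 9 * M ^ 12 ∧
    Qn γ ρ (20 * M ^ 3) ≤ 10 ^ 9 * M ^ 12 ∧
    Rn γ ρ (20 * M ^ 3) (10 * M ^ 3) ≤ 10 ^ 9 * M ^ 12 - 2 := by
  obtain ⟨Y, hY⟩ : ∃ Y, Y = M ^ 3 := ⟨_, rfl⟩
  have h1 : 1 ≤ Y := by rw [hY]; exact Nat.one_le_pow _ _ hM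
  have e : M ^ 12 = Y ^ 4 := by rw [hY]; ring
  rw [e, ← hY]
  have h2 : Y ≤ Y ^ 2 := by nlinarith
  have h3 : Y ^ 2 ≤ Y ^ 3 := by nlinarith
  have h4 : Y ^ 3 ≤ Y ^ 4 := by nlinarith [Nat.zero_le (Y^3)]
  have hq : Qn γ ρ (20 * Y) * (γ * (20 * Y) + 1) ≤ Qn 2 3 (20 * Y) * (2 * (20 * Y) + 1) := by
    unfold Qn Tn; gcongr
  have hr : Rn γ ρ (20 * Y) (10 * Y) ≤ Rn 2 3 (20 * Y) (10 * Y) := by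
    unfold Rn W0 Tn; gcongr
  have hq2 : Qn 2 3 (20 * Y) * (2 * (20 * Y) + 1) ≤ 10 ^ 9 * Y ^ 4 := by
    unfold Qn Tn; ring_nf; omega
  have hr2 : Rn 2 3 (20 * Y) (10 * Y) + 2 ≤ 10 ^ 9 * Y ^ 4 := by
    unfold Rn W0 Tn; ring_nf; omega
  refine ⟨hq.trans hq2, le_trans ?_ (hq.trans hq2), by omega⟩
  exact Nat.le_mul_of_pos_right _ (by positivity)

section
variable {γ ρ t : ℕ} {F : Finset Cell} {X : Finset ℤ} {a b : ℤ} {n : ℕ} {z : ℤ}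

set_option maxHeartbeats 1000000 in
lemma norm_front (hg : Good γ ρ) {w : ℕ} {gg : ℕ → ℕ} {LL : ℕ → Finset ℤ} {D : ℕ → Finset Cell} {r0 tr : ℕ}
    {Xr : Finset ℤ}
    (h : FInv γ ρ (20 * Ms t ^ 3) (10 * Ms t ^ 3) (Ms t ^ 2) 1 t F X a b n z w gg LL D r0 tr Xr) (c : ℕ)
    (hab : b - a + 1 ≤ c * Ms t ^ 14) (hF : F.card ≤ c * Ms t ^ 14) :
    ∃ X' ⊆ X, ∃ n', Front γ ρ t F X' a b n' z ∧ n ≤ n' ∧ (n' = 0 → X' = ∅) ∧ (X = ∅ → n' = n) ∧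
      X'.card ≤ (10 ^ 9 + 8 * c + 4) * Ms t ^ 12 := by
  obtain ⟨hγ, hγ2, hρ, hND⟩ := hg
  have hM := one_le_Ms t
  have hQ := Qn_le hγ2 hρ (by omega : 1 ≤ Ms t)
  have hND := hND t
  unfold Front
  set M := Ms t with hMd
  have h12 : 1 ≤ M ^ 12 := Nat.one_le_pow _ _ (by omega)
  have h2 : 1 ≤ M ^ 2 := Nat.one_le_pow _ _ (by omega)
  have h23 : M ^ 2 ≤ M ^ 3 := Nat.pow_le_pow_right (by omega) (by norm_num)
  obtain ⟨n', w', gg', LL', h3, h4, h5, h6⟩ := FInv.extAll hγ (20 * M ^ 3 - n) n w gg LL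
    (by have := h.hn; omega) h
  by_cases hb : (run γ F t X n').card ≤ Tn γ ρ n'
  · obtain ⟨X', hX', tr', Xr', h7, h8, h9⟩ := h4.thin hb
    refine ⟨X', hX', n', ⟨_, _, _, _, _, _, _, h9⟩, h3, h8, h6, ?_⟩
    nlinarith
  · have hns : n' = 20 * M ^ 3 := by tauto
    have hn0 : n' ≠ 0 := by omega
    by_cases ht : t < r0
    · refine ⟨X, Finset.Subset.refl _, n', ⟨_, _, _, _, _, _, _, h4.e0⟩, h3, fun h => (hn0 h).elim, h6, ?_⟩
      have := h4.young ht
      nlinarith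
    · by_cases hG : 20 * M ^ 3 * W0 γ ρ (20 * M ^ 3) ≤ ∑ r ∈ Finset.Ioo t (t+n'), gg' r
      · obtain ⟨X', hX', w'', h7, h8⟩ := h4.sloppy hγ (by omega) (by omega) hG
        refine ⟨X', hX', n', ⟨_, _, _, _, _, _, _, h8⟩, h3, fun h => (hn0 h).elim, h6, ?_⟩
        have e1 : (b - a + 1 + γ * (M ^ 2 : ℕ)).toNat ≤ c * M ^ 14 + 2 * M ^ 2 := by
          have : (γ:ℤ) * (M ^ 2 : ℕ) ≤ 2 * M ^ 2 := by
            have : γ * M ^ 2 ≤ 2 * M ^ 2 := Nat.mul_le_mul_right _ hγ2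
            exact_mod_cast this
          rw [Int.toNat_le]; push_cast at this ⊢; linarith
        have e2 : 2 * (γ + 1) * F.card ≤ 6 * (c * M ^ 14) := by
          apply Nat.mul_le_mul _ hF; omega
        have e3 : X'.card * M ^ 2 ≤ (8 * c * M ^ 12 + 4) * M ^ 2 := by
          calc X'.card * M ^ 2 ≤ X'.card * (1 + γ * M ^ 2) := by
                apply Nat.mul_le_mul_left; nlinarith
            _ ≤ 2 * (c * M ^ 14 + 2 * M ^ 2) + 6 * (c * M ^ 14) := by omega
            _ = _ := by ring
        have e4 := Nat.le_of_mul_le_mul_right e3 h2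
        nlinarith
      · have hK : M * (8 * γ * M ^ 2 + (γ * M ^ 2 + 1)) ≤ γ * (10 * M ^ 3) := by
          have : M ≤ γ * M ^ 3 := by
            calc M = 1 * M ^ 1 := by ring
              _ ≤ _ := Nat.mul_le_mul hγ (Nat.pow_le_pow_right (by omega) (by norm_num))
          calc _ = 9 * (γ * M ^ 3) + M := by ring
            _ ≤ 10 * (γ * M ^ 3) := by omega
            _ = _ := by ring
        obtain ⟨X', hX', h7, h8⟩ := h4.light hγ hND hK h2 (by omega) (by omega) hns (by omega) (by omega)
        refine ⟨X', hX', n', ⟨_, _, _, _, _, _, _, h8⟩, h3, fun h => (hn0 h).elim, h6, ?_⟩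
        have e1 : ((b - a) / (γ * (M ^ 2 : ℕ) + 1)).toNat ≤ c * M ^ 12 := by
          rw [Int.toNat_le]
          apply Int.le_of_lt_add_one
          rw [Int.ediv_lt_iff_lt_mul (by positivity)]
          have : ((c * M ^ 12 : ℕ) + 1 : ℤ) * (γ * (M ^ 2 : ℕ) + 1) ≥ (c * M ^ 14 : ℕ) := by
            have : (c * M ^ 12 + 1) * (γ * M ^ 2 + 1) ≥ c * M ^ 14 := by
              calc c * M ^ 14 = (c * M ^ 12) * (1 * M ^ 2) := by ring
                _ ≤ _ := by apply Nat.mul_le_mul (by omega); nlinarith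
            exact_mod_cast this
          push_cast at this ⊢; linarith
        have e2 := hQ.2.2
        rw [show (10 ^ 9 + 8 * c + 4) * M ^ 12 = 10 ^ 9 * M ^ 12 + 8 * (c * M ^ 12) + 4 * M ^ 12 by ring]
        omega

lemma Front.start (hg : Good γ ρ) (hX : X ⊆ Finset.Icc a b) (c : ℕ)
    (hab : b - a + 1 ≤ c * Ms t ^ 14) (hF : F.card ≤ c * Ms t ^ 14) :
    ∃ X' ⊆ X, ∃ n', Front γ ρ t F X' a b n' X.card ∧ (n' = 0 → X' = ∅) ∧
      X'.card ≤ (10 ^ 9 + 8 * c + 4) * Ms t ^ 12 := by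
  have h : FInv γ ρ (20 * Ms t ^ 3) (10 * Ms t ^ 3) (Ms t ^ 2) 1 t F X a b 0 X.card 0 (fun _ => 0) (fun _ => ∅)
      (fun _ => ∅) t t ∅ := by
    refine ⟨hX, ?_, by omega, by simp, ?_, ?_, ?_, ?_, by simp, le_rfl, by omega, by simp, ?_⟩
    · intro Z _; simp [val, run]
    all_goals intros; omega
  obtain ⟨X', h1, n', h2, h3, h4, h5, h6⟩ := norm_front hg h c hab hF
  exact ⟨X', h1, n', h2, h4, h6⟩

lemma Front.step (hg : Good γ ρ) (h : Front γ ρ t F X a b (n+1) z) {Δ : Finset Cell} (hΔ : Δ.card ≤ ρ) (c : ℕ)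
    (hab : b + γ - a + 1 ≤ c * Ms (t+1) ^ 14) (hF : (F ∪ Δ).card ≤ c * Ms (t+1) ^ 14) :
    ∃ X' ⊆ run γ (F ∪ Δ) t X 1, ∃ n',
      Front γ ρ (t+1) (F ∪ Δ) X' (lo γ F t X a 1) (hi γ F t X b 1) n'
        (z + γ - (rowc (F ∪ Δ) (t+1) (lo γ F t X a 1) (hi γ F t X b 1)).card) ∧
      (n' = 0 → X' = ∅) ∧ (X = ∅ → n' = n) ∧ X'.card ≤ (10 ^ 9 + 8 * c + 4) * Ms (t+1) ^ 12 := by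
  obtain ⟨w, gg, LL, D, r0, tr, Xr, h⟩ := h
  have hM := Ms_mono (Nat.le_succ t)
  have h1 := (h.shift hΔ).mono (s' := 20 * Ms (t+1) ^ 3) (m' := 10 * Ms (t+1) ^ 3) (m1' := Ms (t+1) ^ 2)
    (by gcongr) (by gcongr) (by gcongr)
  have hl := lo_bd (γ := γ) (Y := F) (j := t) (X := X) (a := a) 1
  have hh := hi_bd (γ := γ) (Y := F) (j := t) (X := X) (b := b) 1
  obtain ⟨X', h2, n', h3, h4, h5, h6, h7⟩ := norm_front hg h1 c (by push_cast at hh; omega) hF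
  refine ⟨X', h2, n', h3, h5, ?_, h7⟩
  rintro rfl
  exact h6 (run_empty _)

lemma Front.val (h : Front γ ρ t F X a b n z) :
    z + γ * n ≤ (run γ F t X n).card + (cs F t n (lo γ F t X a) (hi γ F t X b)).card := by
  obtain ⟨w, gg, LL, D, r0, tr, Xr, h⟩ := h
  have := h.hP ∅ (by intro k; simp [rows])
  rw [Finset.union_empty, _root_.val] at this
  push_cast at this; omega

lemma Front.sub (h : Front γ ρ t F X a b n z) : X ⊆ Finset.Icc a b := by
  obtain ⟨w, gg, LL, D, r0, tr, Xr, h⟩ := h; exact h.hX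
end

end PartP4d

section PartP5

lemma Ms_rpow (t : ℕ) (ht : 1 ≤ t) : ((Ms t ^ 12 : ℕ) : ℝ) ≤ 2 ^ 84 * (t:ℝ) ^ ((6:ℝ)/7) := by
  have h : ((Ms t ^ 14 : ℕ) : ℝ) ≤ 2 ^ 98 * t := by exact_mod_cast Ms_le t ht
  have h1 : ((Ms t ^ 12 : ℕ) : ℝ) = (((Ms t ^ 14 : ℕ) : ℝ)) ^ ((6:ℝ)/7) := by
    push_cast
    rw [← Real.rpow_natCast, ← Real.rpow_natCast, ← Real.rpow_mul (by positivity)]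
    norm_num
  have h2 : ((2:ℝ) ^ 98) ^ ((6:ℝ)/7) = 2 ^ 84 := by
    rw [← Real.rpow_natCast, ← Real.rpow_natCast, ← Real.rpow_mul (by positivity)]
    norm_num
  rw [h1, ← h2, ← Real.mul_rpow (by positivity) (by positivity)]
  exact Real.rpow_le_rpow (by positivity) h (by norm_num)

lemma g_bound {c k : ℕ} {C : ℝ} (t : ℕ) (ht : 1 ≤ t) (hC : (c:ℝ) * 2 ^ 84 ≤ C) (hk : k ≤ c * Ms t ^ 12) :
    (k : ℕ∞) ≤ (⌈C * (t : ℝ) ^ ((6 : ℝ) / 7)⌉₊ : ℕ∞) := by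
  have h1 := Ms_rpow t ht
  have : (k:ℝ) ≤ C * (t : ℝ) ^ ((6 : ℝ) / 7) := by
    have h2 : (k:ℝ) ≤ c * (Ms t ^ 12 : ℕ) := by exact_mod_cast hk
    have h3 : (0:ℝ) ≤ (t:ℝ) ^ ((6:ℝ)/7) := by positivity
    have h4 : (0:ℝ) ≤ c := by positivity
    nlinarith
  have h5 : k ≤ ⌈C * (t : ℝ) ^ ((6 : ℝ) / 7)⌉₊ := by exact_mod_cast this.trans (Nat.le_ceil _)
  exact_mod_cast h5

lemma budget_le {q : ℝ} {ρ : ℕ} (hq : q ≤ ρ) (t : ℕ) : budget q t ≤ ρ := by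
  unfold budget
  rw [Int.toNat_le]
  have h1 := Int.floor_le ((t:ℝ) * q)
  have h2 := Int.lt_floor_add_one (((t:ℝ) - 1) * q)
  have h3 : ((⌊(t:ℝ) * q⌋ - ⌊((t:ℝ) - 1) * q⌋ : ℤ) : ℝ) < ((ρ:ℤ) + 1 : ℤ) := by push_cast; linarith
  have := Int.cast_lt.1 h3
  omega

lemma delSets_congr {V : Type*} (σ : List (Set V) → Set V) {B B' : ℕ → Set V} (t : ℕ)
    (h : ∀ i < t, B i = B' i) : delSets σ B t = delSets σ B' t := by
  induction t with
  | zero => rfl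
  | succ t ih =>
    rw [delSets, delSets, ih (fun i hi => h i (by omega))]
    congr 2
    apply List.map_congr_left
    intro i hi; exact h i (by simpa using hi)

lemma prefix_legal {V : Type*} {adj : V → V → Prop} {q : ℝ} {g : ℕ → ℕ∞} {B₀ : Set V}
    {σ : List (Set V) → Set V}
    (hσ : ∀ B : ℕ → Set V, B 0 = B₀ → SpreaderLegal adj g (delSets σ B) B → ContainerLegal q σ B)
    (B : ℕ → Set V) (hB : B 0 = B₀) (T : ℕ)
    (hT : ∀ t < T, B t ⊆ B (t + 1) ∧ (B (t + 1) \ B t).encard ≤ g (t + 1) ∧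
      ∀ v ∈ B (t + 1) \ B t, v ∉ delSets σ B (t + 1) ∧ ∃ u ∈ B t, adj u v) :
    σ ((List.range (T + 1)).map B) ∩ B T = ∅ ∧
    (σ ((List.range (T + 1)).map B)).encard ≤ (budget q (T + 1) : ℕ∞) := by
  have key := hσ (fun k => B (min k T)) (by simpa using hB) ?_ T
  · have e : (List.range (T+1)).map (fun k => B (min k T)) = (List.range (T+1)).map B := by
      apply List.map_congr_left
      intro i hi
      rw [List.mem_range] at hi
      rw [min_eq_left (by omega)]
    simp only [e, min_self] at key
    exact key
  · intro t
    by_cases ht : t < T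
    · have h1 := hT t ht
      simp only [min_eq_left ht.le, min_eq_left (show t + 1 ≤ T from ht)]
      refine ⟨h1.1, h1.2.1, fun v hv => ⟨?_, (h1.2.2 v hv).2⟩⟩
      rw [delSets_congr σ (B' := B) (t+1) (fun i hi => by rw [min_eq_left (by omega)])]
      exact (h1.2.2 v hv).1
    · simp only [min_eq_right (not_lt.1 ht), min_eq_right (show T ≤ t + 1 by omega)]
      simp

/-- Generic engine: an invariant with a legal step refutes any Container strategy. -/
lemma engine {V : Type*} {adj : V → V → Prop} {q : ℝ} {g : ℕ → ℕ∞} {B₀ : Set V}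
    (hw : ContainerWins adj q g B₀) (J : ℕ → ℕ ×ₗ ℕ → Set V → Set V → Prop) (μ0 : ℕ ×ₗ ℕ)
    (h0 : J 0 μ0 ∅ B₀)
    (hstep : ∀ t μ F B Δ, J t μ F B → Δ ∩ B = ∅ → Δ.encard ≤ (budget q (t+1) : ℕ∞) →
      ∃ B' μ', J (t+1) μ' (F ∪ Δ) B' ∧ B ⊆ B' ∧ (B' \ B).encard ≤ g (t+1) ∧
        (∀ v ∈ B' \ B, v ∉ F ∪ Δ ∧ ∃ u ∈ B, adj u v) ∧ (B' = B → μ' < μ)) : False := by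
  classical
  obtain ⟨σ, hσ⟩ := hw
  let P : ℕ → (Set V × (ℕ ×ₗ ℕ)) → Set V → Set V → (Set V × (ℕ ×ₗ ℕ)) → Prop := fun t s F Δ s' =>
    J (t+1) s'.2 (F ∪ Δ) s'.1 ∧ s.1 ⊆ s'.1 ∧ (s'.1 \ s.1).encard ≤ g (t+1) ∧
        (∀ v ∈ s'.1 \ s.1, v ∉ F ∪ Δ ∧ ∃ u ∈ s.1, adj u v) ∧ (s'.1 = s.1 → s'.2 < s.2)
  let nxt : ℕ → List (Set V) × Set V × (Set V × (ℕ ×ₗ ℕ)) → List (Set V) × Set V × (Set V × (ℕ ×ₗ ℕ)) :=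
    fun t s => let s' := if h : ∃ s', P t s.2.2 s.2.1 (σ s.1) s' then h.choose else s.2.2
      (s.1 ++ [s'.1], s.2.1 ∪ σ s.1, s')
  let st : ℕ → List (Set V) × Set V × (Set V × (ℕ ×ₗ ℕ)) := fun t =>
    Nat.rec ([B₀], ∅, (B₀, μ0)) nxt t
  have hst : ∀ t, st (t+1) = nxt t (st t) := fun t => rfl
  let B : ℕ → Set V := fun t => (st t).2.2.1
  have hh : ∀ t, (st t).1 = (List.range (t+1)).map B := by
    intro t
    induction t with
    | zero => rfl
    | succ t ih =>
      rw [List.range_succ, List.map_append, ← ih]; rfl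
  have hF : ∀ t, (st t).2.1 = delSets σ B t := by
    intro t
    induction t with
    | zero => rfl
    | succ t ih => rw [delSets, ← ih, ← hh]
  have main : ∀ t, J t (st t).2.2.2 (st t).2.1 (B t) ∧ ∀ i < t, P i (st i).2.2 (st i).2.1 (σ (st i).1) (st (i+1)).2.2 := by
    intro t
    induction t with
    | zero => exact ⟨h0, fun i hi => by omega⟩
    | succ t ih =>
      have hl := prefix_legal (fun B h1 h2 => (hσ B h1 h2).1) B rfl t (fun i hi => by
        have := ih.2 i hi
        refine ⟨this.2.1, this.2.2.1, fun v hv => ?_⟩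
        rw [delSets, ← hF, ← hh]
        exact this.2.2.2.1 v hv)
      rw [← hh] at hl
      obtain ⟨B', μ', h1⟩ := hstep t _ _ _ _ ih.1 hl.1 hl.2
      have hex : ∃ s', P t (st t).2.2 (st t).2.1 (σ (st t).1) s' := ⟨(B', μ'), h1⟩
      have e : (st (t+1)).2.2 = hex.choose := by
        rw [hst]; simp only [nxt]; rw [dif_pos hex]
      have hP : P t (st t).2.2 (st t).2.1 (σ (st t).1) (st (t+1)).2.2 := by
        rw [e]; exact hex.choose_spec
      refine ⟨hP.1, fun i hi => ?_⟩
      rcases Nat.lt_succ_iff_lt_or_eq.1 hi with h | h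
      · exact ih.2 i h
      · subst h; exact hP
  have hP : ∀ i, P i (st i).2.2 (st i).2.1 (σ (st i).1) (st (i+1)).2.2 := fun i => (main (i+1)).2 i (by omega)
  obtain ⟨-, -, T, hT⟩ := hσ B rfl (fun t => by
    refine ⟨(hP t).2.1, (hP t).2.2.1, fun v hv => ?_⟩
    rw [delSets, ← hF, ← hh]
    exact (hP t).2.2.2.1 v hv)
  have hdec : ∀ k, (st (T + k + 1)).2.2.2 < (st (T + k)).2.2.2 := fun k =>
    (hP (T+k)).2.2.2.2 ((hT (T+k+1) (by omega)).trans (hT (T+k) (by omega)).symm)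
  obtain ⟨x, ⟨k, rfl⟩, hmin⟩ := WellFounded.has_min (wellFounded_lt (α := ℕ ×ₗ ℕ))
    (Set.range (fun k => (st (T+k)).2.2.2)) ⟨_, 0, rfl⟩
  exact hmin _ ⟨k+1, rfl⟩ (hdec k)

end PartP5

section PartP5b

def ce (v : ZEighth) : Cell := (v.val.2.toNat, v.val.1)

def JE (t : ℕ) (F B : Set ZEighth) : Prop :=
  ∃ (Ff : Finset ZEighth) (X : Finset ℤ) (a b : ℤ) (n : ℕ) (z : ℤ), (Ff : Set ZEighth) = F ∧ Ff.card ≤ t ∧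
    Front 1 1 t (Ff.image ce) X a b n z ∧ (n = 0 → X = ∅) ∧ 0 ≤ a ∧ b ≤ t ∧
    1 + t - (((Ff.image ce).filter (fun c => c.1 ≤ t)).card : ℤ) ≤ z ∧
    (∀ x ∈ X, ∃ v ∈ B, v.val = (x, (t:ℤ))) ∧ ∀ v ∈ B, v.val.2 ≤ t

lemma front_alive {t : ℕ} {F : Finset Cell} {X : Finset ℤ} {a b : ℤ} {n : ℕ} {z : ℤ} (hF : F.card ≤ t)
    (h : Front 1 1 t F X a b n z) (hz : 1 + t - ((F.filter (fun c => c.1 ≤ t)).card : ℤ) ≤ z) : X.Nonempty := by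
  rw [Finset.nonempty_iff_ne_empty]
  rintro rfl
  have h1 := h.val
  rw [run_empty] at h1
  have h2 : (F.filter (fun c => c.1 ≤ t)).card + (cs F t n (lo 1 F t ∅ a) (hi 1 F t ∅ b)).card ≤ F.card := by
    rw [← Finset.card_union_of_disjoint]
    · apply Finset.card_le_card
      intro c; simp only [Finset.mem_union, Finset.mem_filter, cs]; tauto
    · rw [Finset.disjoint_left]; intro c; simp only [Finset.mem_filter, cs]; omega
  simp at h1
  omega

lemma eighth_step {C : ℝ} {q : ℝ} (hq : q ≤ 1) (hC : ((10 ^ 9 + 8 * 2 ^ 16 + 4 : ℕ):ℝ) * 2 ^ 84 ≤ C) (t : ℕ)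
    (F B Δ : Set ZEighth) (hJ : JE t F B)
    (hΔ : Δ.encard ≤ (budget q (t+1) : ℕ∞)) :
    ∃ B', JE (t+1) (F ∪ Δ) B' ∧ B ⊆ B' ∧ (B' \ B).encard ≤ (⌈C * ((t+1 : ℕ) : ℝ) ^ ((6 : ℝ) / 7)⌉₊ : ℕ∞) ∧
        (∀ v ∈ B' \ B, v ∉ F ∪ Δ ∧ ∃ u ∈ B, adjEighth u v) ∧ B' ≠ B := by
  classical
  obtain ⟨Ff, X, a, b, n, z, rfl, hFc, hfr, hn0, ha, hb, hz, hXB, hBt⟩ := hJ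
  have hΔ1 : Δ.encard ≤ (1:ℕ) := hΔ.trans (by exact_mod_cast budget_le (ρ := 1) (by simpa using hq) (t+1))
  have hfin : Δ.Finite := Set.finite_of_encard_le_coe hΔ1
  lift Δ to Finset ZEighth using hfin
  rw [Set.encard_coe_eq_coe_finsetCard] at hΔ1
  have hΔ1 : Δ.card ≤ 1 := by exact_mod_cast hΔ1
  have hXne := front_alive ((Finset.card_image_le).trans hFc) hfr hz
  obtain ⟨n, rfl⟩ : ∃ k, n = k + 1 := ⟨n - 1, by
    have : n ≠ 0 := fun h => hXne.ne_empty (hn0 h)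
    omega⟩
  have hM := lt_Ms (t+1)
  have hcard : (Ff ∪ Δ).card ≤ t + 1 := (Finset.card_union_le _ _).trans (by omega)
  have himg : (Ff ∪ Δ).image ce = Ff.image ce ∪ Δ.image ce := Finset.image_union _ _
  obtain ⟨X', h1, n', h2, h3, h4, h5⟩ := hfr.step good_one (Finset.card_image_le.trans hΔ1 : (Δ.image ce).card ≤ 1)
    (2 ^ 16) (by zify at hM; push_cast at hM ⊢; omega) (by
      rw [← himg]; refine Finset.card_image_le.trans ?_; omega)
  rw [← himg] at h1 h2
  have hl := lo_bd (γ := 1) (Y := Ff.image ce) (j := t) (X := X) (a := a) 1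
  have hh := hi_bd (γ := 1) (Y := Ff.image ce) (j := t) (X := X) (b := b) 1
  set a' := lo 1 (Ff.image ce) t X a 1 with ha'
  set b' := hi 1 (Ff.image ce) t X b 1 with hb'
  set N : Set ZEighth := {v | v.val.2 = t + 1 ∧ v.val.1 ∈ X'} with hN
  have hXsub := h2.sub
  have hz' : 1 + (t+1 : ℕ) - ((((Ff ∪ Δ).image ce).filter (fun c => c.1 ≤ t + 1)).card : ℤ) ≤
      z + (1:ℕ) - (rowc ((Ff ∪ Δ).image ce) (t+1) a' b').card := by
    have : ((Ff.image ce).filter (fun c => c.1 ≤ t)).card + (rowc ((Ff ∪ Δ).image ce) (t+1) a' b').card ≤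
        (((Ff ∪ Δ).image ce).filter (fun c => c.1 ≤ t + 1)).card := by
      rw [← Finset.card_union_of_disjoint]
      · apply Finset.card_le_card
        rw [himg]
        intro c; simp only [Finset.mem_union, Finset.mem_filter, rowc]
        rintro (⟨h, h'⟩ | ⟨h, h', -⟩)
        · exact ⟨Or.inl h, by omega⟩
        · exact ⟨h, by omega⟩
      · rw [Finset.disjoint_left]; intro c; simp only [Finset.mem_filter, rowc]; omega
    push_cast; omega
  have hvert : ∀ x ∈ X', ∃ v : ZEighth, v.val = (x, ((t+1 : ℕ):ℤ)) := by
    intro x hx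
    have := Finset.mem_Icc.1 (hXsub hx)
    refine ⟨⟨(x, ((t+1 : ℕ):ℤ)), ?_, ?_⟩, rfl⟩ <;> simp at * <;> omega
  refine ⟨B ∪ N, ⟨Ff ∪ Δ, X', a', b', n', _, by simp, hcard, h2, h3, by omega, by push_cast at *; omega, hz', ?_, ?_⟩,
    Set.subset_union_left, ?_, ?_, ?_⟩
  · intro x hx
    obtain ⟨v, hv⟩ := hvert x hx
    refine ⟨v, Or.inr ?_, hv⟩
    simp [hN, hv, hx]
  · rintro v (hv | hv)
    · have := hBt v hv; push_cast; omega
    · rw [hv.1]; simp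
  · refine le_trans ?_ (g_bound (t+1) (by omega) hC h5)
    have hinj : (Subtype.val '' ((B ∪ N) \ B)).encard = ((B ∪ N) \ B).encard :=
      Function.Injective.encard_image Subtype.val_injective _
    rw [← hinj]
    have : Subtype.val '' ((B ∪ N) \ B) ⊆ ((X'.image (fun x => (x, (t:ℤ)+1)) : Finset (ℤ × ℤ)) : Set (ℤ × ℤ)) := by
      rintro _ ⟨v, ⟨hv | hv, hv'⟩, rfl⟩
      · exact (hv' hv).elim
      · simp only [Finset.coe_image, Set.mem_image, Finset.mem_coe]
        exact ⟨v.val.1, hv.2, by rw [← hv.1]⟩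
    refine (Set.encard_le_encard this).trans ?_
    rw [Set.encard_coe_eq_coe_finsetCard]
    exact_mod_cast Finset.card_image_le
  · rintro v ⟨hv | hv, hv'⟩
    · exact (hv' hv).elim
    · have hr := h1 hv.2
      rw [show (1:ℕ) = 0 + 1 from rfl, mem_run_succ] at hr
      obtain ⟨⟨x, hx, hx1⟩, hx2⟩ := hr
      constructor
      · intro hvF
        apply hx2
        rw [Finset.mem_image]
        refine ⟨v, by simpa using hvF, ?_⟩
        unfold ce; rw [hv.1]; simp
      · obtain ⟨u, hu, hu'⟩ := hXB x hx
        refine ⟨u, hu, Or.inl ?_⟩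
        rw [hu', hv.1]; simp at *; omega
  · obtain ⟨x, hx⟩ := front_alive (Finset.card_image_le.trans hcard) h2 hz'
    obtain ⟨v, hv⟩ := hvert x hx
    intro he
    have : v ∈ B := by rw [← he]; right; simp [hN, hv, hx]
    have := hBt v this
    rw [hv] at this; simp at this

lemma eighth_spreader {C : ℝ} {q : ℝ} (hC : ((10 ^ 9 + 8 * 2 ^ 16 + 4 : ℕ):ℝ) * 2 ^ 84 ≤ C)
    (h : q ∈ qSet adjEighth (fun t => (⌈C * (t : ℝ) ^ ((6 : ℝ) / 7)⌉₊ : ℕ∞))) : 1 < q := by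
  by_contra hq
  push Not at hq
  refine engine (h.2 {⟨(0,0), by simp⟩} (Set.finite_singleton _)) (fun t _ F B => JE t F B) (toLex (0,0)) ?_ ?_
  · have hM := one_le_Ms 0
    have h14 : 1 ≤ Ms 0 ^ 14 := Nat.one_le_pow _ _ (by omega)
    obtain ⟨X', h1, n', h2, h3, h4⟩ := Front.start (t := 0) (F := ∅) (X := {0}) (a := 0) (b := 0) good_one (by simp) 1
      (by zify at h14; push_cast; omega) (by simp)
    refine ⟨∅, X', 0, 0, n', _, by simp, by simp, by simpa using h2, h3, le_rfl, by simp, by simp, ?_, ?_⟩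
    · intro x hx
      have := h1 hx
      simp at this
      exact ⟨_, rfl, by simp [this]⟩
    · rintro v rfl; simp
  · intro t μ F B Δ hJ _ hΔ
    obtain ⟨B', b1, b2, b3, b4, b5⟩ := eighth_step hq hC t F B Δ hJ hΔ
    exact ⟨B', μ, b1, b2, b3, b4, fun h => (b5 h).elim⟩

end PartP5b

section PartP6a

abbrev Z2 := ℤ × ℤ

def xx : Fin 4 → Z2 → ℤ
  | 0, v => v.1
  | 1, v => v.2
  | 2, v => -v.1
  | 3, v => -v.2

def yy : Fin 4 → Z2 → ℤ
  | 0, v => v.2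
  | 1, v => -v.1
  | 2, v => -v.2
  | 3, v => v.1

def cell : Fin 4 → ℤ → ℤ → Z2
  | 0, x, y => (x, y)
  | 1, x, y => (-y, x)
  | 2, x, y => (-x, -y)
  | 3, x, y => (y, -x)

lemma xx_cell (d : Fin 4) (x y : ℤ) : xx d (cell d x y) = x := by
  fin_cases d <;> simp [xx, cell]

lemma yy_cell (d : Fin 4) (x y : ℤ) : yy d (cell d x y) = y := by
  fin_cases d <;> simp [yy, cell]

lemma cell_eq (d : Fin 4) (v : Z2) : cell d (xx d v) (yy d v) = v := by
  fin_cases d <;> simp [xx, yy, cell]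

lemma yy_succ (d : Fin 4) (v : Z2) : yy (d+1) v = - xx d v := by
  fin_cases d <;> simp [xx, yy]

lemma xx_succ (d : Fin 4) (v : Z2) : xx (d+1) v = yy d v := by
  fin_cases d <;> simp [xx, yy]

lemma yy_opp (d : Fin 4) (v : Z2) : yy (d+2) v = - yy d v := by
  fin_cases d <;> simp [yy]

lemma yy_pred (d : Fin 4) (v : Z2) : yy (d+3) v = xx d v := by
  fin_cases d <;> simp [xx, yy]

lemma adj_iff (d : Fin 4) (u v : Z2) : adjStrong u v ↔ max |xx d u - xx d v| |yy d u - yy d v| = 1 := by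
  unfold adjStrong
  fin_cases d <;> simp only [xx, yy]
  · rw [max_comm, neg_sub_neg, abs_sub_comm v.1]
  · rw [neg_sub_neg, neg_sub_neg, abs_sub_comm v.1, abs_sub_comm v.2]
  · rw [max_comm, neg_sub_neg, abs_sub_comm v.2]

lemma fin4 (d e : Fin 4) : e = d ∨ e = d + 1 ∨ e = d + 2 ∨ e = d + 3 := by
  revert d e; decide

def cm (d : Fin 4) (o : ℤ) (v : Z2) : Cell := ((yy d v - o).toNat, xx d v + (yy d v - o).toNat)

def SF (d : Fin 4) (t : ℕ) (F : Finset Z2) (l : ℤ) (R : Finset ℤ) (A B : ℤ) (n : ℕ) (z : ℤ) : Prop :=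
  Front 2 3 t (F.image (cm d (l - t))) (R.image (· + (t:ℤ))) (A + t) (B + t) n z

lemma sh_mem {R : Finset ℤ} {t x : ℤ} : x ∈ R.image (· + t) ↔ x - t ∈ R := by
  simp only [Finset.mem_image]
  constructor
  · rintro ⟨y, hy, rfl⟩; simpa using hy
  · intro h; exact ⟨_, h, by ring⟩

lemma sh_inv (X : Finset ℤ) (t : ℤ) : (X.image (· + -t)).image (· + t) = X := by
  ext x; rw [sh_mem, sh_mem]; simp

lemma sh_card (X : Finset ℤ) (t : ℤ) : (X.image (· + t)).card = X.card :=
  Finset.card_image_of_injective _ (add_left_injective t)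

variable {d : Fin 4} {t : ℕ} {F : Finset Z2} {l : ℤ} {R : Finset ℤ} {A B : ℤ} {n : ℕ} {z : ℤ}

lemma SF.sub (h : SF d t F l R A B n z) : R ⊆ Finset.Icc A B := by
  intro x hx
  have := Front.sub h (sh_mem.2 (by simpa using hx) : x + t ∈ _)
  simp at this ⊢; omega

lemma SF.start (d : Fin 4) (t : ℕ) (F : Finset Z2) (l : ℤ) (hR : R ⊆ Finset.Icc A B) (c : ℕ) (hab : B - A + 1 ≤ c * Ms t ^ 14)
    (hF : F.card ≤ c * Ms t ^ 14) :
    ∃ R' ⊆ R, ∃ n', SF d t F l R' A B n' R.card ∧ (n' = 0 → R' = ∅) ∧ R'.card ≤ (10^9+8*c+4)*Ms t^12 := by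
  obtain ⟨X', h1, n', h2, h3, h4⟩ := Front.start (t := t) (F := F.image (cm d (l - t))) (X := R.image (· + (t:ℤ)))
    (a := A + t) (b := B + t) good_two (by
      intro x hx
      have := hR (sh_mem.1 hx)
      simp at this ⊢; omega) c (by omega) (Finset.card_image_le.trans hF)
  rw [sh_card] at h2
  refine ⟨X'.image (· + -(t:ℤ)), ?_, n', ?_, fun h => by rw [h3 h]; rfl, by rwa [sh_card]⟩
  · intro x hx
    have := sh_mem.1 (h1 (sh_mem.1 hx))
    simpa using this
  · unfold SF; rw [sh_inv]; exact h2

def rw' (d : Fin 4) (F : Finset Z2) (l A B : ℤ) : Finset Z2 := F.filter (fun v => yy d v = l ∧ A ≤ xx d v ∧ xx d v ≤ B)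

lemma rowc_cm (d : Fin 4) (t : ℕ) (F : Finset Z2) (l A B : ℤ) :
    (rowc (F.image (cm d (l - t))) (t+1) (A + (t+1)) (B + (t+1))).card = (rw' d F (l+1) A B).card := by
  have : rowc (F.image (cm d (l - t))) (t+1) (A + (t+1)) (B + (t+1)) = (rw' d F (l+1) A B).image (cm d (l - t)) := by
    ext c
    simp only [rowc, rw', Finset.mem_filter, Finset.mem_image]
    constructor
    · rintro ⟨⟨v, hv, rfl⟩, h⟩
      refine ⟨v, ⟨hv, ?_⟩, rfl⟩
      simp only [cm] at h; omega
    · rintro ⟨v, ⟨hv, h⟩, rfl⟩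
      refine ⟨⟨v, hv, rfl⟩, ?_⟩
      simp only [cm]; omega
  rw [this, Finset.card_image_of_injOn]
  intro u hu v hv h
  simp only [rw', Finset.coe_filter, Set.mem_ofPred_eq] at hu hv
  simp only [cm, Prod.mk.injEq] at h
  rw [← cell_eq d u, ← cell_eq d v]
  congr 1 <;> omega

lemma SF.step (h : SF d t F l R A B (n+1) z) {Δ : Finset Z2} (hΔ : Δ.card ≤ 3) (c : ℕ)
    (hab : B + 2 - A + 1 ≤ c * Ms (t+1)^14) (hF : (F ∪ Δ).card ≤ c * Ms (t+1)^14) :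
    ∃ R' n' A' B', SF d (t+1) (F ∪ Δ) (l+1) R' A' B' n' (z + 2 - (rw' d (F ∪ Δ) (l+1) A' B').card) ∧
      A' = (if A ∈ R then A - 1 else A) ∧ B' = (if B ∈ R then B + 1 else B) ∧
      (n' = 0 → R' = ∅) ∧ (R = ∅ → n' = n) ∧ R'.card ≤ (10^9+8*c+4)*Ms (t+1)^12 ∧
      ∀ x ∈ R', cell d x (l+1) ∉ F ∪ Δ ∧ ∃ u ∈ R, u - 1 ≤ x ∧ x ≤ u + 1 := by
  have himg := Finset.image_union (f := cm d (l - t)) F Δ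
  obtain ⟨X', h1, n', h2, h3, h4, h5⟩ := Front.step good_two h (Finset.card_image_le.trans hΔ : (Δ.image (cm d (l - t))).card ≤ 3) c
    (by push_cast; omega) (by rw [← himg]; exact Finset.card_image_le.trans hF)
  rw [← himg] at h1 h2
  have hlo : lo 2 (F.image (cm d (l - t))) t (R.image (· + (t:ℤ))) (A + t) 1 = (if A ∈ R then A - 1 else A) + (t+1) := by
    simp only [lo, run, sh_mem, add_sub_cancel_right]; split_ifs <;> ring
  have hhi : hi 2 (F.image (cm d (l - t))) t (R.image (· + (t:ℤ))) (B + t) 1 = (if B ∈ R then B + 1 else B) + (t+1) := by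
    simp only [hi, run, sh_mem, add_sub_cancel_right]; push_cast; split_ifs <;> ring
  rw [hlo, hhi, rowc_cm] at h2
  refine ⟨X'.image (· + -((t+1 : ℕ):ℤ)), n', _, _, ?_, rfl, rfl, fun h => by rw [h3 h]; rfl,
    fun h => h4 (by rw [h]; rfl), by rwa [sh_card], ?_⟩
  · have e : l + 1 - ((t+1 : ℕ):ℤ) = l - t := by push_cast; ring
    unfold SF; rw [sh_inv, e]; push_cast; exact h2
  · intro x hx
    have hx1 := h1 (sh_mem.1 hx)
    rw [show (1:ℕ) = 0 + 1 from rfl, mem_run_succ] at hx1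
    obtain ⟨⟨u, hu, hu1⟩, hx2⟩ := hx1
    constructor
    · intro hF; apply hx2
      rw [Finset.mem_image]
      refine ⟨_, hF, ?_⟩
      simp only [cm, xx_cell, yy_cell, Prod.mk.injEq]; push_cast; omega
    · have := sh_mem.1 hu
      refine ⟨_, this, ?_⟩
      push_cast at hu1; omega

def strip (d : Fin 4) (F : Finset Z2) (l A B : ℤ) : Finset Z2 :=
  F.filter (fun v => l < yy d v ∧ A - (yy d v - l) ≤ xx d v ∧ xx d v ≤ B + (yy d v - l))

lemma SF.val (h : SF d t F l R A B n z) (hAB : A ≤ B) : z ≤ B - A + 1 + (strip d F l A B).card := by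
  have h1 := Front.val h
  have h2 : (cs (F.image (cm d (l - t))) t n (lo 2 (F.image (cm d (l - t))) t (R.image (· + (t:ℤ))) (A + t))
      (hi 2 (F.image (cm d (l - t))) t (R.image (· + (t:ℤ))) (B + t))).card ≤ (strip d F l A B).card := by
    refine le_trans (Finset.card_le_card (t := (strip d F l A B).image (cm d (l - t))) ?_) Finset.card_image_le
    intro c
    simp only [cs, strip, Finset.mem_filter, Finset.mem_image]
    rintro ⟨⟨v, hv, rfl⟩, h3, h4, h5, h6⟩
    refine ⟨v, ⟨hv, ?_⟩, rfl⟩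
    have hl := lo_bd (γ := 2) (Y := F.image (cm d (l - t))) (j := t) (X := R.image (· + (t:ℤ))) (a := A + t) ((cm d (l - t) v).1 - t)
    have hh := hi_bd (γ := 2) (Y := F.image (cm d (l - t))) (j := t) (X := R.image (· + (t:ℤ))) (b := B + t) ((cm d (l - t) v).1 - t)
    replace h5 := hl.1.trans h5
    replace h6 := h6.trans hh.2
    simp only [cm] at h3 h4 h5 h6
    omega
  have h3 : ((run 2 (F.image (cm d (l - t))) t (R.image (· + (t:ℤ))) n).card : ℤ) ≤ B - A + 1 + 2 * n := by
    have : run 2 (F.image (cm d (l - t))) t (R.image (· + (t:ℤ))) n ⊆ Finset.Icc (A + t) (B + t + 2 * n) := by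
      intro p hp
      rw [mem_run_iff] at hp
      obtain ⟨x, hx, hp⟩ := hp
      have := run_cone hp
      have := Finset.mem_Icc.1 (Front.sub h hx)
      rw [Finset.mem_Icc]; push_cast at *; omega
    have := Finset.card_le_card this
    rw [Int.card_Icc] at this
    omega
  push_cast at h1; omega

lemma SF.zero (h : SF d t F l ∅ A B 0 z) : z ≤ 0 := by
  have := Front.val h
  rw [Finset.image_empty, run_empty] at this
  simp [cs] at this
  refine this.trans ?_
  simp only [Nat.cast_nonpos, Finset.card_eq_zero]
  rw [Finset.eq_empty_iff_forall_notMem]; intro c; simp only [Finset.mem_filter]; omega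

end PartP6a

section PartP6b

structure SI (t : ℕ) (F : Finset Z2) (B : Set Z2) (C : Fin 4 → Finset Z2) (l A E : Fin 4 → ℤ)
    (R : Fin 4 → Finset ℤ) (n : Fin 4 → ℕ) (z : Fin 4 → ℤ) : Prop where
  hF : F.card ≤ 3 * t
  hl : 12 + 3 * (t:ℤ) ≤ l 0 + l 1 + l 2 + l 3
  hB : ∀ v ∈ B, ∀ d, yy d v ≤ l d
  hC : ∀ d e, d ≠ e → Disjoint (C d) (C e)
  hl3 : ∀ d, 3 ≤ l d
  hlt : ∀ d, l d ≤ 3 + t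
  hCF : ∀ d, C d ⊆ F
  hCb : ∀ d, ∀ v ∈ C d, ∀ e, yy e v ≤ l e
  acc : ∀ d, 2 * l d - 1 ≤ z d + (C d).card
  dead : ∀ d, n d = 0 → R d = ∅ ∧ z d ≤ 0
  fr : ∀ d, n d ≠ 0 → SF d t F (l d) (R d) (A d) (E d) (n d) (z d)
  hAE : ∀ d, n d ≠ 0 → A d ≤ E d ∧ -l (d+1) ≤ A d ∧ E d ≤ l (d+3)
  cor : ∀ d, n d ≠ 0 → n (d+1) ≠ 0 → -l (d+1) + 1 ≤ A d ∨ E (d+1) ≤ l d - 1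
  hR : ∀ d, ∀ x ∈ R d, cell d x (l d) ∈ B

variable {t : ℕ} {F : Finset Z2} {B : Set Z2} {C : Fin 4 → Finset Z2} {l A E : Fin 4 → ℤ}
    {R : Fin 4 → Finset ℤ} {n : Fin 4 → ℕ} {z : Fin 4 → ℤ}

lemma pair_disj {P : Fin 4 → Finset Z2} (h1 : ∀ d, Disjoint (P d) (P (d+1))) (h2 : ∀ d, Disjoint (P d) (P (d+2))) :
    ∀ d e, d ≠ e → Disjoint (P d) (P e) := by
  intro d e hde
  rcases fin4 d e with h | h | h | h
  · exact (hde h.symm).elim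
  · rw [h]; exact h1 d
  · rw [h]; exact h2 d
  · have := h1 e
    rw [h, add_assoc, show (3 + 1 : Fin 4) = 0 from rfl, add_zero] at this
    rw [h]; exact this.symm

lemma SI.one (h : SI t F B C l A E R n z) {d e : Fin 4} (hd : n d = 0) (he : n e = 0) : d = e := by
  by_contra hde
  set S : Fin 4 → Finset Z2 := fun d => if n d = 0 then ∅ else strip d F (l d) (A d) (E d) with hS
  have hSmem : ∀ d v, v ∈ S d → n d ≠ 0 ∧ v ∈ F ∧ l d < yy d v ∧ A d - (yy d v - l d) ≤ xx d v ∧ xx d v ≤ E d + (yy d v - l d) := by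
    intro d v hv
    simp only [hS] at hv
    split_ifs at hv with h0
    · simp at hv
    · simp only [strip, Finset.mem_filter] at hv; exact ⟨h0, hv⟩
  have hSd : ∀ d e, d ≠ e → Disjoint (S d) (S e) := by
    apply pair_disj
    · intro d
      rw [Finset.disjoint_left]
      intro v h1 h2
      have h1 := hSmem _ _ h1
      have h2 := hSmem _ _ h2
      have a1 := h.hAE d h1.1
      have a2 := h.hAE (d+1) h2.1
      have a3 := h.cor d h1.1 h2.1
      rw [yy_succ, xx_succ] at h2
      rw [show d + 1 + 3 = d by rw [add_assoc]; exact add_zero d] at a2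
      omega
    · intro d
      rw [Finset.disjoint_left]
      intro v h1 h2
      have h1 := hSmem _ _ h1
      have h2 := hSmem _ _ h2
      have a1 := h.hl3 d
      have a2 := h.hl3 (d+2)
      rw [yy_opp] at h2
      omega
  have hPd : ∀ d e, d ≠ e → Disjoint (C d ∪ S d) (C e ∪ S e) := by
    intro d e hde
    rw [Finset.disjoint_union_left, Finset.disjoint_union_right, Finset.disjoint_union_right]
    refine ⟨⟨h.hC d e hde, ?_⟩, ?_, hSd d e hde⟩
    · rw [Finset.disjoint_left]; intro v h1 h2
      have := h.hCb _ _ h1 e; have := (hSmem _ _ h2).2.2.1; omega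
    · rw [Finset.disjoint_left]; intro v h2 h1
      have := h.hCb _ _ h1 d; have := (hSmem _ _ h2).2.2.1; omega
  have hcard : ∀ d, ((C d ∪ S d).card : ℤ) = (C d).card + (S d).card := by
    intro d
    rw [Finset.card_union_of_disjoint]; · push_cast; rfl
    rw [Finset.disjoint_left]; intro v h1 h2
    have := h.hCb _ _ h1 d; have := (hSmem _ _ h2).2.2.1; omega
  have htot : ((C 0 ∪ S 0).card + (C 1 ∪ S 1).card + (C 2 ∪ S 2).card + (C 3 ∪ S 3).card) ≤ F.card := by
    have : (Finset.univ.biUnion (fun d => C d ∪ S d)).card ≤ F.card := by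
      apply Finset.card_le_card
      intro v; simp only [Finset.mem_biUnion, Finset.mem_union]
      rintro ⟨d, -, hv | hv⟩
      · exact h.hCF d hv
      · exact (hSmem d v hv).2.1
    rw [Finset.card_biUnion (fun d _ e _ => hPd d e), Fin.sum_univ_four] at this
    exact this
  have key : ∀ d, (n d = 0 ∧ 2 * l d - 1 ≤ (C d ∪ S d).card) ∨ (n d ≠ 0 ∧ 2 * l d - 2 - l (d+1) - l (d+3) ≤ (C d ∪ S d).card) := by
    intro d
    rw [hcard]
    have := h.acc d
    by_cases h0 : n d = 0
    · have := h.dead d h0; left; exact ⟨h0, by omega⟩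
    · have h1 := h.hAE d h0
      have h2 := (h.fr d h0).val h1.1
      have : S d = strip d F (l d) (A d) (E d) := if_neg h0
      rw [← this] at h2
      right; exact ⟨h0, by omega⟩
  have k0 := key 0
  have k1 := key 1
  have k2 := key 2
  have k3 := key 3
  have hF := h.hF
  have hl := h.hl
  have := h.hl3 0
  have := h.hl3 1
  have := h.hl3 2
  have := h.hl3 3
  simp only [show (0:Fin 4) + 1 = 1 from rfl, show (0:Fin 4) + 3 = 3 from rfl, show (1:Fin 4) + 1 = 2 from rfl, show (1:Fin 4) + 3 = 0 from rfl,
    show (2:Fin 4) + 1 = 3 from rfl, show (2:Fin 4) + 3 = 1 from rfl, show (3:Fin 4) + 1 = 0 from rfl, show (3:Fin 4) + 3 = 2 from rfl] at k0 k1 k2 k3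
  fin_cases d <;> fin_cases e <;> simp at hd he hde <;> omega

/-- the corner trigger -/
def trig (l A E : Fin 4 → ℤ) (R : Fin 4 → Finset ℤ) (d : Fin 4) : Prop :=
  (A (d+3) = -l d ∧ A (d+3) ∈ R (d+3)) ∨ (E (d+1) = l d ∧ E (d+1) ∈ R (d+1))

lemma SI.next (h : SI t F B C l A E R n z) {Δ : Finset Z2} (hΔ : Δ.card ≤ 3) (d : Fin 4) :
    ∃ (l' A' E' : ℤ) (R' : Finset ℤ) (n' : ℕ) (z' : ℤ), (n' = 0 → R' = ∅ ∧ z' ≤ 0) ∧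
      R'.card ≤ (10^9+8*2^17+4)*Ms (t+1)^12 ∧ ((∀ e, R e = ∅) → n' = n d - 1) ∧
      (∀ x ∈ R', cell d x l' ∉ F ∪ Δ ∧ ∃ u ∈ B, adjStrong u (cell d x l')) ∧
      ((l' = l d ∧ n' = 0 ∧ n d = 0 ∧ z' = z d ∧ ¬ trig l A E R d) ∨
       (l' = l d + 1 ∧ (n' ≠ 0 → SF d (t+1) (F ∪ Δ) l' R' A' E' n' z') ∧ A' ≤ E' ∧
        z d + 2 - (rw' d (F ∪ Δ) l' A' E').card ≤ z' ∧
        (-l (d+1) ≤ A' ∨ A' = -l (d+1) - 1 ∧ n d ≠ 0 ∧ A d = -l (d+1) ∧ A d ∈ R d) ∧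
        (E' ≤ l (d+3) ∨ E' = l (d+3) + 1 ∧ n d ≠ 0 ∧ E d = l (d+3) ∧ E d ∈ R d))) := by
  have hM := lt_Ms (t+1)
  have hFc : (F ∪ Δ).card ≤ 2 ^ 17 * Ms (t+1) ^ 14 := by
    have := Finset.card_union_le F Δ
    have := h.hF; omega
  by_cases hn : n d = 0
  · by_cases ht : trig l A E R d
    · obtain ⟨A0, hA1, hA2, hA3⟩ : ∃ A0, -l (d+1) ≤ A0 ∧ A0 + 1 ≤ l (d+3) ∧ ∀ x, A0 ≤ x → x ≤ A0 + 1 →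
          ∃ u ∈ B, adjStrong u (cell d x (l d + 1)) := by
        have l1 := h.hl3 (d+1)
        have l2 := h.hl3 (d+3)
        rcases ht with ⟨h1, h2⟩ | ⟨h1, h2⟩
        · refine ⟨l (d+3) - 1, by omega, by omega, fun x hx hx' => ?_⟩
          have hu := h.hR _ _ h2
          rw [h1] at hu
          refine ⟨_, hu, ?_⟩
          set u := cell (d+3) (-l d) (l (d+3)) with hud
          have e1 : xx d u = l (d+3) := by rw [← yy_pred, hud, yy_cell]
          have e2 : yy d u = l d := by
            have := yy_succ (d+3) u
            rw [add_assoc, show (3 + 1 : Fin 4) = 0 from rfl, add_zero, hud, xx_cell] at this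
            rw [hud, this]; ring
          rw [adj_iff d, xx_cell, yy_cell, e1, e2]
          rw [show l d - (l d + 1) = -1 by ring, abs_neg, abs_one]
          apply max_eq_right; rw [abs_le]; omega
        · refine ⟨-l (d+1), by omega, by omega, fun x hx hx' => ?_⟩
          have hu := h.hR _ _ h2
          rw [h1] at hu
          refine ⟨_, hu, ?_⟩
          set u := cell (d+1) (l d) (l (d+1)) with hud
          have e1 : xx d u = - l (d+1) := by
            have := yy_succ d u
            rw [hud, yy_cell] at this; rw [hud]; omega
          have e2 : yy d u = l d := by rw [← xx_succ, hud, xx_cell]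
          rw [adj_iff d, xx_cell, yy_cell, e1, e2]
          rw [show l d - (l d + 1) = -1 by ring, abs_neg, abs_one]
          apply max_eq_right; rw [abs_le]; omega
      set R0 := (Finset.Icc A0 (A0+1)).filter (fun x => cell d x (l d + 1) ∉ F ∪ Δ) with hR0
      obtain ⟨R', b1, n', b2, b3, b4⟩ := SF.start (R := R0) (A := A0) (B := A0 + 1) d (t+1) (F ∪ Δ) (l d + 1)
        (Finset.filter_subset _ _) (2 ^ 17) (by zify at hM; push_cast at hM ⊢; omega) hFc
      refine ⟨l d + 1, A0, A0 + 1, R', n', R0.card, ?_, b4, ?_, ?_, Or.inr ⟨rfl, fun _ => b2, by omega, ?_, Or.inl hA1, Or.inl hA2⟩⟩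
      · intro h0
        subst h0
        have := b3 rfl
        subst this
        exact ⟨rfl, b2.zero⟩
      · intro hall
        rcases ht with ⟨h1, h2⟩ | ⟨h1, h2⟩ <;> rw [hall] at h2 <;> simp at h2
      · intro x hx
        have := b1 hx
        rw [hR0, Finset.mem_filter, Finset.mem_Icc] at this
        exact ⟨this.2, hA3 x this.1.1 this.1.2⟩
      · have hz := (h.dead d hn).2
        have : (2:ℤ) ≤ R0.card + (rw' d (F ∪ Δ) (l d + 1) A0 (A0+1)).card := by
          have h1 : (Finset.Icc A0 (A0+1)) ⊆ R0 ∪ (rw' d (F ∪ Δ) (l d + 1) A0 (A0+1)).image (xx d) := by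
            intro x hx
            rw [Finset.mem_union, hR0, Finset.mem_filter]
            by_cases hc : cell d x (l d + 1) ∈ F ∪ Δ
            · right
              rw [Finset.mem_image]
              refine ⟨_, ?_, xx_cell d x (l d + 1)⟩
              rw [Finset.mem_Icc] at hx
              rw [rw', Finset.mem_filter, xx_cell, yy_cell]
              exact ⟨hc, rfl, hx⟩
            · exact Or.inl ⟨hx, hc⟩
          have h2 := (Finset.card_le_card h1).trans ((Finset.card_union_le _ _).trans (Nat.add_le_add_left Finset.card_image_le _))
          rw [Int.card_Icc] at h2
          omega
        omega
    · refine ⟨l d, 0, 0, ∅, 0, z d, fun _ => ⟨rfl, (h.dead d hn).2⟩, by simp, by simp [hn], by simp, Or.inl ⟨rfl, rfl, hn, rfl, ht⟩⟩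
  · obtain ⟨k, hk⟩ : ∃ k, n d = k + 1 := ⟨n d - 1, by omega⟩
    have h0 := h.fr d hn
    rw [hk] at h0
    have hAE := h.hAE d hn
    have l1 := h.hlt (d+1)
    have l2 := h.hlt (d+3)
    obtain ⟨R', n', A', B', b1, b2, b3, b4, b5, b6, b7⟩ := h0.step hΔ (2 ^ 17)
      (by zify at hM; push_cast at hM ⊢; omega) hFc
    refine ⟨l d + 1, A', B', R', n', _, ?_, b6, ?_, ?_, Or.inr ⟨rfl, fun _ => b1, ?_, le_rfl, ?_, ?_⟩⟩
    · intro h0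
      subst h0
      have := b4 rfl
      subst this
      exact ⟨rfl, b1.zero⟩
    · intro hall
      rw [b5 (hall d)]; omega
    · intro x hx
      obtain ⟨c1, u, hu, hu1⟩ := b7 x hx
      refine ⟨c1, _, h.hR d u hu, ?_⟩
      rw [adj_iff d, xx_cell, yy_cell, xx_cell, yy_cell]
      rw [show l d - (l d + 1) = -1 by ring, abs_neg, abs_one]
      apply max_eq_right; rw [abs_le]; omega
    · split_ifs at b2 b3 <;> omega
    · split_ifs at b2 with hm
      · by_cases hh : A d = -l (d+1)
        · right; exact ⟨by omega, hn, hh, hm⟩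
        · left; omega
      · left; omega
    · split_ifs at b3 with hm
      · by_cases hh : E d = l (d+3)
        · right; exact ⟨by omega, hn, hh, hm⟩
        · left; omega
      · left; omega

end PartP6b

section PartP6c

variable {t : ℕ} {F : Finset Z2} {B : Set Z2} {C : Fin 4 → Finset Z2} {l A E : Fin 4 → ℤ}
    {R : Fin 4 → Finset ℤ} {n : Fin 4 → ℕ} {z : Fin 4 → ℤ}

lemma rot4 (d : Fin 4) : d + 1 + 3 = d ∧ d + 3 + 1 = d := by revert d; decide

lemma SI.step (h : SI t F B C l A E R n z) {Δ : Finset Z2} (hΔ : Δ.card ≤ 3) :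
    ∃ C' l' A' E' R' n' z', SI (t+1) (F ∪ Δ) (B ∪ {v | ∃ d, ∃ x ∈ R' d, v = cell d x (l' d)}) C' l' A' E' R' n' z' ∧
      (∀ d, (R' d).card ≤ (10^9+8*2^17+4)*Ms (t+1)^12) ∧ ((∀ e, R e = ∅) → ∀ d, n' d = n d - 1) ∧
      (∀ d, ∀ x ∈ R' d, cell d x (l' d) ∉ F ∪ Δ ∧ (∃ u ∈ B, adjStrong u (cell d x (l' d))) ∧ cell d x (l' d) ∉ B) := by
  choose l' A' E' R' n' z' g1 g2 g3 g4 g5 using h.next hΔ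
  set C' : Fin 4 → Finset Z2 := fun d => if l' d = l d then C d else C d ∪ rw' d (F ∪ Δ) (l' d) (A' d) (E' d) with hC'
  have hC'm : ∀ d v, v ∈ C' d → v ∈ C d ∨ (l' d = l d + 1 ∧ v ∈ F ∪ Δ ∧ yy d v = l d + 1 ∧ A' d ≤ xx d v ∧ xx d v ≤ E' d) := by
    intro d v hv
    simp only [hC'] at hv
    split_ifs at hv with h0
    · exact Or.inl hv
    · rw [Finset.mem_union, rw', Finset.mem_filter] at hv
      rcases hv with hv | hv
      · exact Or.inl hv
      · have : l' d = l d + 1 := by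
          rcases g5 d with g | g
          · exact (h0 g.1).elim
          · exact g.1
        rw [this] at hv
        exact Or.inr ⟨this, hv⟩
  have hll : ∀ d, l d ≤ l' d ∧ l' d ≤ l d + 1 := by
    intro d; rcases g5 d with g | g <;> have := g.1 <;> omega
  have hnew : ∀ d, ∀ x ∈ R' d, l' d = l d + 1 := by
    intro d x hx
    rcases g5 d with g | g
    · rw [(g1 d g.2.1).1] at hx; simp at hx
    · exact g.1
  have hbd : ∀ d, l' d = l d + 1 → A' d ≤ E' d ∧ -l' (d+1) ≤ A' d ∧ E' d ≤ l' (d+3) := by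
    intro d hd
    have h1 := hll (d+1)
    have h3 := hll (d+3)
    rcases g5 d with g | ⟨-, -, g0, -, ga, gb⟩
    · omega
    · refine ⟨g0, ?_, ?_⟩
      · rcases ga with ga | ⟨ga, gn, ga1, ga2⟩
        · omega
        · rcases g5 (d+1) with g | g
          · refine (g.2.2.2.2 (Or.inl ?_)).elim
            rw [(rot4 d).1]; exact ⟨ga1, ga2⟩
          · have := g.1; omega
      · rcases gb with ga | ⟨ga, gn, ga1, ga2⟩
        · omega
        · rcases g5 (d+3) with g | g
          · refine (g.2.2.2.2 (Or.inr ?_)).elim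
            rw [(rot4 d).2]; exact ⟨ga1, ga2⟩
          · have := g.1; omega
  have hcor : ∀ d, l' d = l d + 1 → l' (d+1) = l (d+1) + 1 → -l' (d+1) + 1 ≤ A' d ∨ E' (d+1) ≤ l' d - 1 := by
    intro d h1 h2
    rcases g5 d with g | ⟨-, -, -, -, ga, -⟩
    · omega
    rcases g5 (d+1) with g | ⟨-, -, -, -, -, gb⟩
    · omega
    rw [(rot4 d).1] at gb
    rcases ga with ga | ⟨ga, gn, ga1, ga2⟩
    · omega
    rcases gb with gb | ⟨gb, gn', gb1, gb2⟩
    · omega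
    have := h.cor d gn gn'
    omega
  have hout : ∀ d, l' d = l d + 1 → ∀ x, -l' (d+1) ≤ x → x ≤ l' (d+3) → ∀ e, yy e (cell d x (l' d)) ≤ l' e := by
    intro d hd x hx hx' e
    have q1 := xx_cell d x (l' d)
    have q2 := yy_cell d x (l' d)
    rcases fin4 d e with rfl | rfl | rfl | rfl
    · rw [yy_cell]
    · rw [yy_succ]; omega
    · rw [yy_opp]
      have := h.hl3 (d+2); have := h.hl3 d; have := hll (d+2); omega
    · rw [yy_pred]; omega
  have hCb' : ∀ d, ∀ v ∈ C' d, ∀ e, yy e v ≤ l' e := by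
    intro d v hv e
    rcases hC'm d v hv with hv | ⟨h1, h2, h3, h4, h5⟩
    · exact (h.hCb d v hv e).trans (hll e).1
    · have := hbd d h1
      have := hout d h1 (xx d v) (by omega) (by omega) e
      rwa [h1, ← h3, cell_eq] at this
  have hRI : ∀ d, ∀ x ∈ R' d, A' d ≤ x ∧ x ≤ E' d := by
    intro d x hx
    have hn : n' d ≠ 0 := fun h0 => by rw [(g1 d h0).1] at hx; simp at hx
    have hl := hnew d x hx
    rcases g5 d with g | g
    · exact (hn g.2.1).elim
    · exact Finset.mem_Icc.1 ((g.2.1 hn).sub hx)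
  refine ⟨C', l', A', E', R', n', z', ⟨?_, ?_, ?_, ?_, ?_, ?_, ?_, hCb', ?_, g1, ?_, ?_, ?_, ?_⟩, g2, fun hh d => g3 d hh, ?_⟩
  · have := Finset.card_union_le F Δ
    have := h.hF; omega
  · have hone : ∀ d e, l' d = l d → l' e = l e → d = e := by
      intro d e hd he
      apply h.one
      · rcases g5 d with g | g
        · exact g.2.2.1
        · have := g.1; omega
      · rcases g5 e with g | g
        · exact g.2.2.1
        · have := g.1; omega
    have hl := h.hl
    have a0 := hll 0
    have a1 := hll 1
    have a2 := hll 2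
    have a3 := hll 3
    have o1 := hone 0 1
    have o2 := hone 0 2
    have o3 := hone 0 3
    have o4 := hone 1 2
    have o5 := hone 1 3
    have o6 := hone 2 3
    simp at o1 o2 o3 o4 o5 o6
    push_cast; omega
  · rintro v (hv | ⟨d, x, hx, rfl⟩) e
    · exact (h.hB v hv e).trans (hll e).1
    · have h1 := hnew d x hx
      have h2 := hRI d x hx
      have h3 := hbd d h1
      exact hout d h1 x (by omega) (by omega) e
  · have hCn : ∀ d v e, v ∈ C e → l' d = l d + 1 → yy d v = l d + 1 → False := by
      intro d v e hv h1 h2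
      have := h.hCb e v hv d; omega
    apply pair_disj
    · intro d
      rw [Finset.disjoint_left]; intro v hv hv'
      rcases hC'm _ _ hv with a | ⟨b1, b2, b3, b4, b5⟩
      · rcases hC'm _ _ hv' with a' | ⟨b1', b2', b3', b4', b5'⟩
        · exact Finset.disjoint_left.1 (h.hC d (d+1) (by clear hv hv' a a'; revert d; decide)) a a'
        · exact hCn _ _ _ a b1' b3'
      · rcases hC'm _ _ hv' with a' | ⟨b1', b2', b3', b4', b5'⟩
        · exact hCn _ _ _ a' b1 b3
        · have := hcor d b1 b1'
          rw [yy_succ] at b3'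
          rw [xx_succ] at b4' b5'
          omega
    · intro d
      rw [Finset.disjoint_left]; intro v hv hv'
      rcases hC'm _ _ hv with a | ⟨b1, b2, b3, b4, b5⟩
      · rcases hC'm _ _ hv' with a' | ⟨b1', b2', b3', b4', b5'⟩
        · exact Finset.disjoint_left.1 (h.hC d (d+2) (by clear hv hv' a a'; revert d; decide)) a a'
        · exact hCn _ _ _ a b1' b3'
      · rcases hC'm _ _ hv' with a' | ⟨b1', b2', b3', b4', b5'⟩
        · exact hCn _ _ _ a' b1 b3
        · rw [yy_opp] at b3'
          have := h.hl3 d; have := h.hl3 (d+2)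
          omega
  · intro d; have := h.hl3 d; have := hll d; omega
  · intro d; have := h.hlt d; have := hll d; push_cast; omega
  · intro d v hv
    rcases hC'm d v hv with hv | hv
    · exact Finset.mem_union_left _ (h.hCF d hv)
    · exact hv.2.1
  · intro d
    have ha := h.acc d
    rcases g5 d with g | g
    · have : C' d = C d := if_pos g.1
      rw [this, g.1, g.2.2.2.1]; exact ha
    · have e : C' d = C d ∪ rw' d (F ∪ Δ) (l' d) (A' d) (E' d) := if_neg (by have := g.1; omega)
      have hd : Disjoint (C d) (rw' d (F ∪ Δ) (l' d) (A' d) (E' d)) := by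
        rw [Finset.disjoint_left]; intro v h1 h2
        rw [rw', Finset.mem_filter] at h2
        have := h.hCb d v h1 d
        have := g.1; omega
      rw [e, Finset.card_union_of_disjoint hd]
      have h1 := g.1
      have h2 := g.2.2.2.1
      push_cast; omega
  · intro d hn
    rcases g5 d with g | g
    · exact (hn g.2.1).elim
    · exact g.2.1 hn
  · intro d hn
    rcases g5 d with g | g
    · exact (hn g.2.1).elim
    · exact hbd d g.1
  · intro d hn hn'
    rcases g5 d with g | g
    · exact (hn g.2.1).elim
    rcases g5 (d+1) with g' | g'
    · exact (hn' g'.2.1).elim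
    exact hcor d g.1 g'.1
  · intro d x hx; exact Or.inr ⟨d, x, hx, rfl⟩
  · intro d x hx
    refine ⟨(g4 d x hx).1, (g4 d x hx).2, fun hb => ?_⟩
    have := h.hB _ hb d
    rw [yy_cell] at this
    have := hnew d x hx; omega

open Classical in
noncomputable def mu (R : Fin 4 → Finset ℤ) (n : Fin 4 → ℕ) : ℕ ×ₗ ℕ :=
  toLex (if ∀ d, R d = ∅ then 0 else 1, n 0 + n 1 + n 2 + n 3)

lemma SI.init : ∃ C l A E R n z, SI 0 ∅ {v | ∀ d, yy d v ≤ 3} C l A E R n z := by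
  have h14 : 1 ≤ Ms 0 ^ 14 := Nat.one_le_pow _ _ (by have := one_le_Ms 0; omega)
  have key : ∀ d : Fin 4, ∃ R' ⊆ Finset.Icc (if d = 0 ∨ d = 2 then -3 else -2 : ℤ) (if d = 0 ∨ d = 2 then 3 else 2), ∃ n',
      SF d 0 ∅ 3 R' (if d = 0 ∨ d = 2 then -3 else -2) (if d = 0 ∨ d = 2 then 3 else 2) n'
        (if d = 0 ∨ d = 2 then 7 else 5) ∧ (n' = 0 → R' = ∅) := by
    intro d
    obtain ⟨R', h1, n', h2, h3, -⟩ := SF.start (R := Finset.Icc (if d = 0 ∨ d = 2 then -3 else -2 : ℤ) (if d = 0 ∨ d = 2 then 3 else 2))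
      (A := if d = 0 ∨ d = 2 then -3 else -2) (B := if d = 0 ∨ d = 2 then 3 else 2) d 0 ∅ 3 le_rfl 7 (by
      zify at h14; push_cast; split_ifs <;> omega) (by simp)
    refine ⟨R', h1, n', ?_, h3⟩
    convert h2 using 1
    rw [Int.card_Icc]; split_ifs <;> rfl
  choose R h1 n h2 h3 using key
  refine ⟨fun _ => ∅, fun _ => 3, _, _, R, n, _, ⟨by simp, by norm_num, fun v hv => hv, by simp, by simp, by simp, by simp, by simp, ?_, ?_,
    fun d _ => h2 d, ?_, ?_, ?_⟩⟩
  · intro d; split_ifs <;> simp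
  · intro d hd
    have h4 := h3 d hd
    have := h2 d
    rw [hd, h4] at this
    exact ⟨h4, this.zero⟩
  · intro d _; split_ifs <;> norm_num
  · intro d _ _; fin_cases d <;> simp
  · intro d x hx e
    have hx := Finset.mem_Icc.1 (h1 d hx)
    have q : -3 ≤ x ∧ x ≤ 3 := by split_ifs at hx <;> omega
    rcases fin4 d e with rfl | rfl | rfl | rfl
    · rw [yy_cell]
    · rw [yy_succ, xx_cell]; omega
    · rw [yy_opp, yy_cell]; omega
    · rw [yy_pred, xx_cell]; omega

lemma strong_spreader {C : ℝ} {q : ℝ} (hC : ((4 * (10 ^ 9 + 8 * 2 ^ 17 + 4) : ℕ):ℝ) * 2 ^ 84 ≤ C)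
    (h : q ∈ qSet adjStrong (fun t => (⌈C * (t : ℝ) ^ ((6 : ℝ) / 7)⌉₊ : ℕ∞))) : 3 < q := by
  classical
  by_contra hq
  push Not at hq
  obtain ⟨C0, l, A, E, R, n, z, h0⟩ := SI.init
  refine engine (h.2 {v | ∀ d, yy d v ≤ 3} ?_) (fun t μ F B => ∃ (Ff : Finset Z2) (C : Fin 4 → Finset Z2) (l A E : Fin 4 → ℤ)
    (R : Fin 4 → Finset ℤ) (n : Fin 4 → ℕ) (z : Fin 4 → ℤ), (Ff : Set Z2) = F ∧ μ = mu R n ∧ SI t Ff B C l A E R n z)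
    (mu R n) ⟨∅, C0, l, A, E, R, n, z, by simp, rfl, h0⟩ ?_
  · apply Set.Finite.subset (Set.finite_Icc ((-3, -3) : Z2) (3, 3))
    intro v hv
    have h0 := hv 0
    have h1 := hv 1
    have h2 := hv 2
    have h3 := hv 3
    simp only [yy] at h0 h1 h2 h3
    rw [Set.mem_Icc, Prod.le_def, Prod.le_def]
    simp only
    omega
  · rintro t μ _ B Δ ⟨Ff, C1, l, A, E, R, n, z, rfl, rfl, hS⟩ - hΔ
    have hΔ1 : Δ.encard ≤ (3:ℕ) := hΔ.trans (by exact_mod_cast budget_le (ρ := 3) (by simpa using hq) (t+1))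
    have hfin : Δ.Finite := Set.finite_of_encard_le_coe hΔ1
    lift Δ to Finset Z2 using hfin
    rw [Set.encard_coe_eq_coe_finsetCard] at hΔ1
    have hΔ1 : Δ.card ≤ 3 := by exact_mod_cast hΔ1
    obtain ⟨C', l', A', E', R', n', z', g1, g2, g3, g4⟩ := hS.step hΔ1
    refine ⟨_, _, ⟨Ff ∪ Δ, C', l', A', E', R', n', z', by simp, rfl, g1⟩, Set.subset_union_left, ?_, ?_, ?_⟩
    · refine le_trans ?_ (g_bound (t+1) (by omega) hC (k := (Finset.univ.biUnion (fun d => (R' d).image (fun x => cell d x (l' d)))).card) ?_)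
      · rw [← Set.encard_coe_eq_coe_finsetCard]
        apply Set.encard_le_encard
        rintro v ⟨hv | ⟨d, x, hx, rfl⟩, hv'⟩
        · exact (hv' hv).elim
        · simp only [Finset.coe_biUnion, Set.mem_iUnion, Finset.coe_image, Set.mem_image]
          exact ⟨d, by simp, x, hx, rfl⟩
      · refine Finset.card_biUnion_le.trans ((Finset.sum_le_sum (fun d _ => Finset.card_image_le.trans (g2 d))).trans ?_)
        simp; omega
    · rintro v ⟨hv | ⟨d, x, hx, rfl⟩, hv'⟩
      · exact (hv' hv).elim
      · have := g4 d x hx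
        refine ⟨?_, this.2.1⟩
        have := this.1
        rwa [← Finset.mem_coe, Finset.coe_union] at this
    · intro he
      have hR' : ∀ d, R' d = ∅ := by
        intro d
        rw [Finset.eq_empty_iff_forall_notMem]
        intro x hx
        apply (g4 d x hx).2.2
        rw [← he]; exact Or.inr ⟨d, x, hx, rfl⟩
      unfold mu
      rw [if_pos hR']
      by_cases hR : ∀ d, R d = ∅
      · rw [if_pos hR, Prod.Lex.toLex_lt_toLex]
        right
        refine ⟨rfl, ?_⟩
        have e0 := g3 hR 0
        have e1 := g3 hR 1
        have e2 := g3 hR 2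
        have e3 := g3 hR 3
        have : n 0 ≠ 0 ∨ n 1 ≠ 0 := by
          by_contra hh
          push Not at hh
          have := hS.one hh.1 hh.2
          simp at this
        simp only
        omega
      · rw [if_neg hR, Prod.Lex.toLex_lt_toLex]
        left; simp

end PartP6c

section PartP7

lemma container_win {V : Type*} [Countable V] {adj : V → V → Prop} {q : ℝ} {B₀ I : Set V} (hI : I.Finite) (W : Finset V)
    (hW : ∀ w ∈ W, w ∉ I) (nrm : V → ℕ) (r : ℕ) (hB₀ : ∀ v ∈ B₀, v ∈ I ∧ nrm v ≤ r)
    (hadj : ∀ u v, u ∈ I → adj u v → (v ∈ I ∨ v ∈ W) ∧ nrm v ≤ nrm u + 1)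
    (hall : ∀ t : ℕ, ((W.filter (fun w => nrm w ≤ r + t)).card : ℝ) ≤ t * q) : ContainerWins adj q (fun _ => ⊤) B₀ := by
  classical
  obtain ⟨j, hj⟩ := exists_injective_nat V
  let key : V → ℕ ×ₗ ℕ := fun v => toLex (nrm v, j v)
  have hkey : Function.Injective key := fun u v h => hj (by
    have := congrArg (fun p => (ofLex p).2) h
    simpa [key] using this)
  let rank : V → ℕ := fun v => (W.filter (fun w => key w < key v)).card
  have hmono : ∀ u ∈ W, ∀ v, key u < key v → rank u < rank v := by
    intro u hu v h
    apply Finset.card_lt_card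
    rw [Finset.ssubset_iff_of_subset]
    · exact ⟨u, by simp [hu, h], by simp⟩
    · intro w; simp only [Finset.mem_filter]; exact fun hw => ⟨hw.1, hw.2.trans h⟩
  have hinj : ∀ u ∈ W, ∀ v ∈ W, rank u = rank v → u = v := by
    intro u hu v hv h
    rcases lt_trichotomy (key u) (key v) with h1 | h1 | h1
    · have := hmono u hu v h1; omega
    · exact hkey h1
    · have := hmono v hv u h1; omega
  have hrank : ∀ u ∈ W, ∀ k, nrm u ≤ k → rank u < (W.filter (fun w => nrm w ≤ k)).card := by
    intro u hu k hk
    apply Finset.card_lt_card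
    rw [Finset.ssubset_iff_of_subset]
    · exact ⟨u, by simp [hu, hk], by simp⟩
    · intro w; simp only [Finset.mem_filter]
      rintro ⟨h1, h2⟩
      refine ⟨h1, ?_⟩
      rw [Prod.Lex.toLex_lt_toLex] at h2
      simp only at h2; omega
  let Sg : ℕ → Finset V := fun t => W.filter (fun w => ⌊((t:ℝ) - 1) * q⌋ ≤ rank w ∧ (rank w : ℤ) < ⌊(t:ℝ) * q⌋)
  refine ⟨fun L => Sg L.length, fun B hB hL => ?_⟩
  have hlen : ∀ t, ((List.range (t+1)).map B).length = t + 1 := by simp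
  have hdel : ∀ t : ℕ, ∀ w ∈ W, (rank w : ℤ) < ⌊(t:ℝ) * q⌋ → w ∈ delSets (fun L => (Sg L.length : Set V)) B t := by
    intro t
    induction t with
    | zero => intro w _ h; simp at h; omega
    | succ t ih =>
      intro w hw h
      rw [delSets]
      by_cases h1 : (rank w : ℤ) < ⌊(t:ℝ) * q⌋
      · exact Or.inl (ih w hw h1)
      · right
        rw [hlen]
        simp only [Sg, Finset.coe_filter, Set.mem_ofPred_eq]
        refine ⟨hw, ?_, h⟩
        push_cast; rw [add_sub_cancel_right]; omega
  have hin : ∀ t, ∀ v ∈ B t, v ∈ I ∧ nrm v ≤ r + t := by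
    intro t
    induction t with
    | zero => rw [hB]; exact hB₀
    | succ t ih =>
      intro v hv
      by_cases h1 : v ∈ B t
      · have := ih v h1; exact ⟨this.1, by omega⟩
      · obtain ⟨h2, u, hu, hv'⟩ := (hL t).2.2 v ⟨hv, h1⟩
        obtain ⟨u1, u2⟩ := ih u hu
        obtain ⟨h3, h4⟩ := hadj u v u1 hv'
        refine ⟨h3.resolve_right fun hvW => h2 (hdel _ v hvW ?_), by omega⟩
        have := hrank v hvW (r + (t+1)) (by omega)
        rw [Int.lt_iff_add_one_le, Int.le_floor]
        refine le_trans ?_ (hall (t+1))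
        exact_mod_cast this
  refine ⟨fun t => ⟨?_, ?_⟩, fun t => Set.subset_univ _, ?_⟩
  · beta_reduce; rw [hlen, Set.eq_empty_iff_forall_notMem]
    rintro v ⟨h1, h2⟩
    exact hW v (Finset.mem_filter.1 h1).1 (hin t v h2).1
  · beta_reduce; rw [hlen, Set.encard_coe_eq_coe_finsetCard, budget]
    have : (Sg (t+1)).card ≤ (Finset.Ico ⌊(((t+1 : ℕ):ℝ) - 1) * q⌋ ⌊((t+1 : ℕ):ℝ) * q⌋).card := by
      apply Finset.card_le_card_of_injOn (fun w => (rank w : ℤ))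
      · intro w hw
        have := (Finset.mem_filter.1 hw).2
        rw [Finset.mem_coe, Finset.mem_Ico]; exact this
      · intro u hu v hv h
        exact hinj u (Finset.mem_filter.1 hu).1 v (Finset.mem_filter.1 hv).1 (by simpa using h)
    rw [Int.card_Ico] at this
    exact_mod_cast this
  · have hfin : ∀ t, (B t).Finite := fun t => hI.subset (fun v hv => (hin t v hv).1)
    have hbd : BddAbove (Set.range (fun t => (B t).ncard)) := ⟨I.ncard, by
      rintro _ ⟨t, rfl⟩; exact Set.ncard_le_ncard (fun v hv => (hin t v hv).1) hI⟩
    obtain ⟨T, hT⟩ := Nat.sSup_mem (Set.range_nonempty _) hbd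
    have hmon : Monotone B := monotone_nat_of_le_succ (fun t => (hL t).1)
    refine ⟨T, fun t ht => (Set.eq_of_subset_of_ncard_le (hmon ht) ?_ (hfin t)).symm⟩
    have := le_csSup hbd ⟨t, rfl⟩
    simp only at hT this
    rw [hT]; exact this

lemma bdd_nrm {V : Type*} {B₀ : Set V} (h : B₀.Finite) (nrm : V → ℕ) : ∃ r, ∀ v ∈ B₀, nrm v ≤ r := by
  obtain ⟨r, hr⟩ := (h.image nrm).bddAbove
  exact ⟨r, fun v hv => hr ⟨v, hv, rfl⟩⟩

lemma ex_nat (x : ℝ) {ε : ℝ} (hε : 0 < ε) (m : ℕ) : ∃ L : ℕ, m < L ∧ x ≤ L * ε := by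
  obtain ⟨L0, hL0⟩ := exists_nat_ge (x / ε)
  refine ⟨max L0 (m+1), by omega, ?_⟩
  rw [div_le_iff₀ hε] at hL0
  refine hL0.trans ?_
  gcongr
  simp

lemma eighth_container {q : ℝ} (hq : 1 < q) : q ∈ qSet adjEighth (fun _ => ⊤) := by
  classical
  refine ⟨by linarith, fun B₀ hB => ?_⟩
  obtain ⟨r, hr⟩ := bdd_nrm hB (fun v : ZEighth => v.val.2.toNat)
  obtain ⟨L, hL1, hL2⟩ := ex_nat (r * q + 1) (sub_pos.2 hq) r
  have hfin : {v : ZEighth | v.val.2 ≤ L}.Finite := by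
    apply Set.Finite.of_finite_image _ (Subtype.val_injective.injOn)
    apply Set.Finite.subset (Set.finite_Icc ((0, 0) : Z2) (L, L))
    rintro _ ⟨⟨v, h1, h2⟩, hv, rfl⟩
    simp only [Set.mem_ofPred_eq] at hv
    rw [Set.mem_Icc, Prod.le_def, Prod.le_def]
    simp only; omega
  have hWf : {v : ZEighth | v.val.2 = L}.Finite := hfin.subset (fun v hv => le_of_eq hv)
  have hcard : hWf.toFinset.card ≤ L + 1 := by
    have : hWf.toFinset.card ≤ (Finset.Icc (0:ℤ) L).card := by
      apply Finset.card_le_card_of_injOn (fun v => v.val.1)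
      · intro v hv
        have := v.2
        simp at hv ⊢; omega
      · intro u hu v hv h
        simp at hu hv h
        apply Subtype.ext; apply Prod.ext h; omega
    rw [Int.card_Icc] at this; omega
  refine container_win (I := {v : ZEighth | v.val.2 < L}) (hfin.subset fun v (hv : v.val.2 < L) => hv.le) hWf.toFinset ?_
    (fun v => v.val.2.toNat) r ?_ ?_ ?_
  · intro w hw; simp at hw ⊢; omega
  · intro v hv
    have h1 := hr v hv
    have := v.2
    refine ⟨?_, h1⟩
    simp only [Set.mem_ofPred_eq]; omega
  · intro u v hu h
    have := v.2; have := u.2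
    simp only [adjEighth, Set.mem_ofPred_eq, Set.Finite.mem_toFinset] at *
    omega
  · intro t
    by_cases ht : r + t < L
    · rw [Finset.filter_false_of_mem]
      · simp; positivity
      · intro w hw; simp at hw; omega
    · have h1 : ((hWf.toFinset.filter (fun w => w.val.2.toNat ≤ r + t)).card : ℝ) ≤ L + 1 := by
        exact_mod_cast (Finset.card_filter_le _ _).trans hcard
      have h2 : (L:ℝ) ≤ r + t := by exact_mod_cast not_lt.1 ht
      refine h1.trans ?_
      nlinarith

lemma strong_container {q : ℝ} (hq : 3 < q) : q ∈ qSet adjStrong (fun _ => ⊤) := by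
  classical
  refine ⟨by linarith, fun B₀ hB => ?_⟩
  set nrm : Z2 → ℕ := fun v => max v.1.natAbs v.2.natAbs with hn
  obtain ⟨r, hr⟩ := bdd_nrm hB nrm
  have he : 0 < q - 3 := by linarith
  obtain ⟨c, hc1, hc2⟩ := ex_nat (r * q + 1) one_pos r
  obtain ⟨L1, hL1, hL1'⟩ := ex_nat (c + 1 + r * q) he c
  obtain ⟨L2, hL2, hL2'⟩ := ex_nat (L1 + 2 * c + 1 + r * q) he L1
  obtain ⟨L3, hL3, hL3'⟩ := ex_nat (2 * L1 + 2 * L2 + 2 * c + 4 + r * q) one_pos L2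
  set N : Finset Z2 := Finset.Icc (-(L2:ℤ)) L1 ×ˢ {(c:ℤ)} with hN
  set E : Finset Z2 := {(L1:ℤ)} ×ˢ Finset.Icc (-(L3:ℤ)) (c-1) with hE
  set W : Finset Z2 := {-(L2:ℤ)} ×ˢ Finset.Icc (-(L3:ℤ)) (c-1) with hW
  set S : Finset Z2 := Finset.Icc (-(L2:ℤ)) L1 ×ˢ {-(L3:ℤ)} with hS
  have hmem : ∀ v : Z2, v ∈ N ∪ E ∪ W ∪ S ↔ (-(L2:ℤ) ≤ v.1 ∧ v.1 ≤ L1 ∧ v.2 = c) ∨ (v.1 = L1 ∧ -(L3:ℤ) ≤ v.2 ∧ v.2 ≤ c - 1) ∨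
      (v.1 = -L2 ∧ -(L3:ℤ) ≤ v.2 ∧ v.2 ≤ c - 1) ∨ (-(L2:ℤ) ≤ v.1 ∧ v.1 ≤ L1 ∧ v.2 = -L3) := by
    intro v
    simp only [hN, hE, hW, hS, Finset.mem_union, Finset.mem_product, Finset.mem_Icc, Finset.mem_singleton]
    tauto
  refine container_win (I := {v : Z2 | -(L2:ℤ) < v.1 ∧ v.1 < L1 ∧ -(L3:ℤ) < v.2 ∧ v.2 < c}) ?_ (N ∪ E ∪ W ∪ S) ?_ nrm r ?_ ?_ ?_
  · apply Set.Finite.subset (Set.finite_Icc ((-(L2:ℤ), -(L3:ℤ)) : Z2) (L1, c))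
    intro v hv
    simp only [Set.mem_ofPred_eq] at hv
    rw [Set.mem_Icc, Prod.le_def, Prod.le_def]
    simp only; omega
  · intro w hw
    rw [hmem] at hw
    simp only [Set.mem_ofPred_eq]; omega
  · intro v hv
    have := hr v hv
    refine ⟨?_, this⟩
    simp only [hn, Set.mem_ofPred_eq] at *; omega
  · intro u v hu h
    have h1 : |u.1 - v.1| ≤ 1 := by rw [← show max |u.1 - v.1| |u.2 - v.2| = 1 from h]; exact le_max_left _ _
    have h2 : |u.2 - v.2| ≤ 1 := by rw [← show max |u.1 - v.1| |u.2 - v.2| = 1 from h]; exact le_max_right _ _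
    rw [abs_le] at h1 h2
    rw [hmem]
    simp only [hn, Set.mem_ofPred_eq] at *
    omega
  · intro t
    obtain ⟨s, hs⟩ : ∃ s, s = r + t := ⟨_, rfl⟩
    rw [← hs]
    have k1 : ∃ k : ℕ, (N.filter (fun w => nrm w ≤ s)).card ≤ k ∧ k ≤ min s L1 + min s L2 + 1 ∧ (s < c → k = 0) := by
      refine ⟨_, le_rfl, ?_, ?_⟩
      · have : N.filter (fun w => nrm w ≤ s) ⊆ Finset.Icc (-((min s L2 : ℕ):ℤ)) ((min s L1 : ℕ):ℤ) ×ˢ {(c:ℤ)} := by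
          intro v; simp only [hn, hN, Finset.mem_filter, Finset.mem_product, Finset.mem_Icc, Finset.mem_singleton]; omega
        have := Finset.card_le_card this
        rw [Finset.card_product, Int.card_Icc, Finset.card_singleton] at this; omega
      · intro h
        rw [Finset.card_eq_zero, Finset.filter_eq_empty_iff]
        intro v; simp only [hn, hN, Finset.mem_product, Finset.mem_Icc, Finset.mem_singleton]; omega
    have k2 : ∀ (a : ℤ), ∃ k : ℕ, ((({a} ×ˢ Finset.Icc (-(L3:ℤ)) (c-1) : Finset Z2)).filter (fun w => nrm w ≤ s)).card ≤ k ∧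
        k ≤ min s L3 + c ∧ (s < a.natAbs → k = 0) := by
      intro a
      refine ⟨_, le_rfl, ?_, ?_⟩
      · have : ((({a} ×ˢ Finset.Icc (-(L3:ℤ)) (c-1) : Finset Z2)).filter (fun w => nrm w ≤ s)) ⊆
            {a} ×ˢ Finset.Icc (-((min s L3 : ℕ):ℤ)) (c-1) := by
          intro v; simp only [hn, Finset.mem_filter, Finset.mem_product, Finset.mem_Icc, Finset.mem_singleton]; omega
        have := Finset.card_le_card this
        rw [Finset.card_product, Int.card_Icc, Finset.card_singleton] at this; omega
      · intro h
        rw [Finset.card_eq_zero, Finset.filter_eq_empty_iff]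
        intro v; simp only [hn, Finset.mem_product, Finset.mem_Icc, Finset.mem_singleton]; omega
    have k4 : ∃ k : ℕ, (S.filter (fun w => nrm w ≤ s)).card ≤ k ∧ k ≤ L1 + L2 + 1 ∧ (s < L3 → k = 0) := by
      refine ⟨_, le_rfl, ?_, ?_⟩
      · refine (Finset.card_filter_le _ _).trans ?_
        rw [hS, Finset.card_product, Int.card_Icc, Finset.card_singleton]; omega
      · intro h
        rw [Finset.card_eq_zero, Finset.filter_eq_empty_iff]
        intro v; simp only [hn, hS, Finset.mem_product, Finset.mem_Icc, Finset.mem_singleton]; omega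
    obtain ⟨n1, a1, b1, c1⟩ := k1
    obtain ⟨n2, a2, b2, c2⟩ := k2 L1
    obtain ⟨n3, a3, b3, c3⟩ := k2 (-L2)
    obtain ⟨n4, a4, b4, c4⟩ := k4
    obtain ⟨m, hm⟩ : ∃ m, m = ((N ∪ E ∪ W ∪ S).filter (fun w => nrm w ≤ s)).card := ⟨_, rfl⟩
    have htot : m ≤ n1 + n2 + n3 + n4 := by
      rw [hm, Finset.filter_union, Finset.filter_union, Finset.filter_union]
      refine (Finset.card_union_le _ _).trans (add_le_add ((Finset.card_union_le _ _).trans (add_le_add ((Finset.card_union_le _ _).trans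
        (add_le_add a1 a2)) a3)) a4)
    rw [← hm]
    clear_value nrm N E W S
    clear hm a1 a2 a3 a4 hmem k2
    rw [Int.natAbs_neg, Int.natAbs_natCast] at c3
    rw [Int.natAbs_natCast] at c2
    have hsr : (t:ℝ) = s - r := by rw [hs]; push_cast; ring
    have cc : m = 0 ∨ (c ≤ s ∧ m ≤ 2 * s + 1) ∨ (L1 ≤ s ∧ m ≤ 2 * s + L1 + c + 1) ∨ (L2 ≤ s ∧ m ≤ 2 * s + L1 + L2 + 2 * c + 1) ∨
        (L3 ≤ s ∧ m ≤ 2 * L1 + 2 * L2 + 2 * L3 + 2 * c + 4) := by omega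
    rcases cc with h | ⟨h, h'⟩ | ⟨h, h'⟩ | ⟨h, h'⟩ | ⟨h, h'⟩
    · rw [h]; push_cast; have : 0 < q := by linarith
      positivity
    all_goals
      have h := (Nat.cast_le (α := ℝ)).2 h
      have h' := (Nat.cast_le (α := ℝ)).2 h'
      push_cast at h h'
      rw [hsr]
      refine h'.trans ?_
      nlinarith

end PartP7

theorem top_subset_qSet {V : Type*} (adj : V → V → Prop) (g : ℕ → ℕ∞) :
    qSet adj (fun _ => (⊤ : ℕ∞)) ⊆ qSet adj g := by
  rintro q ⟨hq, h⟩
  refine ⟨hq, fun B₀ hB => ?_⟩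
  obtain ⟨σ, hσ⟩ := h B₀ hB
  exact ⟨σ, fun B h0 hl => hσ B h0 (fun t => ⟨(hl t).1, le_top, (hl t).2.2⟩)⟩

/-- **Theorem (sub-linear win).** For each of the graphs `Z_eighth` and `Z_strong`
there is a threshold `C₀ > 0` such that for every `C ≥ C₀`, against the spreading
function `g(t) = ⌈C·t^{6/7}⌉` Container wins for exactly the same set of strengths
`q` as in the Firefighter Problem solitaire (unrestricted spreading). -/
theorem sublinear_spread_equals_unrestricted :
    (∃ C₀ : ℝ, 0 < C₀ ∧ ∀ C : ℝ, C₀ ≤ C →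
      qSet adjEighth (fun t => (⌈C * (t : ℝ) ^ ((6 : ℝ) / 7)⌉₊ : ℕ∞)) =
        qSet adjEighth (fun _ => (⊤ : ℕ∞))) ∧
    (∃ C₀ : ℝ, 0 < C₀ ∧ ∀ C : ℝ, C₀ ≤ C →
      qSet adjStrong (fun t => (⌈C * (t : ℝ) ^ ((6 : ℝ) / 7)⌉₊ : ℕ∞)) =
        qSet adjStrong (fun _ => (⊤ : ℕ∞))) := by
  refine ⟨⟨((10 ^ 9 + 8 * 2 ^ 16 + 4 : ℕ):ℝ) * 2 ^ 84, by positivity, fun C hC => ?_⟩,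
    ⟨((4 * (10 ^ 9 + 8 * 2 ^ 17 + 4) : ℕ):ℝ) * 2 ^ 84, by positivity, fun C hC => ?_⟩⟩
  · exact Set.Subset.antisymm (fun q h => eighth_container (eighth_spreader hC h))
      (top_subset_qSet _ _)
  · exact Set.Subset.antisymm (fun q h => strong_container (strong_spreader hC h))
      (top_subset_qSet _ _)
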